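/- Let Γ be a lattice in G = SL(2,ℝ) and let x₀ ∈ Γ\G be a point whose forward H-trajectory diverges (x₀h(s) leaves every compact subset of Γ\G as s → +∞). Then for every smooth compactly supported function ψ on Γ\G there exists a constant C₀ > 0 such that for all real T with |T| > 1, |∫₀^{|T|} ψ(x₀h(s)a(T)) ds − |T|·∫_{Γ\G} ψ dμ| ≤ C₀. -/

import Mathlib

noncomputable section
open MeasureTheory Matrix Filter Topology

abbrev SL2 : Type := Matrix.SpecialLinearGroup (Fin 2) ℝ

instance : TopologicalSpace SL2 :=
  TopologicalSpace.induced (fun g : SL2 => (g : Matrix (Fin 2) (Fin 2) ℝ)) inferInstance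

instance : MeasurableSpace SL2 := borel SL2

/-- `h(s) = [[cosh(s/2), sinh(s/2)], [sinh(s/2), cosh(s/2)]]` -/
def hmat (s : ℝ) : SL2 :=
  ⟨!![Real.cosh (s/2), Real.sinh (s/2); Real.sinh (s/2), Real.cosh (s/2)], by
    rw [Matrix.det_fin_two_of]
    nlinarith [Real.cosh_sq_sub_sinh_sq (s/2)]⟩

/-- `a(t) = [[e^{t/2}, 0], [0, e^{-t/2}]]` -/
def amat (t : ℝ) : SL2 :=
  ⟨!![Real.exp (t/2), 0; 0, Real.exp (-(t/2))], by
    rw [Matrix.det_fin_two_of]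
    rw [← Real.exp_add]
    simp⟩

/-- the quotient `Γ\G` by right cosets `Γg` -/
def XQuot (Γ : Subgroup SL2) : Type := Quotient (QuotientGroup.rightRel Γ)

instance (Γ : Subgroup SL2) : TopologicalSpace (XQuot Γ) :=
  inferInstanceAs (TopologicalSpace (Quotient (QuotientGroup.rightRel Γ)))

instance (Γ : Subgroup SL2) : MeasurableSpace (XQuot Γ) := borel (XQuot Γ)

/-- the natural projection `G → Γ\G`, `g ↦ Γg` -/
def qmk (Γ : Subgroup SL2) (g : SL2) : XQuot Γ := Quotient.mk (QuotientGroup.rightRel Γ) g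

/-- the right action of `G` on `Γ\G`: `(Γg)g' = Γgg'`. -/
def rmul (Γ : Subgroup SL2) (x : XQuot Γ) (g : SL2) : XQuot Γ :=
  Quotient.map' (fun h => h * g)
    (fun a b hab => by
      rw [QuotientGroup.rightRel_apply] at hab ⊢
      simpa [mul_assoc] using hab) x

/-- `Γ` is a lattice in `SL(2,ℝ)`: a discrete subgroup of finite covolume. -/
def IsLatticeSL2 (Γ : Subgroup SL2) : Prop :=
  DiscreteTopology Γ ∧
    ∃ μG : Measure SL2, μG.IsHaarMeasure ∧
      ∃ F : Set SL2, IsFundamentalDomain Γ F μG ∧ μG F ≠ ⊤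

/-- a function on `Γ\G` is smooth iff its lift to `G ⊆ M₂(ℝ) = ℝ⁴` extends to a smooth
function on the ambient matrix space (equivalently, it is smooth on the manifold `Γ\G`). -/
def IsSmoothQuot (Γ : Subgroup SL2) (ψ : XQuot Γ → ℝ) : Prop :=
  ∃ Ψ : (Fin 2 → Fin 2 → ℝ) → ℝ, ContDiff ℝ (⊤ : ℕ∞) Ψ ∧
    ∀ g : SL2, ψ (qmk Γ g) = Ψ (fun i j => (g : Matrix (Fin 2) (Fin 2) ℝ) i j)

/-- The entrywise `ℓ¹` norm of a `2 × 2` matrix. -/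
def nm (M : Matrix (Fin 2) (Fin 2) ℝ) : ℝ := |M 0 0| + |M 0 1| + |M 1 0| + |M 1 1|

lemma nm_nonneg (M : Matrix (Fin 2) (Fin 2) ℝ) : 0 ≤ nm M := by unfold nm; positivity

lemma nm_add_le (M N : Matrix (Fin 2) (Fin 2) ℝ) : nm (M + N) ≤ nm M + nm N := by
  simp only [nm, Matrix.add_apply]
  linarith [abs_add_le (M 0 0) (N 0 0), abs_add_le (M 0 1) (N 0 1), abs_add_le (M 1 0) (N 1 0),
    abs_add_le (M 1 1) (N 1 1)]

lemma nm_smul (c : ℝ) (M : Matrix (Fin 2) (Fin 2) ℝ) : nm (c • M) = |c| * nm M := by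
  simp only [nm, Matrix.smul_apply, smul_eq_mul, abs_mul]; ring

lemma nm_neg (M : Matrix (Fin 2) (Fin 2) ℝ) : nm (-M) = nm M := by
  simp [nm]

lemma nm_sub_le (M N : Matrix (Fin 2) (Fin 2) ℝ) : nm (M - N) ≤ nm M + nm N := by
  rw [sub_eq_add_neg, ← nm_neg N]; exact nm_add_le _ _

lemma nm_mul_le (M N : Matrix (Fin 2) (Fin 2) ℝ) : nm (M * N) ≤ nm M * nm N := by
  have key : ∀ i j, |(M * N) i j| ≤ |M i 0| * |N 0 j| + |M i 1| * |N 1 j| := fun i j => by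
    rw [Matrix.mul_apply, Fin.sum_univ_two, ← abs_mul, ← abs_mul]; exact abs_add_le _ _
  have h00 := key 0 0
  have h01 := key 0 1
  have h10 := key 1 0
  have h11 := key 1 1
  have p : ∀ i j k l, 0 ≤ |M i j| * |N k l| := fun i j k l => by positivity
  simp only [nm]
  linarith [p 0 0 1 0, p 0 0 1 1, p 0 1 0 0, p 0 1 0 1, p 1 0 1 0, p 1 0 1 1, p 1 1 0 0,
    p 1 1 0 1]

lemma nm_eq_zero {M : Matrix (Fin 2) (Fin 2) ℝ} : nm M = 0 ↔ M = 0 := by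
  constructor
  · intro h
    simp only [nm] at h
    have h0 := abs_nonneg (M 0 0)
    have h1 := abs_nonneg (M 0 1)
    have h2 := abs_nonneg (M 1 0)
    have h3 := abs_nonneg (M 1 1)
    ext i j
    fin_cases i <;> fin_cases j <;> simp only [Fin.zero_eta, Fin.mk_one, Matrix.zero_apply] <;>
      exact abs_eq_zero.mp (by linarith)
  · rintro rfl; simp [nm]

lemma nm_pos {M : Matrix (Fin 2) (Fin 2) ℝ} (h : M ≠ 0) : 0 < nm M :=
  lt_of_le_of_ne (nm_nonneg M) fun h' => h (nm_eq_zero.mp h'.symm)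

lemma nm_one : nm 1 = 2 := by simp [nm]; norm_num

lemma abs_entry_le_nm (M : Matrix (Fin 2) (Fin 2) ℝ) (i j : Fin 2) : |M i j| ≤ nm M := by
  have h0 := abs_nonneg (M 0 0)
  have h1 := abs_nonneg (M 0 1)
  have h2 := abs_nonneg (M 1 0)
  have h3 := abs_nonneg (M 1 1)
  fin_cases i <;> fin_cases j <;> simp only [nm, Fin.zero_eta, Fin.mk_one] <;> linarith

@[fun_prop]
lemma continuous_nm : Continuous nm := by
  unfold nm; fun_prop

lemma SL2_det (g : SL2) : g.1 0 0 * g.1 1 1 - g.1 0 1 * g.1 1 0 = 1 := by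
  have := g.2
  rwa [Matrix.det_fin_two] at this

lemma SL2_inv_coe (g : SL2) : (g⁻¹).1 = !![g.1 1 1, -g.1 0 1; -g.1 1 0, g.1 0 0] := by
  rw [Matrix.SpecialLinearGroup.SL2_inv_expl]; rfl

lemma SL2_mul_coe (g h : SL2) : (g * h).1 = g.1 * h.1 := rfl

lemma SL2_mul_inv_coe (g : SL2) : g.1 * (g⁻¹).1 = 1 := by
  rw [← SL2_mul_coe, mul_inv_cancel]; rfl

lemma SL2_inv_mul_coe (g : SL2) : (g⁻¹).1 * g.1 = 1 := by
  rw [← SL2_mul_coe, inv_mul_cancel]; rfl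

lemma nm_inv (g : SL2) : nm (g⁻¹).1 = nm g.1 := by
  rw [SL2_inv_coe]; simp [nm]; ring

lemma nm_SL2_ge_one (g : SL2) : 1 ≤ nm g.1 := by
  have h := nm_mul_le g.1 (g⁻¹).1
  rw [SL2_mul_inv_coe, nm_one, nm_inv] at h
  nlinarith [nm_nonneg g.1]

/-- The distance of `g` to the identity in the entrywise `ℓ¹` norm. -/
def dev (g : SL2) : ℝ := nm (g.1 - 1)

lemma dev_nonneg (g : SL2) : 0 ≤ dev g := nm_nonneg _

lemma dev_one : dev 1 = 0 := by
  simp [dev, nm]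

lemma dev_inv (g : SL2) : dev g⁻¹ = dev g := by
  simp only [dev, SL2_inv_coe, nm, Matrix.sub_apply]
  simp
  ring

lemma nm_le_dev (g : SL2) : nm g.1 ≤ 2 + dev g := by
  have := nm_add_le 1 (g.1 - 1)
  rw [add_sub_cancel, nm_one] at this
  exact this

lemma dev_conj_le (p g : SL2) : dev (p⁻¹ * g * p) ≤ nm p.1 ^ 2 * dev g := by
  have h : (p⁻¹ * g * p).1 - 1 = (p⁻¹).1 * (g.1 - 1) * p.1 := by
    rw [mul_sub, sub_mul, mul_one, SL2_inv_mul_coe]; rfl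
  unfold dev
  rw [h]
  refine (nm_mul_le _ _).trans ?_
  have := nm_mul_le (p⁻¹).1 (g.1 - 1)
  rw [nm_inv] at this
  nlinarith [nm_nonneg p.1]

lemma SL2_ext' {g h : SL2} (H : g.1 = h.1) : g = h := Subtype.ext H

lemma continuous_coe_SL2 : Continuous (fun g : SL2 => g.1) := continuous_induced_dom

lemma continuous_SL2_iff {X : Type*} [TopologicalSpace X] {f : X → SL2} :
    Continuous f ↔ Continuous (fun x => (f x).1) := continuous_induced_rng

instance : IsTopologicalGroup SL2 where
  continuous_mul := by
    rw [continuous_SL2_iff]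
    exact (continuous_coe_SL2.comp continuous_fst).matrix_mul
      (continuous_coe_SL2.comp continuous_snd)
  continuous_inv := by
    rw [continuous_SL2_iff]
    have : (fun g : SL2 => (g⁻¹).1) = fun g : SL2 => g.1.adjugate := by
      ext g; rw [Matrix.SpecialLinearGroup.coe_inv]
    rw [this]
    exact continuous_coe_SL2.matrix_adjugate

lemma isEmbedding_coe_SL2 : IsEmbedding (fun g : SL2 => g.1) :=
  ⟨⟨rfl⟩, fun _ _ h => Subtype.ext h⟩

instance : SecondCountableTopology SL2 :=
  have : SecondCountableTopology (Matrix (Fin 2) (Fin 2) ℝ) :=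
    inferInstanceAs (SecondCountableTopology (Fin 2 → Fin 2 → ℝ))
  isEmbedding_coe_SL2.secondCountableTopology

instance : T2Space SL2 := isEmbedding_coe_SL2.t2Space

instance : BorelSpace SL2 := ⟨rfl⟩

lemma isClosedEmbedding_coe_SL2 : IsClosedEmbedding (fun g : SL2 => g.1) := by
  refine ⟨isEmbedding_coe_SL2, ?_⟩
  have : Set.range (fun g : SL2 => g.1) = {M : Matrix (Fin 2) (Fin 2) ℝ | M.det = 1} := by
    ext M; exact ⟨fun ⟨g, hg⟩ => hg ▸ g.2, fun h => ⟨⟨M, h⟩, rfl⟩⟩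
  rw [this]
  exact isClosed_eq (Continuous.matrix_det continuous_id) continuous_const

lemma isCompact_nm_le (C : ℝ) : IsCompact {g : SL2 | nm g.1 ≤ C} := by
  have hK : IsCompact {M : Matrix (Fin 2) (Fin 2) ℝ | nm M ≤ C} := by
    have h1 : IsCompact (Set.univ.pi fun _ : Fin 2 => Set.univ.pi fun _ : Fin 2 =>
        Set.Icc (-C) C) :=
      isCompact_univ_pi fun _ => isCompact_univ_pi fun _ => isCompact_Icc
    refine h1.of_isClosed_subset (isClosed_le continuous_nm continuous_const) ?_
    intro M hM i _ j _
    exact abs_le.mp ((abs_entry_le_nm M i j).trans hM)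
  exact isClosedEmbedding_coe_SL2.isCompact_preimage hK

lemma continuous_dev : Continuous dev :=
  continuous_nm.comp (continuous_coe_SL2.sub continuous_const)

/-- The traceless part of a `2 × 2` matrix. -/
def tl (M : Matrix (Fin 2) (Fin 2) ℝ) : Matrix (Fin 2) (Fin 2) ℝ := M - (M.trace / 2) • 1

lemma tl_explicit (M : Matrix (Fin 2) (Fin 2) ℝ) :
    tl M = !![(M 0 0 - M 1 1) / 2, M 0 1; M 1 0, -((M 0 0 - M 1 1) / 2)] := by
  ext i j
  fin_cases i <;> fin_cases j <;> simp [tl, Matrix.trace_fin_two] <;> ring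

lemma nm_tl (M : Matrix (Fin 2) (Fin 2) ℝ) :
    nm (tl M) = |M 0 0 - M 1 1| + |M 0 1| + |M 1 0| := by
  rw [tl_explicit]; simp [nm, abs_div]; ring

lemma nm_tl_le_dev (g : SL2) : nm (tl g.1) ≤ dev g := by
  rw [nm_tl]
  simp only [dev, nm, Matrix.sub_apply]
  have := abs_sub (g.1 0 0 - 1) (g.1 1 1 - 1)
  simp at this ⊢
  linarith

lemma tl_conj (p : SL2) (M : Matrix (Fin 2) (Fin 2) ℝ) :
    tl ((p⁻¹).1 * M * p.1) = (p⁻¹).1 * tl M * p.1 := by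
  have ht : ((p⁻¹).1 * M * p.1).trace = M.trace := by
    rw [Matrix.trace_mul_comm, ← mul_assoc, SL2_mul_inv_coe, one_mul]
  simp only [tl, ht, mul_sub, sub_mul, Matrix.mul_smul, Matrix.smul_mul, mul_one,
    SL2_inv_mul_coe]

lemma nm_conj_le (p : SL2) (M : Matrix (Fin 2) (Fin 2) ℝ) :
    nm ((p⁻¹).1 * M * p.1) ≤ nm p.1 ^ 2 * nm M := by
  refine (nm_mul_le _ _).trans ?_
  have := nm_mul_le (p⁻¹).1 M
  rw [nm_inv] at this
  nlinarith [nm_nonneg p.1]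

lemma nm_conj_ge (p : SL2) (M : Matrix (Fin 2) (Fin 2) ℝ) :
    nm M ≤ nm p.1 ^ 2 * nm ((p⁻¹).1 * M * p.1) := by
  have h := nm_conj_le p⁻¹ ((p⁻¹).1 * M * p.1)
  rw [inv_inv, nm_inv] at h
  have e : p.1 * ((p⁻¹).1 * M * p.1) * (p⁻¹).1 = M := by
    rw [← mul_assoc, ← mul_assoc, SL2_mul_inv_coe, one_mul, mul_assoc, SL2_mul_inv_coe, mul_one]
  rwa [e] at h

lemma nm_conj_le_dev (p : SL2) (M : Matrix (Fin 2) (Fin 2) ℝ) :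
    nm ((p⁻¹).1 * M * p.1) ≤ (1 + 2 * nm p.1 * dev p) * nm M := by
  have e : (p⁻¹).1 * M * p.1 = M + (p⁻¹).1 * (M * (p.1 - 1) - (p.1 - 1) * M) := by
    have h := SL2_inv_mul_coe p
    simp only [mul_sub, sub_mul, mul_one, one_mul, ← mul_assoc, h]
    abel
  rw [e]
  refine (nm_add_le _ _).trans ?_
  have h1 := nm_mul_le (p⁻¹).1 (M * (p.1 - 1) - (p.1 - 1) * M)
  have h2 := nm_sub_le (M * (p.1 - 1)) ((p.1 - 1) * M)
  have h3 := nm_mul_le M (p.1 - 1)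
  have h4 := nm_mul_le (p.1 - 1) M
  rw [nm_inv] at h1
  have h5 : nm (M * (p.1 - 1) - (p.1 - 1) * M) ≤ 2 * (dev p * nm M) := by
    unfold dev; linarith
  have := mul_le_mul_of_nonneg_left h5 (nm_nonneg p.1)
  linarith

lemma SL2_eq_of_tl_eq_zero {g : SL2} (h : tl g.1 = 0) (hd : dev g < 1) : g = 1 := by
  have h1 := nm_eq_zero.mpr h
  rw [nm_tl] at h1
  have a0 := abs_nonneg (g.1 0 0 - g.1 1 1)
  have a1 := abs_nonneg (g.1 0 1)
  have a2 := abs_nonneg (g.1 1 0)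
  have e0 : g.1 0 0 - g.1 1 1 = 0 := abs_eq_zero.mp (by linarith)
  have e1 : g.1 0 1 = 0 := abs_eq_zero.mp (by linarith)
  have e2 : g.1 1 0 = 0 := abs_eq_zero.mp (by linarith)
  have hdet := SL2_det g
  have hd0 := (abs_entry_le_nm (g.1 - 1) 0 0).trans_lt hd
  simp only [Matrix.sub_apply, Matrix.one_apply_eq] at hd0
  rw [abs_lt] at hd0
  have e3 : g.1 1 1 = g.1 0 0 := by linarith
  rw [e1, e2, e3] at hdet
  have e4 : (g.1 0 0 - 1) * (g.1 0 0 + 1) = 0 := by linarith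
  have e5 : g.1 0 0 = 1 := by
    rcases mul_eq_zero.mp e4 with h | h <;> linarith
  apply SL2_ext'
  ext i j
  fin_cases i <;> fin_cases j <;> simp [e1, e2, e3, e5]

lemma tl_sq (g : SL2) : tl (g * g).1 = g.1.trace • tl g.1 := by
  have hdet := SL2_det g
  rw [tl_explicit, tl_explicit, SL2_mul_coe]
  ext i j
  fin_cases i <;> fin_cases j <;> simp [Matrix.mul_apply, Matrix.trace_fin_two] <;> ring

/-- The determinant relation between trace and traceless part. -/
lemma trace_sq (g : SL2) : (g.1.trace / 2) ^ 2 =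
    1 + ((g.1 0 0 - g.1 1 1) / 2) ^ 2 + g.1 0 1 * g.1 1 0 := by
  have hdet := SL2_det g
  rw [Matrix.trace_fin_two]; linarith

lemma trace_bounds (g : SL2) (h : nm (tl g.1) ≤ 1 / 2) :
    |g.1.trace / 2| ≤ 3 / 2 ∧ g.1.trace ≠ 0 ∧
    |(g.1.trace / 2) ^ 2 - 1| ≤ nm (tl g.1) ^ 2 := by
  have ht := trace_sq g
  have hn := nm_tl g.1
  have a0 := abs_nonneg (g.1 0 0 - g.1 1 1)
  have a1 := abs_nonneg (g.1 0 1)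
  have a2 := abs_nonneg (g.1 1 0)
  have e : |(g.1.trace / 2) ^ 2 - 1| ≤ nm (tl g.1) ^ 2 := by
    rw [ht, add_assoc, add_sub_cancel_left]
    refine (abs_add_le _ _).trans ?_
    rw [abs_mul, abs_pow, abs_div, hn]
    norm_num
    nlinarith [mul_nonneg a0 a1, mul_nonneg a0 a2, mul_nonneg a1 a2]
  have e2 := abs_le.mp e
  have e3 : nm (tl g.1) ^ 2 ≤ 1 / 4 := by nlinarith [nm_nonneg (tl g.1)]
  refine ⟨abs_le_of_sq_le_sq (by nlinarith) (by norm_num) , ?_, e⟩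
  intro h0
  rw [h0] at e2
  linarith [e2.1]

lemma nm_le_of_tl (g : SL2) (h : nm (tl g.1) ≤ 1 / 2) : nm g.1 ≤ 4 := by
  have e : g.1 = tl g.1 + (g.1.trace / 2) • 1 := by simp [tl]
  have h1 := nm_add_le (tl g.1) ((g.1.trace / 2) • 1)
  rw [← e, nm_smul, nm_one] at h1
  linarith [(trace_bounds g h).1]

lemma dev_sq_le (g : SL2) (h : nm (tl g.1) ≤ 1 / 2) : dev (g * g) ≤ 6 * nm (tl g.1) := by
  obtain ⟨h1, -, h3⟩ := trace_bounds g h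
  have e : (g * g).1 - 1 = (2 * ((g.1.trace / 2) ^ 2 - 1)) • 1 + g.1.trace • tl g.1 := by
    have h4 := tl_sq g
    have h5 : (g * g).1 = tl (g * g).1 + ((g * g).1.trace / 2) • 1 := by simp [tl]
    have h6 : (g * g).1.trace / 2 = 2 * (g.1.trace / 2) ^ 2 - 1 := by
      have hdet := SL2_det g
      rw [SL2_mul_coe]
      simp only [Matrix.trace_fin_two, Matrix.mul_apply, Fin.sum_univ_two]
      nlinarith
    rw [h5, h4, h6]
    module
  unfold dev
  rw [e]
  refine (nm_add_le _ _).trans ?_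
  rw [nm_smul, nm_smul, nm_one, abs_mul]
  have h7 : |g.1.trace| ≤ 3 := by
    rw [abs_div] at h1; norm_num at h1; linarith
  have := nm_nonneg (tl g.1)
  norm_num
  nlinarith

lemma exists_dev_lt_subset {U : Set SL2} (hU : U ∈ 𝓝 (1 : SL2)) :
    ∃ ε > 0, ∀ g : SL2, dev g < ε → g ∈ U := by
  rw [nhds_induced, Filter.mem_comap] at hU
  obtain ⟨s, hs, hsU⟩ := hU
  have hs' : s ∈ 𝓝 (fun i j : Fin 2 => (1 : SL2).1 i j) := hs
  obtain ⟨ε, hε, hb⟩ := Metric.mem_nhds_iff.mp hs'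
  refine ⟨ε, hε, fun g hg => hsU (@hb (fun i j => g.1 i j) ?_)⟩
  refine (dist_pi_lt_iff hε).mpr fun i => (dist_pi_lt_iff hε).mpr fun j => ?_
  exact (abs_entry_le_nm (g.1 - 1) i j).trans_lt hg

/-- Discreteness of `Γ`: the identity is isolated. -/
def IsDisc (Γ : Subgroup SL2) : Prop := ∃ ε > 0, ∀ γ ∈ Γ, dev γ < ε → γ = 1

lemma isDisc_of_discreteTopology (Γ : Subgroup SL2) (hd : DiscreteTopology Γ) : IsDisc Γ := by
  have h1 : ({1} : Set Γ) ∈ 𝓝 (1 : Γ) := (isOpen_discrete _).mem_nhds rfl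
  rw [nhds_subtype, Filter.mem_comap] at h1
  obtain ⟨U, hU, hs⟩ := h1
  obtain ⟨ε, hε, h⟩ := exists_dev_lt_subset hU
  refine ⟨ε, hε, fun γ hγ hdev => ?_⟩
  have : (⟨γ, hγ⟩ : Γ) ∈ ({1} : Set Γ) := hs (h γ hdev)
  exact congrArg Subtype.val this

lemma tl_eq_smul_of_commute {A B : SL2} (h : A * B = B * A) (hA : tl A.1 ≠ 0) :
    ∃ c : ℝ, tl B.1 = c • tl A.1 := by
  have hm : A.1 * B.1 = B.1 * A.1 := congrArg Subtype.val h
  have e00 := congrFun (congrFun hm 0) 0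
  have e01 := congrFun (congrFun hm 0) 1
  have e10 := congrFun (congrFun hm 1) 0
  simp only [Matrix.mul_apply, Fin.sum_univ_two] at e00 e01 e10
  have key : ∀ c : ℝ, B.1 0 0 - B.1 1 1 = c * (A.1 0 0 - A.1 1 1) → B.1 0 1 = c * A.1 0 1 →
      B.1 1 0 = c * A.1 1 0 → tl B.1 = c • tl A.1 := by
    intro c h1 h2 h3
    rw [tl_explicit, tl_explicit]
    ext i j
    fin_cases i <;> fin_cases j <;> simp [h1, h2, h3] <;> ring
  by_cases hb : A.1 0 1 = 0
  · by_cases hc : A.1 1 0 = 0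
    · have hx : A.1 0 0 - A.1 1 1 ≠ 0 := by
        intro hx; apply hA; rw [tl_explicit, hx, hb, hc]
        ext i j; fin_cases i <;> fin_cases j <;> simp
      refine ⟨(B.1 0 0 - B.1 1 1) / (A.1 0 0 - A.1 1 1), key _ ?_ ?_ ?_⟩ <;> field_simp
      · rw [hb] at e01 ⊢; linarith
      · rw [hc] at e10 ⊢; linarith
    · refine ⟨B.1 1 0 / A.1 1 0, key _ ?_ ?_ ?_⟩ <;> field_simp <;> linarith
  · refine ⟨B.1 0 1 / A.1 0 1, key _ ?_ ?_ ?_⟩ <;> field_simp <;> linarith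

lemma tl_mul_comm_sub (A B : Matrix (Fin 2) (Fin 2) ℝ) :
    B * A - A * B = tl B * tl A - tl A * tl B := by
  simp only [tl, sub_mul, mul_sub, Matrix.smul_mul, Matrix.mul_smul, one_mul, mul_one]
  rw [smul_comm]
  abel

lemma dev_commutator_le (A B : SL2) :
    dev (B * A * B⁻¹ * A⁻¹) ≤ 2 * nm (tl A.1) * nm (tl B.1) * nm A.1 * nm B.1 := by
  have e : (B * A * B⁻¹ * A⁻¹).1 - 1 =
      (tl B.1 * tl A.1 - tl A.1 * tl B.1) * (B⁻¹).1 * (A⁻¹).1 := by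
    rw [← tl_mul_comm_sub]
    have h1 : A.1 * B.1 * (B⁻¹).1 * (A⁻¹).1 = 1 := by
      rw [mul_assoc A.1, SL2_mul_inv_coe, mul_one, SL2_mul_inv_coe]
    rw [sub_mul, sub_mul, h1]; rfl
  unfold dev
  rw [e]
  have h1 := nm_mul_le ((tl B.1 * tl A.1 - tl A.1 * tl B.1) * (B⁻¹).1) (A⁻¹).1
  have h2 := nm_mul_le (tl B.1 * tl A.1 - tl A.1 * tl B.1) (B⁻¹).1
  have h3 := nm_sub_le (tl B.1 * tl A.1) (tl A.1 * tl B.1)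
  have h4 := nm_mul_le (tl B.1) (tl A.1)
  have h5 := nm_mul_le (tl A.1) (tl B.1)
  rw [nm_inv] at h1 h2
  have h6 : nm (tl B.1 * tl A.1 - tl A.1 * tl B.1) ≤ 2 * nm (tl A.1) * nm (tl B.1) := by
    linarith
  calc _ ≤ _ := h1
    _ ≤ (2 * nm (tl A.1) * nm (tl B.1) * nm B.1) * nm A.1 := by
        refine mul_le_mul_of_nonneg_right (h2.trans ?_) (nm_nonneg _)
        exact mul_le_mul_of_nonneg_right h6 (nm_nonneg _)
    _ = _ := by ring

lemma det_tl_conj (A B : SL2) :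
    (tl (B * A * B⁻¹).1).det = (tl A.1).det := by
  have h := tl_conj B⁻¹ A.1
  rw [inv_inv] at h
  have e : (B * A * B⁻¹).1 = B.1 * A.1 * (B⁻¹).1 := rfl
  rw [e, h, Matrix.det_mul, Matrix.det_mul, B.2, B⁻¹.2]; ring

lemma tl_conj_sub_le (A B : SL2) (hB : nm (tl B.1) ≤ 1 / 32) :
    nm (tl (B * A * B⁻¹).1 - tl A.1) ≤ 1 / 4 * nm (tl A.1) := by
  have h := tl_conj B⁻¹ A.1
  rw [inv_inv] at h
  have e : (B * A * B⁻¹).1 = B.1 * A.1 * (B⁻¹).1 := rfl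
  rw [e, h]
  have htt : tl (tl A.1) = tl A.1 := by
    rw [tl_explicit (tl A.1), tl_explicit A.1]
    ext i j; fin_cases i <;> fin_cases j <;> simp
  have e2 : B.1 * tl A.1 * (B⁻¹).1 - tl A.1 = (tl B.1 * tl A.1 - tl A.1 * tl B.1) * (B⁻¹).1 := by
    have h3 := tl_mul_comm_sub (tl A.1) B.1
    rw [htt] at h3
    rw [← h3, sub_mul, mul_assoc (tl A.1), SL2_mul_inv_coe, mul_one]
  rw [e2]
  have h2 := nm_mul_le (tl B.1 * tl A.1 - tl A.1 * tl B.1) (B⁻¹).1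
  have h3 := nm_sub_le (tl B.1 * tl A.1) (tl A.1 * tl B.1)
  have h4 := nm_mul_le (tl B.1) (tl A.1)
  have h5 := nm_mul_le (tl A.1) (tl B.1)
  rw [nm_inv] at h2
  have h7 := nm_le_of_tl B (by linarith)
  have h8 := nm_nonneg (tl A.1)
  have h9 := nm_nonneg (tl B.1)
  have h10 : nm (tl B.1 * tl A.1 - tl A.1 * tl B.1) ≤ 1 / 16 * nm (tl A.1) := by nlinarith
  nlinarith [nm_nonneg B.1, nm_nonneg (tl B.1 * tl A.1 - tl A.1 * tl B.1)]

lemma det_tl_of_nilpotent_trace (A : SL2) (h : (tl A.1).det = 0) :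
    (A.1.trace / 2) ^ 2 = 1 ∧ tl A.1 * tl A.1 = 0 := by
  have h1 := trace_sq A
  rw [tl_explicit, Matrix.det_fin_two_of] at h
  constructor
  · linarith
  · rw [tl_explicit]
    ext i j
    fin_cases i <;> fin_cases j <;> simp [Matrix.mul_apply] <;> linarith

lemma tl_conj_pow {A B : SL2} {c : ℝ} (h : tl (B * A * B⁻¹).1 = c • tl A.1) (k : ℕ) :
    tl (B ^ k * A * (B ^ k)⁻¹).1 = c ^ k • tl A.1 := by
  induction k with
  | zero => simp
  | succ k ih =>
    have e : B ^ (k + 1) * A * (B ^ (k + 1))⁻¹ = B * (B ^ k * A * (B ^ k)⁻¹) * B⁻¹ := by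
      rw [pow_succ']; group
    have h2 := tl_conj B⁻¹ (B ^ k * A * (B ^ k)⁻¹).1
    have h3 := tl_conj B⁻¹ A.1
    rw [inv_inv] at h2 h3
    have h4 : tl (B * A * B⁻¹).1 = B.1 * tl A.1 * (B⁻¹).1 := h3
    have h5 : tl (B * (B ^ k * A * (B ^ k)⁻¹) * B⁻¹).1 =
      B.1 * tl (B ^ k * A * (B ^ k)⁻¹).1 * (B⁻¹).1 := h2
    rw [e, h5, ih, Matrix.mul_smul, Matrix.smul_mul, ← h4, h, smul_smul, pow_succ]

lemma trace_conj_SL2 (A B : SL2) : (B * A * B⁻¹).1.trace = A.1.trace := by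
  have e : (B * A * B⁻¹).1 = B.1 * A.1 * (B⁻¹).1 := rfl
  rw [e, Matrix.trace_mul_comm, ← mul_assoc, SL2_inv_mul_coe, one_mul]

/-- In a discrete group no element conjugates a parabolic element into a proper contraction of
itself. -/
lemma commute_of_conj_contracts {Γ : Subgroup SL2} (hΓ : IsDisc Γ)
    {A B : SL2} (hA : A ∈ Γ) (hB : B ∈ Γ) (hdet : (tl A.1).det = 0) {c : ℝ}
    (hc : |c| < 1) (h : tl (B * A * B⁻¹).1 = c • tl A.1) : B * A * B⁻¹ = A := by
  obtain ⟨ε, hε, hdisc⟩ := hΓ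
  obtain ⟨ht, hn⟩ := det_tl_of_nilpotent_trace A hdet
  set τ := A.1.trace / 2 with hτ
  set X : ℕ → SL2 := fun k => B ^ k * A * (B ^ k)⁻¹ with hX
  have hXc : ∀ k, (X k).1 = τ • 1 + c ^ k • tl A.1 := fun k => by
    have h1 : (X k).1 = tl (X k).1 + ((X k).1.trace / 2) • 1 := by simp [tl]
    rw [h1, tl_conj_pow h, trace_conj_SL2, add_comm]
  have hτ2 : |τ| = 1 := by
    have : |τ| ^ 2 = 1 := by rw [sq_abs, ht]
    nlinarith [abs_nonneg τ]
  have hinv : ∀ k, ((X k)⁻¹).1 = τ • 1 - c ^ k • tl A.1 := fun k => by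
    have h1 : (X k).1 * (τ • 1 - c ^ k • tl A.1) = 1 := by
      rw [hXc]
      simp only [add_mul, mul_sub, Matrix.smul_mul, Matrix.mul_smul, one_mul, mul_one, hn,
        smul_zero, smul_smul]
      rw [← sq, ht, mul_comm]
      simp
    calc ((X k)⁻¹).1 = ((X k)⁻¹).1 * ((X k).1 * (τ • 1 - c ^ k • tl A.1)) := by rw [h1, mul_one]
      _ = _ := by rw [← mul_assoc, SL2_inv_mul_coe, one_mul]
  have hdev : ∀ k, dev (X k * (X (k + 1))⁻¹) ≤ 2 * |c| ^ k * nm (tl A.1) := fun k => by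
    have e : (X k * (X (k + 1))⁻¹).1 - 1 = (τ * (c ^ k - c ^ (k + 1))) • tl A.1 := by
      rw [SL2_mul_coe, hXc, hinv]
      simp only [add_mul, mul_sub, Matrix.smul_mul, Matrix.mul_smul, one_mul, mul_one, hn,
        smul_zero, smul_smul]
      rw [← sq, ht]
      module
    unfold dev
    rw [e, nm_smul, abs_mul, hτ2, one_mul]
    refine mul_le_mul_of_nonneg_right ?_ (nm_nonneg _)
    have := abs_sub (c ^ k) (c ^ (k + 1))
    rw [abs_pow, abs_pow] at this
    have h2 : |c| ^ (k + 1) ≤ |c| ^ k :=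
      pow_le_pow_of_le_one (abs_nonneg c) hc.le (Nat.le_succ k)
    linarith
  have hlim : Tendsto (fun k : ℕ => 2 * |c| ^ k * nm (tl A.1)) atTop (𝓝 (2 * 0 * nm (tl A.1))) :=
    ((tendsto_pow_atTop_nhds_zero_of_lt_one (abs_nonneg c) hc).const_mul 2).mul_const _
  rw [mul_zero, zero_mul] at hlim
  obtain ⟨k, hk⟩ := (hlim.eventually_lt_const hε).exists
  have hmem : ∀ k, X k ∈ Γ := fun k =>
    Γ.mul_mem (Γ.mul_mem (Γ.pow_mem hB k) hA) (Γ.inv_mem (Γ.pow_mem hB k))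
  have h1 := hdisc _ (Γ.mul_mem (hmem k) (Γ.inv_mem (hmem (k + 1)))) ((hdev k).trans_lt hk)
  rw [mul_inv_eq_one] at h1
  simp only [hX, pow_succ] at h1
  have h2 : A = B * A * B⁻¹ := by
    have := congrArg (fun z => (B ^ k)⁻¹ * z * B ^ k) h1
    simpa [mul_assoc] using this
  exact h2.symm

lemma commute_of_commutator_commute {Γ : Subgroup SL2}
    (hΓ : IsDisc Γ)
    {A B : SL2} (hA : A ∈ Γ) (hB : B ∈ Γ) (hA0 : tl A.1 ≠ 0) (hBs : nm (tl B.1) ≤ 1 / 32)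
    (h : A * (B * A * B⁻¹ * A⁻¹) = (B * A * B⁻¹ * A⁻¹) * A) : B * A * B⁻¹ = A := by
  have h1 : A * (B * A * B⁻¹) = (B * A * B⁻¹) * A := by
    have := congrArg (· * A) h
    simpa [mul_assoc] using this
  obtain ⟨c, hc⟩ := tl_eq_smul_of_commute h1 hA0
  have hA1 := nm_pos hA0
  have hc1 : |c - 1| ≤ 1 / 4 := by
    have h2 := tl_conj_sub_le A B hBs
    rw [hc] at h2
    have e : c • tl A.1 - tl A.1 = (c - 1) • tl A.1 := by rw [sub_smul, one_smul]
    rw [e, nm_smul] at h2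
    exact le_of_mul_le_mul_right h2 hA1
  rw [abs_le] at hc1
  have heq : c = 1 → B * A * B⁻¹ = A := fun h => by
    rw [h, one_smul] at hc
    have h3 : (B * A * B⁻¹).1 = tl (B * A * B⁻¹).1 + ((B * A * B⁻¹).1.trace / 2) • 1 := by simp [tl]
    have h4 : A.1 = tl A.1 + (A.1.trace / 2) • 1 := by simp [tl]
    apply SL2_ext'
    rw [h3, hc, trace_conj_SL2, ← h4]
  by_cases hdet : (tl A.1).det = 0
  · rcases lt_trichotomy c 1 with hlt | h | hgt
    · exact commute_of_conj_contracts hΓ hA hB hdet (abs_lt.mpr ⟨by linarith, hlt⟩) hc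
    · exact heq h
    · have h5 : tl (B⁻¹ * A * B⁻¹⁻¹).1 = c⁻¹ • tl A.1 := by
        have h6 := tl_conj B A.1
        have h7 := tl_conj B⁻¹ A.1
        rw [inv_inv] at h7
        have h8 : tl (B * A * B⁻¹).1 = B.1 * tl A.1 * (B⁻¹).1 := h7
        rw [inv_inv]
        have h9 : tl (B⁻¹ * A * B).1 = (B⁻¹).1 * tl A.1 * B.1 := h6
        have h10 : (B⁻¹).1 * (c • tl A.1) * B.1 = tl A.1 := by
          rw [← hc, h8, ← mul_assoc, ← mul_assoc, SL2_inv_mul_coe, one_mul, mul_assoc,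
            SL2_inv_mul_coe, mul_one]
        rw [Matrix.mul_smul, Matrix.smul_mul] at h10
        rw [h9, ← h10, smul_smul, inv_mul_cancel₀ (show c ≠ 0 by linarith), one_smul, h10]
      have hci : |c⁻¹| < 1 := by
        rw [abs_inv, abs_of_pos (by linarith)]; exact inv_lt_one_of_one_lt₀ hgt
      have := commute_of_conj_contracts hΓ hA (Γ.inv_mem hB) hdet hci h5
      rw [inv_inv] at this
      have h10 := congrArg (fun z => B * z * B⁻¹) this
      simpa [mul_assoc] using h10.symm
  · apply heq
    have h2 := det_tl_conj A B
    rw [hc, Matrix.det_smul] at h2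
    simp at h2
    have h3 : (c ^ 2 - 1) * (tl A.1).det = 0 := by linarith
    rcases mul_eq_zero.mp h3 with h | h
    · nlinarith
    · exact absurd h hdet

/-- Zassenhaus neighbourhood: elements of a discrete subgroup close to `±1` commute. -/
lemma commute_of_small {Γ : Subgroup SL2} (hΓ : IsDisc Γ)
    {A B : SL2} (hA : A ∈ Γ) (hB : B ∈ Γ) (hA0 : tl A.1 ≠ 0)
    (hAs : nm (tl A.1) ≤ 1 / 64) (hBs : nm (tl B.1) ≤ 1 / 64) : A * B = B * A := by
  set X : ℕ → SL2 := fun k => Nat.rec B (fun _ C => C * A * C⁻¹ * A⁻¹) k with hX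
  have hX0 : X 0 = B := rfl
  have hXs : ∀ k, X (k + 1) = X k * A * (X k)⁻¹ * A⁻¹ := fun k => rfl
  have hmem : ∀ k, X k ∈ Γ := fun k => by
    induction k with
    | zero => exact hB
    | succ k ih =>
      rw [hXs]; exact Γ.mul_mem (Γ.mul_mem (Γ.mul_mem ih hA) (Γ.inv_mem ih)) (Γ.inv_mem hA)
  have hdevs : ∀ k, nm (tl (X k).1) ≤ 1 / 64 → dev (X (k + 1)) ≤ 1 / 2 * nm (tl (X k).1) :=
    fun k hk => by
      rw [hXs]
      refine (dev_commutator_le A (X k)).trans ?_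
      have h1 := nm_le_of_tl A (by linarith)
      have h2 := nm_le_of_tl (X k) (by linarith)
      have n1 := nm_nonneg (tl A.1)
      have n2 := nm_nonneg (tl (X k).1)
      have n3 := nm_nonneg A.1
      have n4 := nm_nonneg (X k).1
      calc 2 * nm (tl A.1) * nm (tl (X k).1) * nm A.1 * nm (X k).1
          ≤ 2 * (1 / 64) * nm (tl (X k).1) * 4 * 4 := by gcongr
        _ = _ := by ring
  have hsz : ∀ k, nm (tl (X k).1) ≤ (1 / 2) ^ k * (1 / 64) := fun k => by
    induction k with
    | zero => simpa [hX0] using hBs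
    | succ k ih =>
      have h1 : nm (tl (X k).1) ≤ 1 / 64 :=
        ih.trans (mul_le_of_le_one_left (by norm_num) (pow_le_one₀ (by norm_num) (by norm_num)))
      have h2 := (nm_tl_le_dev (X (k + 1))).trans (hdevs k h1)
      rw [pow_succ]; linarith
  have hsz' : ∀ k, nm (tl (X k).1) ≤ 1 / 64 := fun k => (hsz k).trans
    (mul_le_of_le_one_left (by norm_num) (pow_le_one₀ (by norm_num) (by norm_num)))
  have hlim : ∃ k, X k = 1 := by
    obtain ⟨ε, hε, hdisc⟩ := hΓ
    obtain ⟨k, hk⟩ := exists_pow_lt_of_lt_one hε (show (1 / 2 : ℝ) < 1 by norm_num)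
    refine ⟨k + 1, hdisc _ (hmem (k + 1)) ?_⟩
    have := hdevs k (hsz' k)
    have h2 := hsz k
    have h3 : (0 : ℝ) ≤ (1 / 2) ^ k := by positivity
    linarith
  have hdesc : ∀ k, A * X k = X k * A → A * B = B * A := fun k => by
    induction k with
    | zero => exact id
    | succ k ih =>
      intro h
      apply ih
      rw [hXs] at h
      have := commute_of_commutator_commute hΓ hA (hmem k) hA0 ((hsz' k).trans (by norm_num)) h
      rw [mul_inv_eq_iff_eq_mul] at this
      exact this.symm
  obtain ⟨k, hk⟩ := hlim
  exact hdesc k (by rw [hk, mul_one, one_mul])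

/-- The size of `g⁻¹γg` modulo the centre. -/
def sz (γ g : SL2) : ℝ := nm (tl (g⁻¹ * γ * g).1)

lemma sz_nonneg (γ g : SL2) : 0 ≤ sz γ g := nm_nonneg _

lemma tl_conj' (p γ : SL2) : tl (p⁻¹ * γ * p).1 = (p⁻¹).1 * tl γ.1 * p.1 := tl_conj p γ.1

lemma sz_eq (γ g : SL2) : sz γ g = nm ((g⁻¹).1 * tl γ.1 * g.1) := by
  unfold sz; rw [tl_conj']

lemma sz_mul (γ g p : SL2) :
    sz γ (g * p) = nm ((p⁻¹).1 * tl (g⁻¹ * γ * g).1 * p.1) := by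
  rw [← tl_conj']
  unfold sz
  rw [show (g * p)⁻¹ * γ * (g * p) = p⁻¹ * (g⁻¹ * γ * g) * p by group]

lemma sz_mul_left (γ γ' g : SL2) : sz γ (γ' * g) = sz (γ'⁻¹ * γ * γ') g := by
  unfold sz; rw [show (γ' * g)⁻¹ * γ * (γ' * g) = g⁻¹ * (γ'⁻¹ * γ * γ') * g by group]

lemma sz_mul_le (γ g p : SL2) : sz γ (g * p) ≤ nm p.1 ^ 2 * sz γ g := by
  rw [sz_mul]; exact nm_conj_le _ _

lemma sz_le_mul (γ g p : SL2) : sz γ g ≤ nm p.1 ^ 2 * sz γ (g * p) := by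
  rw [sz_mul]; exact nm_conj_ge _ _

lemma sz_mul_le_dev (γ g p : SL2) :
    sz γ (g * p) ≤ (1 + 2 * nm p.1 * dev p) * sz γ g := by
  rw [sz_mul]; exact nm_conj_le_dev _ _

/-- The systole of `Γ` seen from `g`, truncated at `1`. -/
def sys (Γ : Subgroup SL2) (g : SL2) : ℝ :=
  sInf (insert 1 {r | ∃ γ ∈ Γ, tl γ.1 ≠ 0 ∧ r = sz γ g})

lemma sys_bddBelow (Γ : Subgroup SL2) (g : SL2) :
    BddBelow (insert 1 {r | ∃ γ ∈ Γ, tl γ.1 ≠ 0 ∧ r = sz γ g}) := by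
  refine ⟨0, ?_⟩
  rintro r (rfl | ⟨γ, -, -, rfl⟩)
  · exact zero_le_one
  · exact sz_nonneg _ _

lemma sys_le_one (Γ : Subgroup SL2) (g : SL2) : sys Γ g ≤ 1 :=
  csInf_le (sys_bddBelow Γ g) (Set.mem_insert _ _)

lemma sys_le_sz {Γ : Subgroup SL2} {γ : SL2} (hγ : γ ∈ Γ) (h : tl γ.1 ≠ 0) (g : SL2) :
    sys Γ g ≤ sz γ g :=
  csInf_le (sys_bddBelow Γ g) (Set.mem_insert_of_mem _ ⟨γ, hγ, h, rfl⟩)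

lemma le_sys {Γ : Subgroup SL2} {g : SL2} {c : ℝ} (h1 : c ≤ 1)
    (h : ∀ γ ∈ Γ, tl γ.1 ≠ 0 → c ≤ sz γ g) : c ≤ sys Γ g := by
  refine le_csInf (Set.insert_nonempty _ _) ?_
  rintro r (rfl | ⟨γ, h2, h3, rfl⟩)
  · exact h1
  · exact h γ h2 h3

lemma exists_sz_lt {Γ : Subgroup SL2} {g : SL2} {c : ℝ} (h1 : c ≤ 1) (h : sys Γ g < c) :
    ∃ γ ∈ Γ, tl γ.1 ≠ 0 ∧ sz γ g < c := by
  by_contra! hc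
  exact absurd (le_sys h1 hc) (not_le.mpr h)

lemma tl_conj_ne_zero {γ : SL2} (p : SL2) (h : tl γ.1 ≠ 0) : tl (p⁻¹ * γ * p).1 ≠ 0 := by
  intro h0
  apply h
  have := nm_conj_ge p (tl γ.1)
  rw [← tl_conj', h0, nm_eq_zero.mpr rfl, mul_zero] at this
  exact nm_eq_zero.mp (le_antisymm this (nm_nonneg _))

lemma sys_mul_left {Γ : Subgroup SL2} {γ : SL2} (hγ : γ ∈ Γ) (g : SL2) :
    sys Γ (γ * g) = sys Γ g := by
  have key : ∀ γ ∈ Γ, ∀ g, sys Γ g ≤ sys Γ (γ * g) := fun γ hγ g => by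
    refine le_sys (sys_le_one _ _) fun δ hδ hδ0 => ?_
    rw [sz_mul_left]
    exact sys_le_sz (Γ.mul_mem (Γ.mul_mem (Γ.inv_mem hγ) hδ) hγ) (tl_conj_ne_zero γ hδ0) g
  refine le_antisymm ?_ (key γ hγ g)
  have := key γ⁻¹ (Γ.inv_mem hγ) (γ * g)
  rwa [inv_mul_cancel_left] at this

lemma sys_le_mul (Γ : Subgroup SL2) (g p : SL2) : sys Γ g ≤ nm p.1 ^ 2 * sys Γ (g * p) := by
  have hp := nm_SL2_ge_one p
  have hp2 : 1 ≤ nm p.1 ^ 2 := one_le_pow₀ hp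
  have h : sys Γ g / nm p.1 ^ 2 ≤ sys Γ (g * p) := by
    refine le_sys ((div_le_one (by positivity)).mpr ((sys_le_one _ _).trans hp2))
      fun γ hγ h0 => ?_
    rw [div_le_iff₀ (by positivity), mul_comm]
    exact (sys_le_sz hγ h0 g).trans (sz_le_mul _ _ _)
  rwa [div_le_iff₀ (by positivity), mul_comm] at h

lemma sys_mul_le_dev (Γ : Subgroup SL2) (g p : SL2) :
    sys Γ (g * p) ≤ (1 + 2 * nm p.1 * dev p) * sys Γ g := by
  have hp := nm_SL2_ge_one p
  have hK : 1 ≤ 1 + 2 * nm p.1 * dev p := by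
    have := dev_nonneg p
    have : 0 ≤ 2 * nm p.1 * dev p := by positivity
    linarith
  have h : sys Γ (g * p) / (1 + 2 * nm p.1 * dev p) ≤ sys Γ g := by
    refine le_sys ((div_le_one (by positivity)).mpr ((sys_le_one _ _).trans hK))
      fun γ hγ h0 => ?_
    rw [div_le_iff₀ (by positivity), mul_comm]
    exact (sys_le_sz hγ h0 _).trans (sz_mul_le_dev _ _ _)
  rwa [div_le_iff₀ (by positivity), mul_comm] at h

lemma abs_sys_sub_le (Γ : Subgroup SL2) (g p : SL2) :
    |sys Γ (g * p) - sys Γ g| ≤ 2 * nm p.1 * dev p := by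
  have h1 := sys_mul_le_dev Γ g p
  have h2 := sys_mul_le_dev Γ (g * p) p⁻¹
  rw [mul_inv_cancel_right, nm_inv, dev_inv] at h2
  have hp := nm_SL2_ge_one p
  have hd := dev_nonneg p
  have hK : 0 ≤ 2 * nm p.1 * dev p := by positivity
  rw [abs_le]
  constructor <;> nlinarith [sys_le_one Γ g, sys_le_one Γ (g * p)]

lemma continuous_sys (Γ : Subgroup SL2) : Continuous (sys Γ) := by
  rw [continuous_iff_continuousAt]
  intro g
  have hc : Continuous fun g' : SL2 => 2 * nm (g⁻¹ * g').1 * dev (g⁻¹ * g') := by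
    have h1 : Continuous fun g' : SL2 => g⁻¹ * g' := by fun_prop
    exact (continuous_const.mul (continuous_nm.comp (continuous_coe_SL2.comp h1))).mul
      (continuous_dev.comp h1)
  have h0 := hc.tendsto g
  rw [inv_mul_cancel, dev_one, mul_zero] at h0
  refine tendsto_iff_dist_tendsto_zero.mpr (squeeze_zero (fun _ => dist_nonneg) (fun g' => ?_) h0)
  have := abs_sys_sub_le Γ g (g⁻¹ * g')
  rwa [mul_inv_cancel_left] at this

lemma dev_ge_conj (p g : SL2) : dev g ≤ nm p.1 ^ 2 * dev (p⁻¹ * g * p) := by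
  have h := dev_conj_le p⁻¹ (p⁻¹ * g * p)
  rw [nm_inv] at h
  convert h using 2
  group

lemma discrete_conj {Γ : Subgroup SL2} (hΓ : IsDisc Γ) (g : SL2) :
    ∃ ε > 0, ∀ γ ∈ Γ, dev (g⁻¹ * γ * g) < ε → γ = 1 := by
  obtain ⟨ε, hε, h⟩ := hΓ
  have hp := nm_SL2_ge_one g
  refine ⟨ε / nm g.1 ^ 2, by positivity, fun γ hγ hd => h γ hγ ?_⟩
  rw [lt_div_iff₀ (by positivity)] at hd
  exact (dev_ge_conj g γ).trans_lt (by linarith)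

lemma sys_pos {Γ : Subgroup SL2} (hΓ : IsDisc Γ) (g : SL2) :
    0 < sys Γ g := by
  obtain ⟨ε, hε, h⟩ := discrete_conj hΓ g
  have hc : 0 < min (1 / 2) (ε / 12) := by positivity
  refine hc.trans_le (le_sys ((min_le_left _ _).trans (by norm_num)) fun γ hγ h0 => ?_)
  by_contra! hlt
  have h1 : sz γ g ≤ 1 / 2 := (hlt.trans_le (min_le_left _ _)).le
  have h2 : sz γ g < ε / 12 := hlt.trans_le (min_le_right _ _)
  have h3 := dev_sq_le _ h1
  have h4 : γ * γ = 1 := by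
    refine h _ (Γ.mul_mem hγ hγ) ?_
    have e : g⁻¹ * (γ * γ) * g = (g⁻¹ * γ * g) * (g⁻¹ * γ * g) := by group
    rw [e]
    refine h3.trans_lt ?_
    have h2' : nm (tl (g⁻¹ * γ * g).1) < ε / 12 := h2
    linarith
  have h5 := tl_sq (g⁻¹ * γ * g)
  have e : (g⁻¹ * γ * g) * (g⁻¹ * γ * g) = 1 := by
    have : g⁻¹ * (γ * γ) * g = (g⁻¹ * γ * g) * (g⁻¹ * γ * g) := by group
    rw [← this, h4]; group
  rw [e] at h5
  have h6 : tl (1 : SL2).1 = 0 := by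
    rw [tl_explicit]; ext i j; fin_cases i <;> fin_cases j <;> simp
  rw [h6] at h5
  rcases smul_eq_zero.mp h5.symm with h | h
  · exact (trace_bounds _ h1).2.1 h
  · exact tl_conj_ne_zero g h0 h

/-- The height function on `Γ\G`. -/
def ht (Γ : Subgroup SL2) (g : SL2) : ℝ := sys Γ g ^ (-(1 / 4) : ℝ)

lemma ht_mul_left {Γ : Subgroup SL2} {γ : SL2} (hγ : γ ∈ Γ) (g : SL2) :
    ht Γ (γ * g) = ht Γ g := by unfold ht; rw [sys_mul_left hγ]

lemma one_le_ht {Γ : Subgroup SL2} (hΓ : IsDisc Γ) (g : SL2) : 1 ≤ ht Γ g :=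
  Real.one_le_rpow_of_pos_of_le_one_of_nonpos (sys_pos hΓ g) (sys_le_one _ _) (by norm_num)

lemma continuous_ht {Γ : Subgroup SL2} (hΓ : IsDisc Γ) : Continuous (ht Γ) :=
  (continuous_sys Γ).rpow_const fun g => Or.inl (sys_pos hΓ g).ne'

lemma ht_mul_le {Γ : Subgroup SL2} (hΓ : IsDisc Γ)
    (g p : SL2) : ht Γ (g * p) ≤ nm p.1 * ht Γ g := by
  have hp := nm_SL2_ge_one p
  have h1 := sys_le_mul Γ g p
  have h2 := sys_pos hΓ g
  have h3 := sys_pos hΓ (g * p)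
  unfold ht
  have h4 : (nm p.1 ^ 2 * sys Γ (g * p)) ^ (-(1 / 4) : ℝ) ≤ sys Γ g ^ (-(1 / 4) : ℝ) :=
    Real.rpow_le_rpow_of_nonpos h2 h1 (by norm_num)
  rw [Real.mul_rpow (by positivity) h3.le] at h4
  have h5 : nm p.1 * (nm p.1 ^ 2) ^ (-(1 / 4) : ℝ) ≥ 1 := by
    rw [← Real.rpow_natCast, ← Real.rpow_mul (by positivity), ← Real.rpow_one_add' (by positivity)
      (by norm_num)]
    exact Real.one_le_rpow hp (by norm_num)
  have h6 : 0 < sys Γ (g * p) ^ (-(1 / 4) : ℝ) := Real.rpow_pos_of_pos h3 _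
  calc sys Γ (g * p) ^ (-(1 / 4) : ℝ)
      ≤ (nm p.1 * (nm p.1 ^ 2) ^ (-(1 / 4) : ℝ)) * sys Γ (g * p) ^ (-(1 / 4) : ℝ) :=
        le_mul_of_one_le_left h6.le h5
    _ = nm p.1 * ((nm p.1 ^ 2) ^ (-(1 / 4) : ℝ) * sys Γ (g * p) ^ (-(1 / 4) : ℝ)) := by ring
    _ ≤ _ := mul_le_mul_of_nonneg_left h4 (by positivity)

lemma dev_mul_inv_le {u v : SL2} : dev (u * v⁻¹) ≤ (dev u + dev v) * (2 + dev v) := by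
  have e : (u * v⁻¹).1 - 1 = ((u.1 - 1) - (v.1 - 1)) * (v⁻¹).1 := by
    rw [sub_sub_sub_cancel_right, sub_mul, SL2_mul_inv_coe]; rfl
  unfold dev
  rw [e]
  refine (nm_mul_le _ _).trans ?_
  rw [nm_inv]
  exact mul_le_mul (nm_sub_le _ _) (nm_le_dev v) (nm_nonneg _)
    (add_nonneg (nm_nonneg _) (nm_nonneg _))

lemma eq_one_of_dev_lt_sys {Γ : Subgroup SL2} {γ g : SL2} (hγ : γ ∈ Γ)
    (h : dev (g⁻¹ * γ * g) < sys Γ g) : γ = 1 := by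
  have h0 : tl γ.1 = 0 := by
    by_contra h0
    have h1 := sys_le_sz hγ h0 g
    have h2 : sz γ g ≤ dev (g⁻¹ * γ * g) := nm_tl_le_dev _
    linarith
  have h1 : tl (g⁻¹ * γ * g).1 = 0 := by rw [tl_conj', h0]; simp
  have h2 := SL2_eq_of_tl_eq_zero h1 (h.trans_le (sys_le_one _ _))
  have h3 := congrArg (fun x => g * x * g⁻¹) h2
  simpa [mul_assoc] using h3

lemma isOpen_dev_lt (δ : ℝ) : IsOpen {u : SL2 | dev u < δ} :=
  isOpen_lt continuous_dev continuous_const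

/-- Away from the cusps, `Γ\G` is compact. -/
lemma exists_reduction {Γ : Subgroup SL2} (hlat : IsLatticeSL2 Γ) {r : ℝ} (hr : 0 < r) :
    ∃ C, ∀ g, r ≤ sys Γ g → ∃ γ ∈ Γ, nm (γ * g).1 ≤ C := by
  obtain ⟨hd, μ, hμ, F, hF, hfin⟩ := hlat
  have hcount : Countable Γ := TopologicalSpace.separableSpace_iff_countable.mp inferInstance
  by_cases hr1 : 1 < r
  · exact ⟨0, fun g hg => absurd (hg.trans (sys_le_one _ _)) (not_le.mpr hr1)⟩
  push Not at hr1
  set δ := r / 8 with hδ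
  have hδ0 : 0 < δ := by positivity
  set U : Set SL2 := {u | dev u < δ} with hU
  have hUo : IsOpen U := isOpen_dev_lt δ
  have hU1 : (1 : SL2) ∈ U := by rw [hU, Set.mem_ofPred_eq, dev_one]; exact hδ0
  have hUdev : ∀ u ∈ U, ∀ v ∈ U, dev (u * v⁻¹) < r := fun u hu v hv => by
    refine dev_mul_inv_le.trans_lt ?_
    have hu' : dev u < δ := hu
    have hv' : dev v < δ := hv
    nlinarith [dev_nonneg u, dev_nonneg v]
  have hμU : μ U ≠ 0 := (hUo.measure_pos μ ⟨1, hU1⟩).ne'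
  set P : Finset SL2 → Prop := fun t => (∀ g ∈ t, r ≤ sys Γ g) ∧
    ∀ g ∈ t, ∀ g' ∈ t, g ≠ g' → ∀ γ ∈ Γ, ∀ u ∈ U, ∀ v ∈ U, γ * g * u ≠ g' * v with hP
  have hbound : ∀ t, P t → t.card * μ U ≤ μ F := fun t ht => by
    set S : Set SL2 := ⋃ g ∈ t, (fun x => g⁻¹ * x) ⁻¹' U with hS
    have hmeas : ∀ g : SL2, MeasurableSet ((fun x => g⁻¹ * x) ⁻¹' U) := fun g =>
      (hUo.preimage (continuous_const.mul continuous_id)).measurableSet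
    have hSm : MeasurableSet S := Finset.measurableSet_biUnion _ fun g _ => hmeas g
    have hμS : μ S = t.card * μ U := by
      rw [hS, measure_biUnion_finset]
      · simp [measure_preimage_mul]
      · intro g hg g' hg' hne
        rw [Function.onFun, Set.disjoint_left]
        intro x hx hx'
        exact ht.2 g hg g' hg' hne 1 Γ.one_mem _ hx _ hx' (by group)
      · exact fun g _ => hmeas g
    rw [← hμS]
    by_contra! hlt
    obtain ⟨x, hx, y, hy, γ, hγ, hxy⟩ := hF.exists_ne_one_smul_eq hSm.nullMeasurableSet hlt
    simp only [hS, Set.mem_iUnion] at hx hy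
    obtain ⟨g, hg, hx⟩ := hx
    obtain ⟨g', hg', hy⟩ := hy
    have hxy' : γ.1 * x = y := hxy
    have key : γ.1 * g * (g⁻¹ * x) = g' * (g'⁻¹ * y) := by rw [← hxy']; group
    by_cases hgg : g = g'
    · subst hgg
      apply hγ
      apply Subtype.ext
      refine eq_one_of_dev_lt_sys (g := g) γ.2 (lt_of_lt_of_le ?_ (ht.1 g hg))
      have h1 : dev (g⁻¹ * y * (g⁻¹ * x)⁻¹) < r := hUdev _ hy _ hx
      rwa [← hxy', show g⁻¹ * (γ.1 * x) * (g⁻¹ * x)⁻¹ = g⁻¹ * γ.1 * g by group] at h1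
    · exact ht.2 g hg g' hg' hgg γ.1 γ.2 _ hx _ hy key
  obtain ⟨N, hN⟩ : ∃ N : ℕ, ∀ t, P t → t.card ≤ N := by
    have h1 : μ F / μ U ≠ ⊤ := ENNReal.div_ne_top hfin hμU
    obtain ⟨N, hN⟩ := ENNReal.exists_nat_gt h1
    refine ⟨N, fun t ht => ?_⟩
    have hUt : μ U ≠ ⊤ := by
      refine (lt_of_le_of_lt (measure_mono (t := {g : SL2 | nm g.1 ≤ 2 + δ}) fun u hu => ?_)
        (isCompact_nm_le _).measure_lt_top).ne
      have hu' : dev u < δ := hu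
      exact (nm_le_dev u).trans (by linarith)
    have h2 : (t.card : ENNReal) ≤ μ F / μ U :=
      (ENNReal.le_div_iff_mul_le (Or.inl hμU) (Or.inl hUt)).mpr (hbound t ht)
    exact_mod_cast (h2.trans_lt hN).le
  obtain ⟨t, ht, hmax⟩ : ∃ t, P t ∧ ∀ t', P t' → t'.card ≤ t.card := by
    have hne : {n | ∃ t, P t ∧ t.card = n}.Nonempty := ⟨0, ∅, by simp [hP], rfl⟩
    have hbdd : BddAbove {n | ∃ t, P t ∧ t.card = n} := ⟨N, by rintro _ ⟨t, ht, rfl⟩; exact hN t ht⟩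
    obtain ⟨t, ht, hc⟩ := Nat.sSup_mem hne hbdd
    exact ⟨t, ht, fun t' ht' => by rw [hc]; exact le_csSup hbdd ⟨t', ht', rfl⟩⟩
  have hsum : ∀ g ∈ t, nm g.1 ≤ ∑ g ∈ t, nm g.1 := fun g hg =>
    Finset.single_le_sum (f := fun g : SL2 => nm g.1) (fun g _ => nm_nonneg g.1) hg
  have hUnm : ∀ u ∈ U, nm u.1 ≤ 3 := fun u hu => by
    have hu' : dev u < δ := hu
    exact (nm_le_dev u).trans (by linarith)
  have hs0 : 0 ≤ ∑ g ∈ t, nm g.1 := Finset.sum_nonneg fun g _ => nm_nonneg g.1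
  refine ⟨9 * ∑ g ∈ t, nm g.1, fun g hg => ?_⟩
  have hrep : ∀ γ, ∀ g' ∈ t, ∀ u ∈ U, ∀ v ∈ U, γ * g * u = g' * v →
      nm (γ * g).1 ≤ 9 * ∑ g ∈ t, nm g.1 := fun γ g' hg' u hu v hv h => by
    have e : γ * g = g' * v * u⁻¹ := by rw [← h]; group
    have h1 := nm_mul_le (g' * v).1 (u⁻¹).1
    have h2 := nm_mul_le g'.1 v.1
    rw [nm_inv] at h1
    rw [e]
    calc nm (g' * v * u⁻¹).1 ≤ _ := h1
      _ ≤ (nm g'.1 * nm v.1) * nm u.1 := mul_le_mul_of_nonneg_right h2 (nm_nonneg _)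
      _ ≤ ((∑ g ∈ t, nm g.1) * 3) * 3 := by
          have := hsum g' hg'
          have := hUnm u hu
          have := hUnm v hv
          have := nm_nonneg g'.1
          have := nm_nonneg u.1
          have := nm_nonneg v.1
          gcongr
      _ = _ := by ring
  by_cases hgt : g ∈ t
  · exact ⟨1, Γ.one_mem, hrep 1 g hgt 1 hU1 1 hU1 (by group)⟩
  · classical
    by_contra! hno
    have hP' : P (insert g t) := by
      have h1 : ∀ g' ∈ t, ∀ γ ∈ Γ, ∀ u ∈ U, ∀ v ∈ U, γ * g * u ≠ g' * v :=
        fun g' hg' γ hγ u hu v hv h =>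
          absurd (hrep γ g' hg' u hu v hv h) (not_le.mpr (hno γ hγ))
      refine ⟨fun x hx => ?_, fun x hx y hy hne γ hγ u hu v hv h => ?_⟩
      · rcases Finset.mem_insert.mp hx with rfl | hx
        · exact hg
        · exact ht.1 x hx
      · rcases Finset.mem_insert.mp hx with hxg | hxt
        · rcases Finset.mem_insert.mp hy with hyg | hyt
          · exact hne (hxg.trans hyg.symm)
          · exact h1 y hyt γ hγ u hu v hv (hxg ▸ h)
        · rcases Finset.mem_insert.mp hy with hyg | hyt
          · refine h1 x hxt γ⁻¹ (Γ.inv_mem hγ) v hv u hu ?_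
            rw [mul_assoc, ← hyg, ← h]; group
          · exact ht.2 x hxt y hyt hne γ hγ u hu v hv h
    have := hmax _ hP'
    rw [Finset.card_insert_of_notMem hgt] at this
    omega

/-- Upper unipotent elements. -/
def nU (u : ℝ) : SL2 := ⟨!![1, u; 0, 1], by simp [Matrix.det_fin_two_of]⟩

lemma continuous_nU : Continuous nU := by
  rw [continuous_SL2_iff]
  refine continuous_pi fun i => continuous_pi fun j => ?_
  fin_cases i <;> fin_cases j <;> simp [nU] <;> fun_prop

lemma continuous_amat : Continuous amat := by
  rw [continuous_SL2_iff]
  refine continuous_pi fun i => continuous_pi fun j => ?_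
  fin_cases i <;> fin_cases j <;> simp [amat] <;> fun_prop

/-- The elements `n(u)a(-t)`. -/
def na (u t : ℝ) : SL2 := nU u * amat (-t)

lemma na_coe (u t : ℝ) :
    (na u t).1 = !![Real.exp (-(t / 2)), u * Real.exp (t / 2); 0, Real.exp (t / 2)] := by
  unfold na
  rw [SL2_mul_coe]
  simp [nU, amat, neg_div]

lemma continuous_na : Continuous fun q : ℝ × ℝ => na q.1 q.2 :=
  (continuous_nU.comp continuous_fst).mul (continuous_amat.comp continuous_snd.neg)

lemma continuous_na_left (t : ℝ) : Continuous fun u => na u t :=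
  continuous_nU.mul continuous_const

lemma continuous_nm_conj {X : Type*} [TopologicalSpace X] {f : X → SL2} (hf : Continuous f)
    (v : Matrix (Fin 2) (Fin 2) ℝ) : Continuous fun u => nm (((f u)⁻¹).1 * v * (f u).1) :=
  continuous_nm.comp (((continuous_coe_SL2.comp hf.inv).mul continuous_const).mul
    (continuous_coe_SL2.comp hf))

lemma nm_na_le {u t : ℝ} (hu : u ∈ Set.Icc (0 : ℝ) 1) (ht : 0 ≤ t) :
    nm (na u t).1 ≤ 3 * Real.exp (t / 2) := by
  rw [na_coe]
  have h1 : Real.exp (-(t / 2)) ≤ Real.exp (t / 2) := Real.exp_le_exp.mpr (by linarith)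
  have h2 : u * Real.exp (t / 2) ≤ Real.exp (t / 2) :=
    mul_le_of_le_one_left (Real.exp_pos _).le hu.2
  have h3 : 0 ≤ u * Real.exp (t / 2) := mul_nonneg hu.1 (Real.exp_pos _).le
  simp [nm, abs_of_nonneg hu.1]
  linarith

lemma nm_na_sq_le {u t : ℝ} (hu : u ∈ Set.Icc (0 : ℝ) 1) (ht : 0 ≤ t) :
    nm (na u t).1 ^ 2 ≤ 9 * Real.exp t := by
  have h := pow_le_pow_left₀ (nm_nonneg _) (nm_na_le hu ht) 2
  have e : Real.exp t = Real.exp (t / 2) ^ 2 := by rw [← Real.exp_nat_mul]; congr 1; push_cast; ring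
  rw [e]; linarith [h, mul_pow 3 (Real.exp (t / 2)) 2]

lemma nm_conj_na_ge (u t x y z : ℝ) :
    Real.exp t * |y + 2 * x * u - z * u ^ 2| ≤
      nm (((na u t)⁻¹).1 * !![x, y; z, -x] * (na u t).1) := by
  have e : Real.exp t = Real.exp (t / 2) * Real.exp (t / 2) := by rw [← Real.exp_add]; ring_nf
  have h : (((na u t)⁻¹).1 * !![x, y; z, -x] * (na u t).1) 0 1 =
      Real.exp t * (y + 2 * x * u - z * u ^ 2) := by
    rw [SL2_inv_coe, na_coe]
    simp [Matrix.mul_apply, Fin.sum_univ_two]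
    rw [e]
    ring
  have h1 := abs_entry_le_nm (((na u t)⁻¹).1 * !![x, y; z, -x] * (na u t).1) 0 1
  rwa [h, abs_mul, abs_of_pos (Real.exp_pos t)] at h1

lemma rpow_quarter_le {X Y K : ℝ} (hY : 0 < Y) (hK : 0 < K) (h : Y ≤ K ^ 4 * X) :
    X ^ (-(1 / 4) : ℝ) ≤ K * Y ^ (-(1 / 4) : ℝ) := by
  have hX : 0 < X := by
    by_contra! hX
    nlinarith [pow_pos hK 4]
  have h1 := Real.rpow_le_rpow_of_nonpos hY h (show (-(1 / 4) : ℝ) ≤ 0 by norm_num)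
  rw [Real.mul_rpow (by positivity) hX.le, ← Real.rpow_natCast, ← Real.rpow_mul hK.le] at h1
  norm_num at h1
  rw [Real.rpow_neg_one] at h1
  have h2 := mul_le_mul_of_nonneg_left h1 hK.le
  rw [← mul_assoc, mul_inv_cancel₀ hK.ne', one_mul] at h2
  norm_num
  exact h2

lemma integral_le_of_sum_le {f : ℝ → ℝ} (hf : Continuous f) {N : ℕ} (hN : 0 < N) {C : ℝ}
    (h : ∀ w ∈ Set.Icc (0 : ℝ) 1, ∑ j ∈ Finset.range N, f ((N : ℝ)⁻¹ * w + j / N) ≤ N * C) :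
    ∫ u in (0 : ℝ)..1, f u ≤ C := by
  have hN' : (0 : ℝ) < N := Nat.cast_pos.mpr hN
  have h1 := intervalIntegral.sum_integral_adjacent_intervals (f := f) (μ := volume)
    (a := fun k : ℕ => (k : ℝ) / N) (n := N) (fun k _ => hf.intervalIntegrable _ _)
  simp only [Nat.cast_zero, zero_div, div_self hN'.ne'] at h1
  have h2 : ∀ k : ℕ, ∫ u in ((k : ℝ) / N)..((k + 1 : ℕ) : ℝ) / N, f u =
      (N : ℝ)⁻¹ * ∫ w in (0 : ℝ)..1, f ((N : ℝ)⁻¹ * w + k / N) := fun k => by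
    rw [intervalIntegral.integral_comp_mul_add f (inv_ne_zero hN'.ne'), smul_eq_mul, inv_inv,
      ← mul_assoc, inv_mul_cancel₀ hN'.ne', one_mul]
    congr 1
    · simp
    · push_cast; field_simp; ring
  rw [← h1, Finset.sum_congr rfl fun k _ => h2 k, ← Finset.mul_sum,
    ← intervalIntegral.integral_finsetSum fun k _ =>
      (Continuous.intervalIntegrable (by fun_prop) _ _)]
  have h3 : ∫ w in (0 : ℝ)..1, ∑ j ∈ Finset.range N, f ((N : ℝ)⁻¹ * w + j / N) ≤
      ∫ _w in (0 : ℝ)..1, (N * C : ℝ) :=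
    intervalIntegral.integral_mono_on zero_le_one
      (Continuous.intervalIntegrable (by fun_prop) _ _) (by simp) h
  simp only [intervalIntegral.integral_const, sub_zero, one_smul] at h3
  rw [inv_mul_le_iff₀ hN']
  exact h3

/-- A quadratic polynomial that is small at three separated points has small coefficients. -/
lemma quadratic_small {x y z ε : ℝ} {N : ℝ} (hN : 1 ≤ N) {a b c : ℝ}
    (ha : a ∈ Set.Icc (0 : ℝ) 1) (hb : b ∈ Set.Icc (0 : ℝ) 1)
    (hab : 1 ≤ N * |a - b|) (hac : 1 ≤ N * |a - c|) (hbc : 1 ≤ N * |b - c|)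
    (h1 : |y + 2 * x * a - z * a ^ 2| ≤ ε) (h2 : |y + 2 * x * b - z * b ^ 2| ≤ ε)
    (h3 : |y + 2 * x * c - z * c ^ 2| ≤ ε) : 2 * |x| + |y| + |z| ≤ 29 * N ^ 2 * ε := by
  have hε : 0 ≤ ε := (abs_nonneg _).trans h1
  have key : ∀ a b : ℝ, 1 ≤ N * |a - b| → |y + 2 * x * a - z * a ^ 2| ≤ ε →
      |y + 2 * x * b - z * b ^ 2| ≤ ε → |2 * x - z * (a + b)| ≤ 2 * ε * N := by
    intro a b hab h1 h2
    have e : |2 * x - z * (a + b)| * |a - b| ≤ 2 * ε := by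
      rw [← abs_mul, show (2 * x - z * (a + b)) * (a - b) =
        (y + 2 * x * a - z * a ^ 2) - (y + 2 * x * b - z * b ^ 2) by ring]
      have := abs_sub (y + 2 * x * a - z * a ^ 2) (y + 2 * x * b - z * b ^ 2)
      linarith
    nlinarith [abs_nonneg (2 * x - z * (a + b))]
  have k1 := key a b hab h1 h2
  have k2 := key a c hac h1 h3
  have hz : |z| ≤ 4 * ε * N ^ 2 := by
    have e : |z| * |b - c| ≤ 4 * ε * N := by
      rw [← abs_mul, show z * (b - c) = (2 * x - z * (a + c)) - (2 * x - z * (a + b)) by ring]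
      have := abs_sub (2 * x - z * (a + c)) (2 * x - z * (a + b))
      linarith
    nlinarith [abs_nonneg z]
  have hNN : N ≤ N ^ 2 := by nlinarith
  have hNe : ε * N ≤ ε * N ^ 2 := mul_le_mul_of_nonneg_left hNN hε
  have hNe' : ε ≤ ε * N ^ 2 := le_mul_of_one_le_right hε (by nlinarith)
  have hzab : |z * (a + b)| ≤ 2 * |z| := by
    rw [abs_mul, mul_comm]
    refine mul_le_mul_of_nonneg_right ?_ (abs_nonneg z)
    rw [abs_le]; constructor <;> linarith [ha.1, ha.2, hb.1, hb.2]
  have hx : 2 * |x| ≤ 10 * (ε * N ^ 2) := by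
    have : 2 * |x| = |2 * x| := by rw [abs_mul]; simp
    rw [this, show 2 * x = (2 * x - z * (a + b)) + z * (a + b) by ring]
    have := abs_add_le (2 * x - z * (a + b)) (z * (a + b))
    linarith
  have hza : |z * a ^ 2| ≤ |z| := by
    rw [abs_mul, abs_of_nonneg (sq_nonneg a)]
    exact mul_le_of_le_one_right (abs_nonneg z) (pow_le_one₀ ha.1 ha.2)
  have hxa : |2 * x * a| ≤ 2 * |x| := by
    rw [abs_mul, abs_mul, abs_of_nonneg ha.1]; simp
    nlinarith [abs_nonneg x, ha.2, ha.1]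
  have hy : |y| ≤ 15 * (ε * N ^ 2) := by
    rw [show y = (y + 2 * x * a - z * a ^ 2) - (2 * x * a - z * a ^ 2) by ring]
    have e1 := abs_sub (y + 2 * x * a - z * a ^ 2) (2 * x * a - z * a ^ 2)
    have e2 := abs_sub (2 * x * a) (z * a ^ 2)
    linarith
  linarith

lemma commute_of_sz_le {Γ : Subgroup SL2} (hΓ : IsDisc Γ) {g γ δ : SL2} (hγ : γ ∈ Γ) (hδ : δ ∈ Γ)
    (h0 : tl γ.1 ≠ 0) (h1 : sz γ g ≤ 1 / 64) (h2 : sz δ g ≤ 1 / 64) : γ * δ = δ * γ := by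
  obtain ⟨ε, hε, hd⟩ := discrete_conj hΓ g
  have hconj : IsDisc (Γ.map (MulAut.conj g⁻¹).toMonoidHom) := by
    refine ⟨ε, hε, ?_⟩
    rintro _ ⟨δ, hδ, rfl⟩ hlt
    have : (MulAut.conj g⁻¹).toMonoidHom δ = g⁻¹ * δ * g := by simp
    rw [this] at hlt ⊢
    rw [hd δ hδ hlt]; group
  have hmem : ∀ δ ∈ Γ, g⁻¹ * δ * g ∈ Γ.map (MulAut.conj g⁻¹).toMonoidHom := fun δ hδ =>
    ⟨δ, hδ, by simp⟩
  have hcomm := commute_of_small hconj (hmem γ hγ) (hmem δ hδ) (tl_conj_ne_zero g h0) h1 h2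
  have h3 := congrArg (fun p => g * p * g⁻¹) hcomm
  simpa [mul_assoc] using h3

/-- Near the cusp a single element of `Γ` controls the systole. -/
lemma exists_dominant {Γ : Subgroup SL2} (hΓ : IsDisc Γ) {g : SL2} (hg : sys Γ g < 1 / 128) :
    ∃ x y z : ℝ, sys Γ g ≤ nm !![x, y; z, -x] ∧ ∀ p : SL2, ∀ L, 0 < L → nm p.1 ^ 2 ≤ L →
      min (1 / (64 * L)) (nm ((p⁻¹).1 * !![x, y; z, -x] * p.1) / 2) ≤ sys Γ (g * p) := by
  have hpos := sys_pos hΓ g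
  obtain ⟨γ₀, hγ₀, h0, hs⟩ := exists_sz_lt (Γ := Γ) (g := g) (c := 2 * sys Γ g) (by linarith)
    (by linarith)
  obtain ⟨x, y, z, hv⟩ : ∃ x y z, tl (g⁻¹ * γ₀ * g).1 = !![x, y; z, -x] :=
    ⟨_, _, _, tl_explicit _⟩
  refine ⟨x, y, z, ?_, ?_⟩
  · rw [← hv]; exact sys_le_sz hγ₀ h0 g
  · intro p L hL hp
    rw [← hv]
    refine le_sys (min_le_of_left_le ?_) fun γ hγ hγ0 => ?_
    · have : 1 ≤ L := (one_le_pow₀ (nm_SL2_ge_one p)).trans hp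
      rw [div_le_one (by positivity)]; linarith
    · by_cases hsm : sz γ g ≤ 1 / 64
      · refine min_le_of_right_le ?_
        have hcomm := commute_of_sz_le hΓ hγ₀ hγ h0 (by linarith) hsm
        obtain ⟨c, hc⟩ := tl_eq_smul_of_commute (A := g⁻¹ * γ₀ * g) (B := g⁻¹ * γ * g)
          (by
            rw [show g⁻¹ * γ₀ * g * (g⁻¹ * γ * g) = g⁻¹ * (γ₀ * γ) * g by group, hcomm]
            group) (tl_conj_ne_zero g h0)
        have h1 : sz γ g = |c| * sz γ₀ g := by unfold sz; rw [hc, nm_smul]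
        have h2 := sys_le_sz hγ hγ0 g
        have h3 : 1 / 2 ≤ |c| := by
          by_contra! h
          have := mul_le_mul_of_nonneg_right h.le (sz_nonneg γ₀ g)
          linarith
        rw [sz_mul, hc, Matrix.mul_smul, Matrix.smul_mul, nm_smul]
        have := nm_nonneg ((p⁻¹).1 * tl (g⁻¹ * γ₀ * g).1 * p.1)
        nlinarith
      · refine min_le_of_left_le ?_
        push Not at hsm
        have h1 := sz_le_mul γ g p
        have h2 := mul_le_mul_of_nonneg_right hp (sz_nonneg γ (g * p))
        rw [div_le_iff₀ (by positivity)]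
        linarith

lemma sum_le_of_card_bad {N : ℕ} {f : ℕ → ℝ} {A B : ℝ} (hA : 0 ≤ A) (hB : 0 ≤ B)
    (P : ℕ → Prop) (hgood : ∀ j < N, ¬ P j → f j ≤ A) (hbad : ∀ j < N, P j → f j ≤ B)
    (hcard : ∀ i < N, ∀ j < N, ∀ k < N, P i → P j → P k → i ≠ j → i ≠ k → j ≠ k → False) :
    ∑ j ∈ Finset.range N, f j ≤ N * A + 2 * B := by
  classical
  have h1 : ∑ j ∈ Finset.range N, f j ≤ ∑ j ∈ Finset.range N, (A + if P j then B else 0) := by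
    refine Finset.sum_le_sum fun j hj => ?_
    rw [Finset.mem_range] at hj
    split_ifs with h
    · linarith [hbad j hj h]
    · linarith [hgood j hj h]
  refine h1.trans ?_
  rw [Finset.sum_add_distrib, Finset.sum_const, Finset.card_range, nsmul_eq_mul,
    ← Finset.sum_filter, Finset.sum_const, nsmul_eq_mul]
  have h2 : ((Finset.range N).filter P).card ≤ 2 := by
    by_contra! h
    obtain ⟨i, j, k, hi, hj, hk, hij, hik, hjk⟩ := Finset.two_lt_card_iff.mp h
    simp only [Finset.mem_filter, Finset.mem_range] at hi hj hk
    exact hcard i hi.1 j hj.1 k hk.1 hi.2 hj.2 hk.2 hij hik hjk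
  have h3 : (((Finset.range N).filter P).card : ℝ) ≤ 2 := by exact_mod_cast h2
  have := mul_le_mul_of_nonneg_right h3 hB
  linarith

lemma one_le_mul_abs_sub {N : ℕ} (hN : 0 < N) (w : ℝ) {i j : ℕ} (h : i ≠ j) :
    (1 : ℝ) ≤ N * |((N : ℝ)⁻¹ * w + i / N) - ((N : ℝ)⁻¹ * w + j / N)| := by
  have hN' : (0 : ℝ) < N := Nat.cast_pos.mpr hN
  rw [add_sub_add_left_eq_sub, ← sub_div, abs_div, abs_of_pos hN', mul_div_cancel₀ _ hN'.ne']
  have : (1 : ℤ) ≤ |(i : ℤ) - j| := Int.one_le_abs (sub_ne_zero.mpr (by exact_mod_cast h))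
  exact_mod_cast this

lemma node_mem {N : ℕ} (hN : 0 < N) {w : ℝ} (hw : w ∈ Set.Icc (0 : ℝ) 1) {j : ℕ} (h : j < N) :
    (N : ℝ)⁻¹ * w + j / N ∈ Set.Icc (0 : ℝ) 1 := by
  have hN' : (0 : ℝ) < N := Nat.cast_pos.mpr hN
  have h1 : (j : ℝ) + 1 ≤ N := by exact_mod_cast h
  have e : (N : ℝ)⁻¹ * w + j / N = (w + j) / N := by field_simp
  rw [e]
  have := hw.1
  exact ⟨by positivity, (div_le_one hN').mpr (by linarith [hw.2])⟩

/-- The times used in the averaging operators. -/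
def driftTime (M : ℕ) : ℝ := 2 * Real.log (128 * M ^ 2)

lemma exp_driftTime {M : ℕ} (hM : 0 < M) : Real.exp (driftTime M) = (128 * M ^ 2 : ℝ) ^ 2 := by
  have : (0 : ℝ) < M := Nat.cast_pos.mpr hM
  rw [driftTime, two_mul, Real.exp_add, Real.exp_log (by positivity)]; ring

lemma driftTime_nonneg {M : ℕ} (hM : 0 < M) : 0 ≤ driftTime M := by
  have : (1 : ℝ) ≤ M := by exact_mod_cast hM
  exact mul_nonneg zero_le_two (Real.log_nonneg (by nlinarith))

lemma integral_unit_le {f : ℝ → ℝ} (hf : Continuous f) {C : ℝ}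
    (h : ∀ u ∈ Set.Icc (0 : ℝ) 1, f u ≤ C) : ∫ u in (0 : ℝ)..1, f u ≤ C := by
  have h1 := intervalIntegral.integral_mono_on zero_le_one (hf.intervalIntegrable 0 1)
    (continuous_const.intervalIntegrable (μ := volume) 0 1) h
  simpa using h1

lemma integral_conj_quarter_le {M : ℕ} (hM : 248 ≤ M) {t : ℝ}
    (ht : t ∈ Set.Icc (driftTime M) (driftTime M + 1)) {x y z : ℝ} (hv : 0 < nm !![x, y; z, -x]) :
    ∫ u in (0 : ℝ)..1, (nm (((na u t)⁻¹).1 * !![x, y; z, -x] * (na u t).1) / 2) ^ (-(1 / 4) : ℝ) ≤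
      1 / 2 * nm !![x, y; z, -x] ^ (-(1 / 4) : ℝ) := by
  have hM0 : 0 < M := by omega
  have hMr : (248 : ℝ) ≤ M := by exact_mod_cast hM
  have hMp : (0 : ℝ) < M := by linarith
  have ht0 : 0 ≤ t := (driftTime_nonneg hM0).trans ht.1
  have he1 : (128 * M ^ 2 : ℝ) ^ 2 ≤ Real.exp t := by
    rw [← exp_driftTime hM0]; exact Real.exp_le_exp.mpr ht.1
  have he2 : Real.exp t ≤ 2.7182818286 * (128 * M ^ 2 : ℝ) ^ 2 := by
    rw [← exp_driftTime hM0]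
    refine (Real.exp_le_exp.mpr ht.2).trans ?_
    rw [Real.exp_add, mul_comm]
    exact mul_le_mul_of_nonneg_right Real.exp_one_lt_d9.le (Real.exp_pos _).le
  set v : Matrix (Fin 2) (Fin 2) ℝ := !![x, y; z, -x] with hvd
  set n := nm v ^ (-(1 / 4) : ℝ) with hn
  have hn0 : 0 ≤ n := Real.rpow_nonneg hv.le _
  set X : ℝ → ℝ := fun u => nm (((na u t)⁻¹).1 * v * (na u t).1) with hX
  have hXge : ∀ u, nm v ≤ nm (na u t).1 ^ 2 * X u := fun u => nm_conj_ge _ _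
  have hXpos : ∀ u, 0 < X u := fun u => by
    have := hXge u
    by_contra! h
    nlinarith [sq_nonneg (nm (na u t).1)]
  have hXc : Continuous X := continuous_nm_conj (continuous_na_left t) v
  obtain ⟨N, hN⟩ : ∃ N : ℕ, (N : ℝ) = M ^ 2 := ⟨M ^ 2, by push_cast; rfl⟩
  have hNpos : 0 < N := by
    have : (0 : ℝ) < N := by rw [hN]; positivity
    exact_mod_cast this
  refine integral_le_of_sum_le (N := N) ?_ hNpos fun w hw => ?_
  · exact (hXc.div_const 2).rpow_const fun u => Or.inl (by have := hXpos u; positivity)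
  have hsum := sum_le_of_card_bad (N := N)
    (f := fun j : ℕ => (X ((N : ℝ)⁻¹ * w + j / N) / 2) ^ (-(1 / 4) : ℝ))
    (A := 1 / 4 * n) (B := 31 * M * n) (by positivity) (by positivity)
    (fun j => |y + 2 * x * ((N : ℝ)⁻¹ * w + j / N) -
      z * ((N : ℝ)⁻¹ * w + j / N) ^ 2| < nm v / (32 * M ^ 4)) ?_ ?_ ?_
  · refine hsum.trans ?_
    rw [hN]
    have : 31 * M * 2 * n ≤ 1 / 4 * (M : ℝ) ^ 2 * n :=
      mul_le_mul_of_nonneg_right (by nlinarith) hn0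
    linarith
  · intro j hj hgood
    push Not at hgood
    refine rpow_quarter_le hv (by norm_num) ?_
    have h1 := nm_conj_na_ge ((N : ℝ)⁻¹ * w + j / N) t x y z
    have h2 := mul_le_mul he1 hgood (by positivity) (Real.exp_pos t).le
    have h3 := h2.trans h1
    have e : (128 * (M : ℝ) ^ 2) ^ 2 * (nm v / (32 * M ^ 4)) = 512 * nm v := by
      field_simp; norm_num
    rw [e] at h3
    change 512 * nm v ≤ X _ at h3
    linarith
  · intro j hj _
    refine rpow_quarter_le hv (by positivity) ?_
    have h1 := hXge ((N : ℝ)⁻¹ * w + j / N)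
    have h2 := nm_na_sq_le (node_mem hNpos hw hj) ht0
    refine h1.trans ?_
    have h3 := (hXpos ((N : ℝ)⁻¹ * w + j / N)).le
    have h4 : nm (na ((N : ℝ)⁻¹ * w + j / N) t).1 ^ 2 ≤
        (31 * M : ℝ) ^ 4 / 2 := by
      have h5 : (0 : ℝ) ≤ M ^ 4 := by positivity
      nlinarith
    calc _ ≤ ((31 * M : ℝ) ^ 4 / 2) * X _ := mul_le_mul_of_nonneg_right h4 h3
      _ = _ := by ring
  · intro i hi j hj k hk h1 h2 h3 hij hik hjk
    have h4 := quadratic_small (N := (N : ℝ)) (by exact_mod_cast hNpos)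
      (node_mem hNpos hw hi) (node_mem hNpos hw hj)
      (one_le_mul_abs_sub hNpos w hij) (one_le_mul_abs_sub hNpos w hik)
      (one_le_mul_abs_sub hNpos w hjk) h1.le h2.le h3.le
    have h5 : nm v = 2 * |x| + |y| + |z| := by rw [hvd]; simp [nm]; ring
    rw [← h5] at h4
    rw [hN] at h4
    have e : 29 * ((M : ℝ) ^ 2) ^ 2 * (nm v / (32 * M ^ 4)) = 29 / 32 * nm v := by
      field_simp
    rw [e] at h4
    linarith

/-- The height function is contracted by horocycle averages followed by the geodesic flow. -/
lemma drift {Γ : Subgroup SL2} (hΓ : IsDisc Γ) {M : ℕ} (hM : 248 ≤ M) :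
    ∃ b, 0 ≤ b ∧ ∀ t ∈ Set.Icc (driftTime M) (driftTime M + 1), ∀ g,
      ∫ u in (0 : ℝ)..1, ht Γ (g * na u t) ≤ 1 / 2 * ht Γ g + b := by
  have hM0 : 0 < M := by omega
  set L : ℝ := 9 * Real.exp (driftTime M + 1) with hL
  have hL0 : 0 < L := by positivity
  have hLnm : ∀ t ∈ Set.Icc (driftTime M) (driftTime M + 1), ∀ u ∈ Set.Icc (0 : ℝ) 1,
      nm (na u t).1 ^ 2 ≤ L := fun t ht u hu =>
    (nm_na_sq_le hu ((driftTime_nonneg hM0).trans ht.1)).trans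
      (mul_le_mul_of_nonneg_left (Real.exp_le_exp.mpr ht.2) (by norm_num))
  have hc : ∀ g t, Continuous fun u => ht Γ (g * na u t) := fun g t =>
    (continuous_ht hΓ).comp (continuous_const.mul (continuous_na_left t))
  set b1 : ℝ := (1 / (64 * L)) ^ (-(1 / 4) : ℝ) with hb1
  set b2 : ℝ := L * (1 / 128) ^ (-(1 / 4) : ℝ) with hb2
  have hb1p : 0 ≤ b1 := by positivity
  have hb2p : 0 ≤ b2 := by positivity
  refine ⟨b1 + b2, by positivity, fun t ht' g => ?_⟩
  have hg1 := one_le_ht hΓ g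
  by_cases hg : sys Γ g < 1 / 128
  · obtain ⟨x, y, z, hv, hdom⟩ := exists_dominant hΓ hg
    have hv0 : 0 < nm !![x, y; z, -x] := (sys_pos hΓ g).trans_le hv
    have hpt : ∀ u ∈ Set.Icc (0 : ℝ) 1, ht Γ (g * na u t) ≤ b1 +
        (nm (((na u t)⁻¹).1 * !![x, y; z, -x] * (na u t).1) / 2) ^ (-(1 / 4) : ℝ) := by
      intro u hu
      have h1 := hdom (na u t) L hL0 (hLnm t ht' u hu)
      have h2 := nm_conj_ge (na u t) !![x, y; z, -x]
      have h3 : 0 < nm (((na u t)⁻¹).1 * !![x, y; z, -x] * (na u t).1) := by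
        by_contra! h
        nlinarith [sq_nonneg (nm (na u t).1)]
      have h4 : 0 ≤ (nm (((na u t)⁻¹).1 * !![x, y; z, -x] * (na u t).1) / 2) ^
        (-(1 / 4) : ℝ) := by positivity
      rcases min_le_iff.mp h1 with h | h
      · have := Real.rpow_le_rpow_of_nonpos (by positivity) h (show (-(1 / 4) : ℝ) ≤ 0 by norm_num)
        unfold ht; linarith
      · have := Real.rpow_le_rpow_of_nonpos (by positivity) h (show (-(1 / 4) : ℝ) ≤ 0 by norm_num)
        unfold ht; linarith
    have hXc : Continuous fun u =>
        (nm (((na u t)⁻¹).1 * !![x, y; z, -x] * (na u t).1) / 2) ^ (-(1 / 4) : ℝ) := by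
      refine ((continuous_nm_conj (continuous_na_left t) _).div_const 2).rpow_const
        fun u => Or.inl ?_
      have h2 := nm_conj_ge (na u t) !![x, y; z, -x]
      intro h
      have : nm (((na u t)⁻¹).1 * !![x, y; z, -x] * (na u t).1) = 0 := by
        have h3 : nm (((na u t)⁻¹).1 * !![x, y; z, -x] * (na u t).1) / 2 = 0 := h
        linarith
      rw [this] at h2
      linarith
    have h1 := integral_unit_le ((hc g t).sub hXc) fun u hu =>
      (sub_le_iff_le_add (b := b1)).mpr (hpt u hu)
    simp only [Pi.sub_apply] at h1
    rw [intervalIntegral.integral_sub ((hc g t).intervalIntegrable 0 1)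
      (hXc.intervalIntegrable 0 1)] at h1
    have h2 := integral_conj_quarter_le hM ht' hv0
    have h3 := Real.rpow_le_rpow_of_nonpos (sys_pos hΓ g) hv (show (-(1 / 4) : ℝ) ≤ 0 by norm_num)
    change _ ≤ ht Γ g at h3
    linarith
  · push Not at hg
    have h0 := Real.rpow_le_rpow_of_nonpos (by norm_num) hg (show (-(1 / 4) : ℝ) ≤ 0 by norm_num)
    have hpt : ∀ u ∈ Set.Icc (0 : ℝ) 1, ht Γ (g * na u t) ≤ b2 := fun u hu => by
      refine (ht_mul_le hΓ g _).trans ?_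
      have h1 := hLnm t ht' u hu
      have h2 := nm_SL2_ge_one (na u t)
      exact mul_le_mul (by nlinarith) h0 (zero_le_one.trans hg1) hL0.le
    have h1 := integral_unit_le (hc g t) hpt
    linarith

lemma nm_conj_amat (s x y z : ℝ) :
    nm (((amat s)⁻¹).1 * !![x, y; z, -x] * (amat s).1) =
      2 * |x| + Real.exp (-s) * |y| + Real.exp s * |z| := by
  have e1 : Real.exp (-(s / 2)) * Real.exp (s / 2) = 1 := by rw [← Real.exp_add]; simp
  have e2 : Real.exp (-s) = Real.exp (-(s / 2)) * Real.exp (-(s / 2)) := by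
    rw [← Real.exp_add]; ring_nf
  have e3 : Real.exp s = Real.exp (s / 2) * Real.exp (s / 2) := by rw [← Real.exp_add]; ring_nf
  have h : ((amat s)⁻¹).1 * !![x, y; z, -x] * (amat s).1 =
      !![x, Real.exp (-s) * y; Real.exp s * z, -x] := by
    rw [SL2_inv_coe, e2, e3]
    ext i j
    fin_cases i <;> fin_cases j <;> simp [amat]
    · linear_combination x * e1
    · ring
    · ring
    · linear_combination x * e1
  rw [h]
  simp [nm, abs_mul]
  ring

lemma nm_amat_one_sq_le : nm (amat 1).1 ^ 2 ≤ 9 := by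
  have h1 : Real.exp (1 / 2) ≤ 2 := by
    have h := Real.exp_one_lt_d9
    have e : Real.exp 1 = Real.exp (1 / 2) * Real.exp (1 / 2) := by rw [← Real.exp_add]; norm_num
    nlinarith [Real.exp_pos (1 / 2)]
  have h2 : Real.exp (-(1 / 2)) ≤ 1 := Real.exp_le_one_iff.mpr (by norm_num)
  have h3 : nm (amat 1).1 ≤ 3 := by
    rw [one_div] at h1 h2
    simp [nm, amat]
    linarith
  nlinarith [nm_nonneg (amat 1).1]

lemma amat_add (s t : ℝ) : amat (s + t) = amat s * amat t := by
  apply SL2_ext'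
  rw [SL2_mul_coe]
  ext i j
  fin_cases i <;> fin_cases j <;> simp [amat, ← Real.exp_add] <;> ring_nf

/-- A divergent geodesic ends in a cusp: its endpoint is fixed by a parabolic element of `Γ`. -/
lemma exists_unipotent_of_divergent {Γ : Subgroup SL2} (hΓ : IsDisc Γ) {g : SL2}
    (hdiv : ∀ r > 0, ∃ s₁ : ℝ, ∀ s, s₁ ≤ s → sys Γ (g * amat s) < r) :
    ∃ c : ℝ, c ≠ 0 ∧ ∃ γ ∈ Γ, γ * g = g * nU c := by
  obtain ⟨s₁, hs₁⟩ := hdiv (1 / 600) (by norm_num)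
  have hex : ∀ j : ℕ, ∃ γ ∈ Γ, tl γ.1 ≠ 0 ∧ sz γ (g * amat (s₁ + j)) < 1 / 600 ∧
      sz γ (g * amat (s₁ + j)) < 2 * sys Γ (g * amat (s₁ + j)) := fun j => by
    have h1 := hs₁ (s₁ + j) (by simp)
    have h2 := sys_pos hΓ (g * amat (s₁ + j))
    obtain ⟨γ, h3, h4, h5⟩ := exists_sz_lt (Γ := Γ) (g := g * amat (s₁ + j))
      (c := min (1 / 600) (2 * sys Γ (g * amat (s₁ + j))))
      ((min_le_left _ _).trans (by norm_num)) (lt_min h1 (by linarith))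
    exact ⟨γ, h3, h4, h5.trans_le (min_le_left _ _), h5.trans_le (min_le_right _ _)⟩
  choose γ hγ hγ0 hsm hsys using hex
  have hprop : ∀ j, ∃ c : ℝ, tl (γ j).1 = c • tl (γ 0).1 := fun j => by
    induction j with
    | zero => exact ⟨1, by simp⟩
    | succ j ih =>
      obtain ⟨c, hc⟩ := ih
      have e : g * amat (s₁ + (j + 1 : ℕ)) = g * amat (s₁ + j) * amat 1 := by
        rw [mul_assoc, ← amat_add]; push_cast; ring_nf
      have h1 : sz (γ j) (g * amat (s₁ + (j + 1 : ℕ))) ≤ 1 / 64 := by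
        rw [e]
        refine (sz_mul_le _ _ _).trans ?_
        have := mul_le_mul nm_amat_one_sq_le (hsm j).le (sz_nonneg _ _) (by norm_num)
        linarith
      have h2 := commute_of_sz_le hΓ (hγ j) (hγ (j + 1)) (hγ0 j) h1
        ((hsm (j + 1)).le.trans (by norm_num))
      obtain ⟨c', hc'⟩ := tl_eq_smul_of_commute h2 (hγ0 j)
      exact ⟨c' * c, by rw [hc', hc, smul_smul]⟩
  have hszsmul : ∀ j p c, tl (γ j).1 = c • tl (γ 0).1 → sz (γ j) p = |c| * sz (γ 0) p :=
    fun j p c hc => by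
      rw [sz_eq, sz_eq, hc, Matrix.mul_smul, Matrix.smul_mul, nm_smul]
  have hsg := sys_pos hΓ g
  have hs0 : 0 < sz (γ 0) g := hsg.trans_le (sys_le_sz (hγ 0) (hγ0 0) g)
  have hsmall : ∀ ε > 0, ∃ s ≥ (0 : ℝ), sz (γ 0) (g * amat s) < ε := fun ε hε => by
    obtain ⟨s₂, hs₂⟩ := hdiv (ε * sys Γ g / (2 * sz (γ 0) g)) (by positivity)
    obtain ⟨j, hj⟩ := exists_nat_ge (max 0 s₂ - s₁)
    have h0 : 0 ≤ s₁ + j := by linarith [le_max_left 0 s₂]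
    have h2 := hs₂ (s₁ + j) (by linarith [le_max_right 0 s₂])
    obtain ⟨c, hc⟩ := hprop j
    have h3 := hszsmul j g c hc
    have h4 := hszsmul j (g * amat (s₁ + j)) c hc
    have h5 := sys_le_sz (hγ j) (hγ0 j) g
    have h6 := hsys j
    refine ⟨s₁ + j, h0, ?_⟩
    rw [lt_div_iff₀ (by positivity)] at h2
    rw [h3] at h5
    rw [h4] at h6
    by_contra! h
    have h7 : |c| * ε ≤ |c| * sz (γ 0) (g * amat (s₁ + j)) :=
      mul_le_mul_of_nonneg_left h (abs_nonneg c)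
    have h8 : |c| * ε < 2 * sys Γ (g * amat (s₁ + j)) := by linarith
    have h9 := mul_lt_mul_of_pos_right h8 hs0
    have h10 := mul_le_mul_of_nonneg_right h5 hε.le
    linarith
  obtain ⟨x, y, z, hv⟩ : ∃ x y z, tl (g⁻¹ * γ 0 * g).1 = !![x, y; z, -x] :=
    ⟨_, _, _, tl_explicit _⟩
  have hsz : ∀ s, sz (γ 0) (g * amat s) = 2 * |x| + Real.exp (-s) * |y| + Real.exp s * |z| :=
    fun s => by rw [sz_mul, hv, nm_conj_amat]
  have hxz : 2 * |x| + |z| = 0 := by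
    by_contra hne
    have hpos : 0 < 2 * |x| + |z| := lt_of_le_of_ne (by positivity) (Ne.symm hne)
    obtain ⟨s, hs, hlt⟩ := hsmall _ hpos
    rw [hsz] at hlt
    have h1 : 1 ≤ Real.exp s := Real.one_le_exp hs
    have h2 : 0 ≤ Real.exp (-s) * |y| := by positivity
    nlinarith [abs_nonneg z]
  have hx : x = 0 := abs_eq_zero.mp (by linarith [abs_nonneg x, abs_nonneg z])
  have hz : z = 0 := abs_eq_zero.mp (by linarith [abs_nonneg x, abs_nonneg z])
  have hy : y ≠ 0 := by
    intro hy
    apply tl_conj_ne_zero g (hγ0 0)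
    rw [hv, hx, hy, hz]
    ext i j; fin_cases i <;> fin_cases j <;> simp
  set A := g⁻¹ * γ 0 * g with hA
  set τ := A.1.trace / 2 with hτ
  have hA1 : A.1 = !![τ, y; 0, τ] := by
    have h1 : A.1 = tl A.1 + τ • 1 := by simp [tl, hτ]
    rw [h1, hv, hx, hz]
    ext i j; fin_cases i <;> fin_cases j <;> simp
  have hτ1 : τ * τ = 1 := by
    have := SL2_det A
    rw [hA1] at this
    simpa using this
  refine ⟨2 * τ * y, ?_, γ 0 * γ 0, Γ.mul_mem (hγ 0) (hγ 0), ?_⟩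
  · have : τ ≠ 0 := by rintro h; rw [h] at hτ1; norm_num at hτ1
    positivity
  · have h1 : A * A = nU (2 * τ * y) := by
      apply SL2_ext'
      rw [SL2_mul_coe, hA1]
      ext i j
      fin_cases i <;> fin_cases j <;> simp [nU, hτ1]
      ring
    rw [← h1, hA]
    group

/-- The matrix diagonalizing `h(s)`. -/
def kmat : SL2 := ⟨!![1, -(1 / 2); 1, 1 / 2], by simp [Matrix.det_fin_two_of]; norm_num⟩

lemma hmat_mul_kmat (s : ℝ) : hmat s * kmat = kmat * amat s := by
  apply SL2_ext'
  rw [SL2_mul_coe, SL2_mul_coe]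
  ext i j
  fin_cases i <;> fin_cases j <;>
    simp [hmat, kmat, amat, Real.cosh_eq, Real.sinh_eq] <;> ring

lemma continuous_qmk (Γ : Subgroup SL2) : Continuous (qmk Γ) := continuous_quotient_mk'

lemma sys_divergent {Γ : Subgroup SL2} (hlat : IsLatticeSL2 Γ) {g : SL2}
    (hdiv : ∀ C : Set (XQuot Γ), IsCompact C →
      ∃ s₁ : ℝ, 0 < s₁ ∧ ∀ s : ℝ, s₁ ≤ s → rmul Γ (qmk Γ g) (hmat s) ∉ C) :
    ∀ r > 0, ∃ s₁ : ℝ, ∀ s, s₁ ≤ s → sys Γ (g * kmat * amat s) < r := by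
  intro r hr
  have hk := nm_SL2_ge_one kmat
  obtain ⟨C, hC⟩ := exists_reduction hlat (r := r / nm kmat.1 ^ 2) (by positivity)
  obtain ⟨s₁, -, hs₁⟩ := hdiv (qmk Γ '' {p | nm p.1 ≤ C})
    ((isCompact_nm_le C).image (continuous_qmk Γ))
  refine ⟨s₁, fun s hs => ?_⟩
  have h1 : sys Γ (g * hmat s) < r / nm kmat.1 ^ 2 := by
    by_contra! h
    obtain ⟨γ, hγ, hn⟩ := hC _ h
    refine hs₁ s hs ⟨γ * (g * hmat s), hn, ?_⟩
    change Quotient.mk _ _ = Quotient.mk _ _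
    refine Quotient.sound ?_
    change (QuotientGroup.rightRel Γ) _ _
    rw [QuotientGroup.rightRel_apply]
    have e : g * hmat s * (γ * (g * hmat s))⁻¹ = γ⁻¹ := by group
    rw [e]; exact Γ.inv_mem hγ
  have h2 := sys_le_mul Γ (g * kmat * amat s) kmat⁻¹
  have e : g * kmat * amat s * kmat⁻¹ = g * hmat s := by
    rw [mul_assoc g, ← hmat_mul_kmat]; group
  rw [nm_inv, e] at h2
  rw [lt_div_iff₀ (by positivity)] at h1
  linarith

lemma abs_integral_le_of_le {f : ℝ → ℝ} {a b B : ℝ} (h : ∀ u ∈ Set.uIcc a b, |f u| ≤ B) :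
    |∫ u in a..b, f u| ≤ B * |b - a| := by
  rw [← Real.norm_eq_abs]
  exact intervalIntegral.norm_integral_le_of_norm_le_const fun u hu =>
    h u (Set.uIoc_subset_uIcc hu)

lemma uIcc_subset_of_mem {a b x y : ℝ} (hx : x ∈ Set.Icc a b) (hy : y ∈ Set.Icc a b) :
    Set.uIcc x y ⊆ Set.Icc a b :=
  Set.uIcc_subset_Icc hx hy

/-- A double average changes little under a change of variables close to the identity. -/
lemma abs_integral_change_le {F : ℝ → ℝ → ℝ} (hF : Continuous fun q : ℝ × ℝ => F q.1 q.2)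
    {φ φ' τ : ℝ → ℝ} {κ B t₀ : ℝ} (hκ : 4 * κ ≤ 1)
    (hB : ∀ v ∈ Set.Icc (-1 : ℝ) 2, ∀ t ∈ Set.Icc (t₀ - 1) (t₀ + 2), |F v t| ≤ B)
    (hφc : Continuous φ) (hτc : Continuous τ) (hφ'c : Continuous φ')
    (hφ : ∀ u ∈ Set.Ioo (0 : ℝ) 1, HasDerivAt φ (φ' u) u)
    (h1 : ∀ u ∈ Set.Icc (0 : ℝ) 1, |φ u - u| ≤ 2 * κ)
    (h2 : ∀ u ∈ Set.Icc (0 : ℝ) 1, |φ' u - 1| ≤ 4 * κ)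
    (h3 : ∀ u ∈ Set.Icc (0 : ℝ) 1, |τ u| ≤ 4 * κ) :
    |(∫ u in (0 : ℝ)..1, ∫ t in t₀..(t₀ + 1), F (φ u) (t + τ u)) -
      ∫ u in (0 : ℝ)..1, ∫ t in t₀..(t₀ + 1), F u t| ≤ 16 * κ * B := by
  set H : ℝ → ℝ := fun v => ∫ t in t₀..(t₀ + 1), F v t with hH
  have hB0 : 0 ≤ B := (abs_nonneg _).trans (hB 0 (by norm_num) t₀ (by constructor <;> linarith))
  have hHc : Continuous H :=
    intervalIntegral.continuous_parametric_intervalIntegral_of_continuous' hF _ _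
  have hHB : ∀ v ∈ Set.Icc (-1 : ℝ) 2, |H v| ≤ B := fun v hv => by
    refine (abs_integral_le_of_le fun t ht => hB v hv t ?_).trans (by simp)
    rw [Set.uIcc_of_le (by linarith)] at ht
    constructor <;> linarith [ht.1, ht.2]
  have hφm : ∀ u ∈ Set.Icc (0 : ℝ) 1, φ u ∈ Set.Icc (-1 : ℝ) 2 := fun u hu => by
    have := abs_le.mp (h1 u hu)
    constructor <;> linarith [hu.1, hu.2]
  have hGc : Continuous fun u => ∫ t in t₀..(t₀ + 1), F (φ u) (t + τ u) :=
    intervalIntegral.continuous_parametric_intervalIntegral_of_continuous'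
      (f := fun u t => F (φ u) (t + τ u))
      (hF.comp ((hφc.comp continuous_fst).prodMk
        (continuous_snd.add (hτc.comp continuous_fst)))) _ _
  have hFv : ∀ v, Continuous (F v) := fun v => hF.comp (continuous_const.prodMk continuous_id)
  have hHφ : Continuous fun u => H (φ u) := hHc.comp hφc
  have hHφ' : Continuous fun u => H (φ u) * φ' u := hHφ.mul hφ'c
  have e1 : |(∫ u in (0 : ℝ)..1, ∫ t in t₀..(t₀ + 1), F (φ u) (t + τ u)) -
      ∫ u in (0 : ℝ)..1, H (φ u)| ≤ 8 * κ * B := by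
    rw [← intervalIntegral.integral_sub (hGc.intervalIntegrable _ _)
      (hHφ.intervalIntegrable _ _)]
    refine (abs_integral_le_of_le (B := 8 * κ * B) fun u hu => ?_).trans (by simp)
    rw [Set.uIcc_of_le zero_le_one] at hu
    have hτ := abs_le.mp (h3 u hu)
    rw [intervalIntegral.integral_comp_add_right (fun t => F (φ u) t), hH]
    simp only
    rw [intervalIntegral.integral_interval_sub_interval_comm
      ((hFv _).intervalIntegrable _ _) ((hFv _).intervalIntegrable _ _)
      ((hFv _).intervalIntegrable _ _)]
    have b1 : |∫ t in (t₀ + τ u)..t₀, F (φ u) t| ≤ B * |t₀ - (t₀ + τ u)| :=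
      abs_integral_le_of_le fun t ht => hB _ (hφm u hu) t (uIcc_subset_of_mem
        (by constructor <;> linarith) (by constructor <;> linarith) ht)
    have b2 : |∫ t in (t₀ + 1 + τ u)..(t₀ + 1), F (φ u) t| ≤ B * |t₀ + 1 - (t₀ + 1 + τ u)| :=
      abs_integral_le_of_le fun t ht => hB _ (hφm u hu) t (uIcc_subset_of_mem
        (by constructor <;> linarith) (by constructor <;> linarith) ht)
    have a1 : |t₀ - (t₀ + τ u)| = |τ u| := by rw [← abs_neg]; ring_nf
    have a2 : |t₀ + 1 - (t₀ + 1 + τ u)| = |τ u| := by rw [← abs_neg]; ring_nf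
    rw [a1] at b1; rw [a2] at b2
    have := mul_le_mul_of_nonneg_left (h3 u hu) hB0
    calc _ ≤ _ := abs_sub _ _
      _ ≤ 8 * κ * B := by linarith
  have e2 : |(∫ u in (0 : ℝ)..1, H (φ u)) - ∫ u in (0 : ℝ)..1, H (φ u) * φ' u| ≤
      4 * κ * B := by
    rw [← intervalIntegral.integral_sub (hHφ.intervalIntegrable _ _)
      (hHφ'.intervalIntegrable _ _)]
    refine (abs_integral_le_of_le (B := 4 * κ * B) fun u hu => ?_).trans (by simp)
    rw [Set.uIcc_of_le zero_le_one] at hu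
    rw [show H (φ u) - H (φ u) * φ' u = -(φ' u - 1) * H (φ u) by ring, abs_mul, abs_neg]
    exact mul_le_mul (h2 u hu) (hHB _ (hφm u hu)) (abs_nonneg _)
      ((abs_nonneg _).trans (h2 u hu))
  have e3 : ∫ u in (0 : ℝ)..1, H (φ u) * φ' u = ∫ v in (φ 0)..(φ 1), H v := by
    refine intervalIntegral.integral_comp_mul_deriv''' hφc.continuousOn (fun u hu => ?_)
      hHc.continuousOn ?_ ?_
    · rw [min_eq_left zero_le_one, max_eq_right zero_le_one] at hu
      exact (hφ u hu).hasDerivWithinAt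
    · exact hHc.continuousOn.integrableOn_compact (isCompact_uIcc.image hφc)
    · exact hHφ'.continuousOn.integrableOn_compact isCompact_uIcc
  have e4 : |(∫ v in (φ 0)..(φ 1), H v) - ∫ v in (0 : ℝ)..1, H v| ≤ 4 * κ * B := by
    rw [intervalIntegral.integral_interval_sub_interval_comm
      (hHc.intervalIntegrable _ _) (hHc.intervalIntegrable _ _) (hHc.intervalIntegrable _ _)]
    have m0 := hφm 0 (by norm_num)
    have m1 := hφm 1 (by norm_num)
    have b1 : |∫ v in (φ 0)..0, H v| ≤ B * |0 - φ 0| :=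
      abs_integral_le_of_le fun v hv => hHB v (uIcc_subset_of_mem m0 (by norm_num) hv)
    have b2 : |∫ v in (φ 1)..1, H v| ≤ B * |1 - φ 1| :=
      abs_integral_le_of_le fun v hv => hHB v (uIcc_subset_of_mem m1 (by norm_num) hv)
    rw [abs_sub_comm] at b1 b2
    have c0 := mul_le_mul_of_nonneg_left (h1 0 (by norm_num)) hB0
    have c1 := mul_le_mul_of_nonneg_left (h1 1 (by norm_num)) hB0
    calc _ ≤ _ := abs_sub _ _
      _ ≤ 4 * κ * B := by linarith
  rw [e3] at e2
  rw [abs_le] at *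
  constructor <;> linarith [e1.1, e1.2, e2.1, e2.2, e4.1, e4.2]

/-- The lower triangular unipotent matrix. -/
def nL (w : ℝ) : SL2 := ⟨!![1, 0; w, 1], by simp [Matrix.det_fin_two_of]⟩

lemma dev_nL (w : ℝ) : dev (nL w) = |w| := by simp [dev, nm, nL]

lemma mul_na_eq (p : SL2) (u t : ℝ) (hD : 0 < p.1 1 0 * u + p.1 1 1) :
    p * na u t = na ((p.1 0 0 * u + p.1 0 1) / (p.1 1 0 * u + p.1 1 1))
      (t + 2 * Real.log (p.1 1 0 * u + p.1 1 1)) *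
        nL (Real.exp (-t) * (p.1 1 0 / (p.1 1 0 * u + p.1 1 1))) := by
  have hdet := SL2_det p
  set a := p.1 0 0
  set b := p.1 0 1
  set c := p.1 1 0
  set d := p.1 1 1
  set D := c * u + d with hDdef
  have e1 : Real.exp ((t + 2 * Real.log D) / 2) = Real.exp (t / 2) * D := by
    rw [add_div, Real.exp_add, mul_div_cancel_left₀ _ two_ne_zero, Real.exp_log hD]
  have e2 : Real.exp (-((t + 2 * Real.log D) / 2)) = Real.exp (-(t / 2)) / D := by
    rw [Real.exp_neg, e1, Real.exp_neg]; field_simp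
  have e3 : Real.exp (-t) = Real.exp (-(t / 2)) * Real.exp (-(t / 2)) := by
    rw [← Real.exp_add]; ring_nf
  have e4 : Real.exp (t / 2) * Real.exp (-(t / 2)) = 1 := by rw [← Real.exp_add]; simp
  apply SL2_ext'
  rw [SL2_mul_coe, SL2_mul_coe, na_coe, na_coe, e1, e2, e3]
  ext i j
  fin_cases i <;> fin_cases j <;> simp [nL, Matrix.mul_apply]
  · change a * Real.exp (-(t / 2)) = _
    field_simp
    linear_combination -(a * u + b) * c * e4 + hdet + a * hDdef
  · change a * (u * Real.exp (t / 2)) + b * Real.exp (t / 2) = _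
    field_simp
  · change c * Real.exp (-(t / 2)) = _
    field_simp
    linear_combination -c * e4
  · change c * (u * Real.exp (t / 2)) + d * Real.exp (t / 2) = _
    rw [hDdef]; ring

/-- The average of `G` over `[0,1] × [t₀, t₀ + 1]`. -/
def boxInt (t₀ : ℝ) (G : ℝ → ℝ → ℝ) : ℝ := ∫ u in (0 : ℝ)..1, ∫ t in t₀..(t₀ + 1), G u t

section boxInt
variable {t₀ : ℝ} {G G' : ℝ → ℝ → ℝ}

lemma continuous_section_integral (hG : Continuous fun q : ℝ × ℝ => G q.1 q.2) :
    Continuous fun u => ∫ t in t₀..(t₀ + 1), G u t :=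
  intervalIntegral.continuous_parametric_intervalIntegral_of_continuous' hG _ _

lemma continuous_section (hG : Continuous fun q : ℝ × ℝ => G q.1 q.2) (u : ℝ) :
    Continuous (G u) := hG.comp (continuous_const.prodMk continuous_id)

lemma boxInt_const (c : ℝ) : boxInt t₀ (fun _ _ => c) = c := by simp [boxInt]

lemma boxInt_sub (hG : Continuous fun q : ℝ × ℝ => G q.1 q.2)
    (hG' : Continuous fun q : ℝ × ℝ => G' q.1 q.2) :
    boxInt t₀ (fun u t => G u t - G' u t) = boxInt t₀ G - boxInt t₀ G' := by
  unfold boxInt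
  rw [← intervalIntegral.integral_sub ((continuous_section_integral hG).intervalIntegrable _ _)
    ((continuous_section_integral hG').intervalIntegrable _ _)]
  congr 1
  ext u
  exact intervalIntegral.integral_sub ((continuous_section hG u).intervalIntegrable _ _)
    ((continuous_section hG' u).intervalIntegrable _ _)

lemma boxInt_add (hG : Continuous fun q : ℝ × ℝ => G q.1 q.2)
    (hG' : Continuous fun q : ℝ × ℝ => G' q.1 q.2) :
    boxInt t₀ (fun u t => G u t + G' u t) = boxInt t₀ G + boxInt t₀ G' := by
  unfold boxInt
  rw [← intervalIntegral.integral_add ((continuous_section_integral hG).intervalIntegrable _ _)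
    ((continuous_section_integral hG').intervalIntegrable _ _)]
  congr 1
  ext u
  exact intervalIntegral.integral_add ((continuous_section hG u).intervalIntegrable _ _)
    ((continuous_section hG' u).intervalIntegrable _ _)

lemma boxInt_const_mul (c : ℝ) : boxInt t₀ (fun u t => c * G u t) = c * boxInt t₀ G := by
  simp [boxInt]

lemma boxInt_mono (hG : Continuous fun q : ℝ × ℝ => G q.1 q.2)
    (hG' : Continuous fun q : ℝ × ℝ => G' q.1 q.2)
    (h : ∀ u ∈ Set.Icc (0 : ℝ) 1, ∀ t ∈ Set.Icc t₀ (t₀ + 1), G u t ≤ G' u t) :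
    boxInt t₀ G ≤ boxInt t₀ G' := by
  refine intervalIntegral.integral_mono_on zero_le_one
    ((continuous_section_integral hG).intervalIntegrable _ _)
    ((continuous_section_integral hG').intervalIntegrable _ _) fun u hu => ?_
  exact intervalIntegral.integral_mono_on (by linarith)
    ((continuous_section hG u).intervalIntegrable _ _)
    ((continuous_section hG' u).intervalIntegrable _ _) fun t ht => h u hu t ht

lemma boxInt_le (hG : Continuous fun q : ℝ × ℝ => G q.1 q.2) {B : ℝ}
    (h : ∀ u ∈ Set.Icc (0 : ℝ) 1, ∀ t ∈ Set.Icc t₀ (t₀ + 1), G u t ≤ B) :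
    boxInt t₀ G ≤ B :=
  (boxInt_mono hG continuous_const h).trans_eq (boxInt_const B)

lemma le_boxInt (hG : Continuous fun q : ℝ × ℝ => G q.1 q.2) {B : ℝ}
    (h : ∀ u ∈ Set.Icc (0 : ℝ) 1, ∀ t ∈ Set.Icc t₀ (t₀ + 1), B ≤ G u t) :
    B ≤ boxInt t₀ G :=
  (boxInt_const B).symm.trans_le (boxInt_mono continuous_const hG h)

lemma abs_boxInt_sub_le (hG : Continuous fun q : ℝ × ℝ => G q.1 q.2)
    (hG' : Continuous fun q : ℝ × ℝ => G' q.1 q.2) {B : ℝ}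
    (h : ∀ u ∈ Set.Icc (0 : ℝ) 1, ∀ t ∈ Set.Icc t₀ (t₀ + 1), |G u t - G' u t| ≤ B) :
    |boxInt t₀ G - boxInt t₀ G'| ≤ B := by
  rw [← boxInt_sub hG hG', abs_le]
  exact ⟨le_boxInt (hG.sub hG') fun u hu t ht => (abs_le.mp (h u hu t ht)).1,
    boxInt_le (hG.sub hG') fun u hu t ht => (abs_le.mp (h u hu t ht)).2⟩

lemma boxInt_swap (hG : Continuous fun q : ℝ × ℝ => G q.1 q.2) :
    boxInt t₀ G = ∫ t in t₀..(t₀ + 1), ∫ u in (0 : ℝ)..1, G u t := by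
  unfold boxInt
  refine intervalIntegral_intervalIntegral_swap ?_
  have hG' : Continuous (Function.uncurry G) := hG
  refine (hG'.continuousOn.integrableOn_compact
    ((isCompact_uIcc (a := 0) (b := 1)).prod (isCompact_uIcc (a := t₀) (b := t₀ + 1)))).mono_set ?_
  exact Set.prod_mono Set.uIoc_subset_uIcc Set.uIoc_subset_uIcc

end boxInt

/-- The average of `f` over a box in the group of upper triangular matrices. -/
def avgA (t₀ : ℝ) (f : SL2 → ℝ) (g : SL2) : ℝ := boxInt t₀ fun u t => f (g * na u t)

lemma continuous_mul_na {f : SL2 → ℝ} (hf : Continuous f) (g : SL2) :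
    Continuous fun q : ℝ × ℝ => f (g * na q.1 q.2) :=
  hf.comp (continuous_const.mul continuous_na)

/-- `f` is Lipschitz under right translations, with weight `W`. -/
def LipW (W f : SL2 → ℝ) (L : ℝ) : Prop := ∀ g p, |f (g * p) - f g| ≤ L * dev p * W g

lemma LipW.continuous {W f : SL2 → ℝ} {L : ℝ} (h : LipW W f L) : Continuous f := by
  rw [continuous_iff_continuousAt]
  intro g
  refine tendsto_iff_dist_tendsto_zero.mpr ?_
  have h1 : Tendsto (fun g' : SL2 => L * dev (g⁻¹ * g') * W g) (𝓝 g) (𝓝 0) := by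
    have h2 : Continuous fun g' : SL2 => L * dev (g⁻¹ * g') * W g :=
      (continuous_const.mul (continuous_dev.comp (continuous_const.mul continuous_id))).mul
        continuous_const
    have h3 := h2.tendsto g
    simpa [dev_one] using h3
  refine squeeze_zero (fun _ => dist_nonneg) (fun g' => ?_) h1
  have := h g (g⁻¹ * g')
  rwa [mul_inv_cancel_left] at this

lemma nm_na_le' {v t : ℝ} (hv : v ∈ Set.Icc (-1 : ℝ) 2) (ht : 0 ≤ t) :
    nm (na v t).1 ≤ 4 * Real.exp (t / 2) := by
  have h1 : Real.exp (-(t / 2)) ≤ Real.exp (t / 2) := Real.exp_le_exp.mpr (by linarith)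
  have h2 : |v| ≤ 2 := abs_le.mpr ⟨by linarith [hv.1], hv.2⟩
  have h3 := mul_le_mul_of_nonneg_right h2 (Real.exp_pos (t / 2)).le
  rw [na_coe]
  simp [nm, abs_mul]
  linarith

lemma abs_log_le_two_mul {x κ : ℝ} (h : |x - 1| ≤ κ) (hκ : κ ≤ 1 / 2) : |Real.log x| ≤ 2 * κ := by
  have h1 := abs_le.mp h
  have hx : 0 < x := by linarith
  rw [abs_le]
  constructor
  · have h2 := Real.one_sub_inv_le_log_of_pos hx
    have h3 : x⁻¹ ≤ 1 + 2 * κ := by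
      rw [inv_le_iff_one_le_mul₀ hx]; nlinarith
    linarith
  · linarith [Real.log_le_sub_one_of_pos hx]

lemma exists_distortion (p : SL2) (hp : dev p ≤ 1 / 8) :
    ∃ φ φ' τ : ℝ → ℝ, Continuous φ ∧ Continuous φ' ∧ Continuous τ ∧
      (∀ u ∈ Set.Ioo (0 : ℝ) 1, HasDerivAt φ (φ' u) u) ∧
      (∀ u ∈ Set.Icc (0 : ℝ) 1, |φ u - u| ≤ 2 * dev p) ∧
      (∀ u ∈ Set.Icc (0 : ℝ) 1, |φ' u - 1| ≤ 4 * dev p) ∧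
      (∀ u ∈ Set.Icc (0 : ℝ) 1, |τ u| ≤ 4 * dev p) ∧
      ∀ u ∈ Set.Icc (0 : ℝ) 1, ∀ t, ∃ w, |w| ≤ Real.exp (-t) * (2 * dev p) ∧
        p * na u t = na (φ u) (t + τ u) * nL w := by
  set κ := dev p with hκ
  have hκ0 : 0 ≤ κ := dev_nonneg p
  have hdet := SL2_det p
  have hpκ : |p.1 0 0 - 1| + |p.1 0 1| + |p.1 1 0| + |p.1 1 1 - 1| = κ := by
    simp [hκ, dev, nm]
  set a := p.1 0 0
  set b := p.1 0 1
  set c := p.1 1 0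
  set d := p.1 1 1
  set D : ℝ → ℝ := fun u => max (c * u + d) (1 / 2) with hD'
  have hDc : Continuous D := by fun_prop
  have hDpos : ∀ u, 0 < D u := fun u => lt_of_lt_of_le (by norm_num) (le_max_right _ _)
  have hD1 : ∀ u ∈ Set.Icc (0 : ℝ) 1, |c * u + d - 1| ≤ κ := fun u hu => by
    have h1 : |c * u| ≤ |c| := by
      rw [abs_mul, abs_of_nonneg hu.1]
      exact mul_le_of_le_one_right (abs_nonneg _) hu.2
    calc |c * u + d - 1| = |c * u + (d - 1)| := by ring_nf
      _ ≤ |c * u| + |d - 1| := abs_add_le _ _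
      _ ≤ κ := by linarith [abs_nonneg (a - 1), abs_nonneg b]
  have hDe : ∀ u ∈ Set.Icc (0 : ℝ) 1, D u = c * u + d := fun u hu => by
    have := abs_le.mp (hD1 u hu)
    exact max_eq_left (by linarith)
  have hDb : ∀ u ∈ Set.Icc (0 : ℝ) 1, |D u - 1| ≤ κ := fun u hu => by
    rw [hDe u hu]; exact hD1 u hu
  set φ : ℝ → ℝ := fun u => (a * u + b) / D u with hφdef
  set τ : ℝ → ℝ := fun u => 2 * Real.log (D u) with hτdef
  have hφc : Continuous φ := Continuous.div (by fun_prop) hDc fun u => (hDpos u).ne'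
  have hτc : Continuous τ := continuous_const.mul (hDc.log fun u => (hDpos u).ne')
  have hφ1 : ∀ u ∈ Set.Icc (0 : ℝ) 1, |φ u - u| ≤ 2 * κ := fun u hu => by
    have h0 := abs_le.mp (hDb u hu)
    have e : φ u - u = (a * u + b - u * D u) / D u := by
      rw [hφdef]; field_simp [(hDpos u).ne']
    rw [e, abs_div, abs_of_pos (hDpos u), div_le_iff₀ (hDpos u)]
    have h1 : |a * u + b - u * D u| ≤ κ := by
      rw [hDe u hu]
      have e2 : a * u + b - u * (c * u + d) =
          u * (a - 1) + b - u ^ 2 * c - u * (d - 1) := by ring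
      have b1 : |u * (a - 1)| ≤ |a - 1| := by
        rw [abs_mul, abs_of_nonneg hu.1]; exact mul_le_of_le_one_left (abs_nonneg _) hu.2
      have b2 : |u * (d - 1)| ≤ |d - 1| := by
        rw [abs_mul, abs_of_nonneg hu.1]; exact mul_le_of_le_one_left (abs_nonneg _) hu.2
      have b3 : |u ^ 2 * c| ≤ |c| := by
        rw [abs_mul, abs_of_nonneg (sq_nonneg u)]
        exact mul_le_of_le_one_left (abs_nonneg _) (pow_le_one₀ hu.1 hu.2)
      rw [e2]
      calc _ ≤ |u * (a - 1) + b - u ^ 2 * c| + |u * (d - 1)| := abs_sub _ _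
        _ ≤ |u * (a - 1) + b| + |u ^ 2 * c| + |u * (d - 1)| := by gcongr; exact abs_sub _ _
        _ ≤ |u * (a - 1)| + |b| + |u ^ 2 * c| + |u * (d - 1)| := by
          gcongr; exact abs_add_le _ _
        _ ≤ κ := by linarith
    nlinarith
  have hφ'1 : ∀ u ∈ Set.Icc (0 : ℝ) 1, |1 / D u ^ 2 - 1| ≤ 4 * κ := fun u hu => by
    have h0 := abs_le.mp (hDb u hu)
    have hp2 : 0 < D u ^ 2 := pow_pos (hDpos u) 2
    have e : 1 / D u ^ 2 - 1 = -((D u - 1) * (D u + 1)) / D u ^ 2 := by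
      field_simp [(hDpos u).ne']; ring
    rw [e, abs_div, abs_neg, abs_mul, abs_of_pos hp2, div_le_iff₀ hp2,
      abs_of_pos (show 0 < D u + 1 by linarith [hDpos u])]
    calc |D u - 1| * (D u + 1) ≤ κ * (D u + 1) := 
          mul_le_mul_of_nonneg_right (hDb u hu) (by linarith [hDpos u])
      _ ≤ 4 * κ * D u ^ 2 := by nlinarith [mul_nonneg hκ0 (sq_nonneg (D u - 7 / 8))]
  have hτ1 : ∀ u ∈ Set.Icc (0 : ℝ) 1, |τ u| ≤ 4 * κ := fun u hu => by
    have := abs_log_le_two_mul (hDb u hu) (by linarith)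
    rw [hτdef, abs_mul, abs_two]; linarith
  have hφd : ∀ u ∈ Set.Ioo (0 : ℝ) 1, HasDerivAt φ (1 / D u ^ 2) u := fun u hu => by
    have hu' := Set.Ioo_subset_Icc_self hu
    have h0 : c * u + d ≠ 0 := by rw [← hDe u hu']; exact (hDpos u).ne'
    have h1 : HasDerivAt (fun u => (a * u + b) / (c * u + d))
        ((a * (c * u + d) - (a * u + b) * c) / (c * u + d) ^ 2) u := by
      refine HasDerivAt.div ?_ ?_ h0
      · simpa using ((hasDerivAt_id u).const_mul a).add_const b
      · simpa using ((hasDerivAt_id u).const_mul c).add_const d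
    rw [show a * (c * u + d) - (a * u + b) * c = 1 by linear_combination hdet,
      ← hDe u hu'] at h1
    refine h1.congr_of_eventuallyEq ?_
    filter_upwards [Ioo_mem_nhds hu.1 hu.2] with v hv
    simp only [hφdef, hDe v (Set.Ioo_subset_Icc_self hv)]
  refine ⟨φ, fun u => 1 / D u ^ 2, τ, hφc,
    continuous_const.div (hDc.pow 2) fun u => (pow_pos (hDpos u) 2).ne', hτc, hφd, hφ1, hφ'1, hτ1,
    fun u hu t => ⟨Real.exp (-t) * (c / D u), ?_, ?_⟩⟩
  · rw [abs_mul, abs_of_pos (Real.exp_pos _), abs_div, abs_of_pos (hDpos u)]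
    refine mul_le_mul_of_nonneg_left ?_ (Real.exp_pos _).le
    have h0 := abs_le.mp (hDb u hu)
    rw [div_le_iff₀ (hDpos u)]
    nlinarith [abs_nonneg (a - 1), abs_nonneg b, abs_nonneg (d - 1)]
  · have e := mul_na_eq p u t (by rw [← hDe u hu]; exact hDpos u)
    rw [← hDe u hu] at e
    exact e

/-- The averaging operator contracts the weighted Lipschitz seminorm, up to oscillation. -/
theorem abs_avgA_mul_sub_le {W f : SL2 → ℝ} (hW0 : ∀ g, 0 ≤ W g)
    (hWm : ∀ g p, W (g * p) ≤ nm p.1 * W g) {Q M t₀ : ℝ} (hQ : 0 ≤ Q) (hM : 0 ≤ M)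
    (hL : LipW W f Q)
    (hD : ∀ g g', f g - f g' ≤ M * (W g + W g')) (ht₀ : 2 ≤ t₀) (he : 64 ≤ Real.exp (t₀ / 2))
    (g p : SL2) (hp : dev p ≤ 1 / 8) :
    |avgA t₀ f (g * p) - avgA t₀ f g| ≤
      (1 / 4 * Q + 16 * (4 * Real.exp ((t₀ + 2) / 2) + 1) * M) * dev p * W g := by
  have hfc := hL.continuous
  set κ := dev p with hκ
  have hκ0 : 0 ≤ κ := dev_nonneg p
  obtain ⟨φ, φ', τ, hφc, hφ'c, hτc, hφd, hφ1, hφ'1, hτ1, hw⟩ := exists_distortion p hp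
  have hφm : ∀ u ∈ Set.Icc (0 : ℝ) 1, φ u ∈ Set.Icc (-1 : ℝ) 2 := fun u hu => by
    have := abs_le.mp (hφ1 u hu)
    constructor <;> linarith [hu.1, hu.2]
  have hGc := continuous_mul_na hfc g
  have hG'c : Continuous fun q : ℝ × ℝ => f (g * na (φ q.1) (q.2 + τ q.1)) :=
    hfc.comp (continuous_const.mul ((continuous_nU.comp (hφc.comp continuous_fst)).mul
      (continuous_amat.comp (continuous_snd.add (hτc.comp continuous_fst)).neg)))
  have s1 : |avgA t₀ f (g * p) - boxInt t₀ fun u t => f (g * na (φ u) (t + τ u))| ≤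
      1 / 4 * Q * κ * W g := by
    refine abs_boxInt_sub_le (continuous_mul_na hfc _) hG'c fun u hu t ht => ?_
    have h1 := abs_le.mp (hτ1 u hu)
    obtain ⟨w, hw1, hw2⟩ := hw u hu t
    rw [mul_assoc g p, hw2, ← mul_assoc]
    refine (hL _ _).trans ?_
    rw [dev_nL]
    have hW1 : W (g * na (φ u) (t + τ u)) ≤ 8 * Real.exp (t / 2) * W g := by
      refine (hWm _ _).trans (mul_le_mul_of_nonneg_right ?_ (hW0 g))
      refine (nm_na_le' (hφm u hu) (by linarith [ht.1])).trans ?_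
      have h3 := Real.add_one_le_exp (-(τ u / 2))
      have h4 : Real.exp (τ u / 2) * Real.exp (-(τ u / 2)) = 1 := by rw [← Real.exp_add]; simp
      have h5 : Real.exp (τ u / 2) ≤ 2 := by nlinarith [Real.exp_pos (τ u / 2)]
      rw [add_div, Real.exp_add]
      nlinarith [Real.exp_pos (t / 2)]
    have e2 : Real.exp (-t) * Real.exp (t / 2) ≤ 1 / 64 := by
      rw [← Real.exp_add, show -t + t / 2 = -(t / 2) by ring, Real.exp_neg,
        inv_eq_one_div, div_le_div_iff₀ (Real.exp_pos _) (by norm_num)]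
      have := Real.exp_le_exp.mpr (show t₀ / 2 ≤ t / 2 by linarith [ht.1])
      linarith
    calc Q * |w| * W (g * na (φ u) (t + τ u))
        ≤ Q * (Real.exp (-t) * (2 * κ)) * (8 * Real.exp (t / 2) * W g) := by
          gcongr
          exact hW0 _
      _ = 16 * Q * κ * W g * (Real.exp (-t) * Real.exp (t / 2)) := by ring
      _ ≤ 16 * Q * κ * W g * (1 / 64) := by
          gcongr
          have := hW0 g
          positivity
      _ = 1 / 4 * Q * κ * W g := by ring
  have s2 : |(boxInt t₀ fun u t => f (g * na (φ u) (t + τ u))) - avgA t₀ f g| ≤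
      16 * κ * ((4 * Real.exp ((t₀ + 2) / 2) + 1) * M * W g) := by
    have hB : ∀ v ∈ Set.Icc (-1 : ℝ) 2, ∀ t ∈ Set.Icc (t₀ - 1) (t₀ + 2),
        |f (g * na v t) - f g| ≤ (4 * Real.exp ((t₀ + 2) / 2) + 1) * M * W g := fun v hv t ht => by
      have h1 := hD (g * na v t) g
      have h2 := hD g (g * na v t)
      have h3 : W (g * na v t) ≤ 4 * Real.exp ((t₀ + 2) / 2) * W g := by
        refine (hWm _ _).trans (mul_le_mul_of_nonneg_right ?_ (hW0 g))
        refine (nm_na_le' hv (by linarith [ht.1])).trans ?_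
        have := Real.exp_le_exp.mpr (show t / 2 ≤ (t₀ + 2) / 2 by linarith [ht.2])
        linarith
      have h4 := mul_le_mul_of_nonneg_left h3 hM
      rw [abs_le]
      constructor <;> linarith
    have hFc : Continuous fun q : ℝ × ℝ => f (g * na q.1 q.2) - f g := hGc.sub continuous_const
    have h : |(boxInt t₀ fun u t => f (g * na (φ u) (t + τ u)) - f g) -
        boxInt t₀ fun u t => f (g * na u t) - f g| ≤ _ :=
      abs_integral_change_le (F := fun v t => f (g * na v t) - f g)
        hFc (by linarith) hB hφc hτc hφ'c hφd hφ1 hφ'1 hτ1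
    rw [boxInt_sub hG'c continuous_const, boxInt_sub hGc continuous_const,
      sub_sub_sub_cancel_right] at h
    exact h
  have := abs_sub_le (avgA t₀ f (g * p)) (boxInt t₀ fun u t => f (g * na (φ u) (t + τ u)))
    (avgA t₀ f g)
  calc _ ≤ _ := this
    _ ≤ 1 / 4 * Q * κ * W g + 16 * κ * ((4 * Real.exp ((t₀ + 2) / 2) + 1) * M * W g) :=
      add_le_add s1 s2
    _ = _ := by ring

lemma nU_add (x y : ℝ) : nU (x + y) = nU x * nU y := by
  apply SL2_ext'
  rw [SL2_mul_coe]
  ext i j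
  fin_cases i <;> fin_cases j <;> simp [nU, add_comm]

lemma nU_zero : nU 0 = 1 := by
  apply SL2_ext'
  ext i j
  fin_cases i <;> fin_cases j <;> simp [nU]

lemma nU_neg (x : ℝ) : nU (-x) = (nU x)⁻¹ :=
  eq_inv_of_mul_eq_one_left (by rw [← nU_add, neg_add_cancel, nU_zero])

lemma nU_injective {x y : ℝ} (h : nU x = nU y) : x = y := by
  have := congrArg (fun g : SL2 => g.1 0 1) h
  simpa [nU] using this

lemma tl_nU (c : ℝ) : tl (nU c).1 = c • !![0, 1; 0, 0] := by
  rw [tl_explicit]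
  ext i j
  fin_cases i <;> fin_cases j <;> simp [nU]

lemma conj_nU_of_upper {P : SL2} (h : P.1 1 0 = 0) (x : ℝ) :
    P * nU x * P⁻¹ = nU (P.1 0 0 ^ 2 * x) := by
  have hd := SL2_det P
  rw [mul_inv_eq_iff_eq_mul]
  apply SL2_ext'
  rw [SL2_mul_coe, SL2_mul_coe]
  ext i j
  fin_cases i <;> fin_cases j <;> simp [nU, Matrix.mul_apply, h]
  rw [h] at hd
  linear_combination -(P.1 0 0 * x) * hd

/-- An element of the group of upper triangular matrices normalizing a cusp is unipotent up to sign. -/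
lemma sq_eq_one_of_upper {Γ : Subgroup SL2} (hΓ : IsDisc Γ) {g γ₀ γ : SL2} {c : ℝ} (hc : c ≠ 0)
    (hγ₀ : γ₀ ∈ Γ) (h₀ : γ₀ * g = g * nU c) (hγ : γ ∈ Γ) (h : (g⁻¹ * γ * g).1 1 0 = 0) :
    1 ≤ (g⁻¹ * γ * g).1 0 0 ^ 2 := by
  by_contra! hlt
  set P := g⁻¹ * γ * g with hP
  have e0 : γ₀ = g * nU c * g⁻¹ := by rw [← h₀]; group
  have e1 : γ * γ₀ * γ⁻¹ = g * nU (P.1 0 0 ^ 2 * c) * g⁻¹ := by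
    rw [← conj_nU_of_upper h, e0, hP]; group
  have t0 : ∀ x, tl (g * nU x * g⁻¹).1 = x • (g.1 * !![0, 1; 0, 0] * (g⁻¹).1) := fun x => by
    have := tl_conj' g⁻¹ (nU x)
    rw [inv_inv] at this
    rw [this, tl_nU, Matrix.mul_smul, Matrix.smul_mul]
  have h2 := commute_of_conj_contracts hΓ hγ₀ hγ (c := P.1 0 0 ^ 2) ?_ ?_ ?_
  · rw [e1, e0] at h2
    have h3 := nU_injective (mul_left_cancel (mul_right_cancel h2))
    have : P.1 0 0 ^ 2 = 1 := mul_right_cancel₀ hc (by linarith)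
    linarith
  · rw [e0, t0, Matrix.det_smul, Matrix.det_mul, Matrix.det_mul]
    simp [Matrix.det_fin_two_of]
  · rwa [abs_of_nonneg (sq_nonneg _)]
  · rw [e1, e0, t0, t0, smul_smul]

/-- A lattice is not contained in the stabilizer of one of its cusps. -/
lemma exists_lower_ne_zero {Γ : Subgroup SL2} (hlat : IsLatticeSL2 Γ) (hΓ : IsDisc Γ)
    {g γ₀ : SL2} {c : ℝ} (hc : c ≠ 0) (hγ₀ : γ₀ ∈ Γ) (h₀ : γ₀ * g = g * nU c) :
    ∃ γ ∈ Γ, (g⁻¹ * γ * g).1 1 0 ≠ 0 := by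
  by_contra! hall
  have key : ∀ γ ∈ Γ, (g⁻¹ * γ * g).1 0 0 ^ 2 = 1 ∧
      (g⁻¹ * γ * g).1 0 0 = (g⁻¹ * γ * g).1 1 1 := fun γ hγ => by
    have h1 := sq_eq_one_of_upper hΓ hc hγ₀ h₀ hγ (hall γ hγ)
    have h2 := sq_eq_one_of_upper hΓ hc hγ₀ h₀ (Γ.inv_mem hγ) (hall _ (Γ.inv_mem hγ))
    have e : g⁻¹ * γ⁻¹ * g = (g⁻¹ * γ * g)⁻¹ := by group
    rw [e, SL2_inv_coe] at h2
    have hd := SL2_det (g⁻¹ * γ * g)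
    rw [hall γ hγ] at hd
    generalize (g⁻¹ * γ * g).1 0 0 = a at *
    generalize (g⁻¹ * γ * g).1 1 1 = d at *
    simp at h2
    have h3 : (a ^ 2) * (d ^ 2) = 1 := by rw [← mul_pow, show a * d = 1 by linarith, one_pow]
    have h2' : 1 ≤ d ^ 2 := by simpa using h2
    have h4 : a ^ 2 = 1 := by nlinarith
    exact ⟨h4, by linear_combination d * h4 - a * hd⟩
  have hsys : ∀ s, 0 ≤ s → sys Γ g ≤ sys Γ (g * amat (-s)) := fun s hs => by
    refine le_sys (sys_le_one _ _) fun γ hγ h0 => (sys_le_sz hγ h0 g).trans ?_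
    have e : tl (g⁻¹ * γ * g).1 = !![0, (g⁻¹ * γ * g).1 0 1; 0, -0] := by
      rw [tl_explicit, (key γ hγ).2, hall γ hγ]; simp
    rw [sz_mul, e, nm_conj_amat]
    rw [sz, e]
    have h1 : 1 ≤ Real.exp (- -s) := Real.one_le_exp (by linarith)
    generalize (g⁻¹ * γ * g).1 0 1 = y
    have h2 := abs_nonneg y
    simp only [nm]
    simp
    rw [neg_neg] at h1
    nlinarith
  obtain ⟨C, hC⟩ := exists_reduction hlat (sys_pos hΓ g)
  set X := nm g.1 * |C| with hX
  have hX0 : 0 ≤ X := mul_nonneg (nm_nonneg _) (abs_nonneg _)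
  obtain ⟨γ, hγ, hn⟩ := hC _ (hsys (2 * X) (by positivity))
  have h1 : nm (g⁻¹ * γ * g * amat (-(2 * X))).1 ≤ X := by
    rw [show g⁻¹ * γ * g * amat (-(2 * X)) = g⁻¹ * (γ * (g * amat (-(2 * X)))) by group,
      SL2_mul_coe]
    refine (nm_mul_le _ _).trans ?_
    rw [nm_inv]
    exact mul_le_mul_of_nonneg_left (hn.trans (le_abs_self C)) (nm_nonneg _)
  have h2 := (abs_entry_le_nm _ 1 1).trans h1
  rw [SL2_mul_coe, Matrix.mul_apply, Fin.sum_univ_two, ← (key γ hγ).2] at h2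
  have h3 : |(g⁻¹ * γ * g).1 0 0| = 1 := by
    have := (key γ hγ).1
    rw [← sq_abs] at this
    exact (pow_eq_one_iff_of_nonneg (abs_nonneg _) two_ne_zero).mp this
  have h4 : ((amat (-(2 * X))).1 0 1) = 0 := by simp [amat]
  have h5 : ((amat (-(2 * X))).1 1 1) = Real.exp X := by
    simp [amat]; ring
  rw [h4, h5, mul_zero, zero_add, abs_mul, h3, one_mul, abs_of_pos (Real.exp_pos _)] at h2
  linarith [Real.add_one_le_exp X]

lemma nU_zpow (c : ℝ) (k : ℤ) : nU c ^ k = nU (k * c) := by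
  induction k using Int.induction_on with
  | zero => simp [nU_zero]
  | succ n ih => rw [_root_.zpow_add_one, ih, ← nU_add]; congr 1; push_cast; ring
  | pred n ih => rw [_root_.zpow_sub_one, ih, ← nU_neg, ← nU_add]; congr 1; push_cast; ring

lemma zpow_mul_of_conj {g γ₀ : SL2} {c : ℝ} (h₀ : γ₀ * g = g * nU c) (k : ℤ) :
    γ₀ ^ k * g = g * nU (k * c) := by
  have e0 : γ₀ = g * nU c * g⁻¹ := by rw [← h₀]; group
  rw [e0, conj_zpow, nU_zpow, inv_mul_cancel_right]

lemma exists_int_lt_add_mul (B x : ℝ) {z : ℝ} (hz : z ≠ 0) : ∃ k : ℤ, B < x + k * z := by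
  rcases lt_or_gt_of_ne hz with h | h
  · obtain ⟨k, hk⟩ := exists_int_lt ((B - x) / z)
    exact ⟨k, by rw [lt_div_iff_of_neg h] at hk; linarith⟩
  · obtain ⟨k, hk⟩ := exists_int_gt ((B - x) / z)
    exact ⟨k, by rw [div_lt_iff₀ h] at hk; linarith⟩

lemma mul_na_eq_nL (P : SL2) (h : 0 < P.1 0 0) :
    P * na (-P.1 0 1 / P.1 0 0) (2 * Real.log (P.1 0 0)) = nL (P.1 1 0 / P.1 0 0) := by
  have hd := SL2_det P
  apply SL2_ext'
  rw [SL2_mul_coe, na_coe]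
  have e1 : Real.exp (2 * Real.log (P.1 0 0) / 2) = P.1 0 0 := by
    rw [mul_div_cancel_left₀ _ two_ne_zero, Real.exp_log h]
  rw [Real.exp_neg, e1]
  have h' := h.ne'
  ext i j
  fin_cases i <;> fin_cases j <;> simp [nL, Matrix.mul_apply]
  · field_simp
  · field_simp; ring
  · field_simp
  · field_simp; linear_combination hd

/-- From every point one can approach a given cuspidal point through upper triangular
translations. -/
lemma exists_dev_mul_na_lt {Γ : Subgroup SL2} (hlat : IsLatticeSL2 Γ) (hΓ : IsDisc Γ)
    {g₁ γ₀ : SL2} {c : ℝ} (hc : c ≠ 0) (hγ₀ : γ₀ ∈ Γ) (h₀ : γ₀ * g₁ = g₁ * nU c)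
    {η : ℝ} (hη : 0 < η) (g : SL2) :
    ∃ q : ℝ × ℝ, ∃ γ ∈ Γ, dev (g₁⁻¹ * γ * g * na q.1 q.2) < η := by
  obtain ⟨γ', hγ', hne⟩ : ∃ γ' ∈ Γ, (g₁⁻¹ * γ' * g).1 1 0 ≠ 0 := by
    by_cases h : (g₁⁻¹ * g).1 1 0 = 0
    · obtain ⟨γ₁, hγ₁, h1⟩ := exists_lower_ne_zero hlat hΓ hc hγ₀ h₀
      refine ⟨γ₁, hγ₁, ?_⟩
      have hd := SL2_det (g₁⁻¹ * g)
      rw [show g₁⁻¹ * γ₁ * g = (g₁⁻¹ * γ₁ * g₁) * (g₁⁻¹ * g) by group, SL2_mul_coe,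
        Matrix.mul_apply, Fin.sum_univ_two, h, mul_zero, add_zero]
      rw [h, mul_zero, sub_zero] at hd
      refine mul_ne_zero h1 fun h2 => ?_
      rw [h2, zero_mul] at hd
      exact zero_ne_one hd
    · exact ⟨1, Γ.one_mem, by simpa using h⟩
  set P := g₁⁻¹ * γ' * g with hP
  obtain ⟨k, hk⟩ := exists_int_lt_add_mul (|P.1 1 0| / η) (P.1 0 0) (mul_ne_zero hc hne)
  have e : g₁⁻¹ * (γ₀ ^ k * γ') * g = nU (k * c) * P := by
    rw [hP]
    have h1 : g₁⁻¹ * γ₀ ^ k * g₁ = nU (k * c) := by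
      rw [mul_assoc, zpow_mul_of_conj h₀, inv_mul_cancel_left]
    rw [← h1]; group
  set Q := nU (k * c) * P with hQ
  have e00 : Q.1 0 0 = P.1 0 0 + k * (c * P.1 1 0) := by
    rw [hQ, SL2_mul_coe, Matrix.mul_apply, Fin.sum_univ_two]; simp [nU]; ring
  have e10 : Q.1 1 0 = P.1 1 0 := by
    rw [hQ, SL2_mul_coe, Matrix.mul_apply, Fin.sum_univ_two]; simp [nU]
  rw [← e00] at hk
  have hpos : 0 < Q.1 0 0 := lt_of_le_of_lt (div_nonneg (abs_nonneg _) hη.le) hk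
  refine ⟨(-Q.1 0 1 / Q.1 0 0, 2 * Real.log (Q.1 0 0)), γ₀ ^ k * γ',
    Γ.mul_mem (Γ.zpow_mem hγ₀ k) hγ', ?_⟩
  rw [e, mul_na_eq_nL _ hpos, dev_nL, e10, abs_div, abs_of_pos hpos, div_lt_iff₀ hpos]
  rw [div_lt_iff₀ hη] at hk
  linarith

/-- A uniform version of `exists_dev_mul_na_lt` over sets of bounded height. -/
lemma exists_finset_dev_le {Γ : Subgroup SL2} (hlat : IsLatticeSL2 Γ) (hΓ : IsDisc Γ)
    {g₁ γ₀ : SL2} {c : ℝ} (hc : c ≠ 0) (hγ₀ : γ₀ ∈ Γ) (h₀ : γ₀ * g₁ = g₁ * nU c)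
    {η : ℝ} (hη : 0 < η) (R : ℝ) :
    ∃ S : Finset (ℝ × ℝ), S.Nonempty ∧ ∀ g, ht Γ g ≤ R →
      ∃ q ∈ S, ∃ γ ∈ Γ, dev (g₁⁻¹ * γ * g * na q.1 q.2) ≤ η := by
  obtain ⟨C, hC⟩ := exists_reduction hlat (show 0 < (max R 1) ^ (-4 : ℝ) by positivity)
  obtain ⟨F, hF⟩ := (isCompact_nm_le C).elim_finite_subcover
    (fun i : (ℝ × ℝ) × Γ => {h : SL2 | dev (g₁⁻¹ * i.2 * h * na i.1.1 i.1.2) < η})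
    (fun i => isOpen_lt (continuous_dev.comp ((continuous_const.mul continuous_id).mul
      continuous_const)) continuous_const)
    (fun g _ => by
      obtain ⟨q, γ, hγ, h⟩ := exists_dev_mul_na_lt hlat hΓ hc hγ₀ h₀ hη g
      exact Set.mem_iUnion.mpr ⟨(q, ⟨γ, hγ⟩), h⟩)
  classical
  refine ⟨insert (0, 0) (F.image Prod.fst), Finset.insert_nonempty _ _, fun g hg => ?_⟩
  have hsys : (max R 1) ^ (-4 : ℝ) ≤ sys Γ g := by
    have h1 : sys Γ g ^ (-(1 / 4) : ℝ) ≤ max R 1 := hg.trans (le_max_left _ _)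
    have hp := sys_pos hΓ g
    have h2 := Real.rpow_le_rpow_of_nonpos (Real.rpow_pos_of_pos hp _) h1
      (show (-4 : ℝ) ≤ 0 by norm_num)
    rw [← Real.rpow_mul hp.le] at h2
    norm_num at h2
    simpa [Real.rpow_neg] using h2
  obtain ⟨γ, hγ, hn⟩ := hC g hsys
  obtain ⟨i, hi, hd⟩ := Set.mem_iUnion₂.mp (hF hn)
  refine ⟨i.1, Finset.mem_insert_of_mem (Finset.mem_image_of_mem _ hi), i.2 * γ,
    Γ.mul_mem i.2.2 hγ, ?_⟩
  have : dev (g₁⁻¹ * i.2 * (γ * g) * na i.1.1 i.1.2) < η := hd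
  rw [show g₁⁻¹ * (↑i.2 * γ) * g = g₁⁻¹ * ↑i.2 * (γ * g) by group]
  exact this.le

/-- The average of `f` over finitely many upper triangular translations. -/
def avgJ (S : Finset (ℝ × ℝ)) (f : SL2 → ℝ) (g : SL2) : ℝ :=
  (∑ q ∈ S, f (g * na q.1 q.2)) / S.card

/-- The averaging operator: a convex combination of `avgA` and `avgJ`. -/
def avg (ε t₀ : ℝ) (S : Finset (ℝ × ℝ)) (f : SL2 → ℝ) (g : SL2) : ℝ :=
  (1 - ε) * avgA t₀ f g + ε * avgJ S f g

lemma avgJ_sub_le {S : Finset (ℝ × ℝ)} (hS : S.Nonempty) {f : SL2 → ℝ} {g g' : SL2} {B : ℝ}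
    (h : ∀ q ∈ S, ∀ q' ∈ S, f (g * na q.1 q.2) - f (g' * na q'.1 q'.2) ≤ B) {q₀ q₀' : ℝ × ℝ}
    (h₀ : q₀ ∈ S) (h₀' : q₀' ∈ S) {δ : ℝ}
    (hδ : f (g * na q₀.1 q₀.2) - f (g' * na q₀'.1 q₀'.2) ≤ B - δ) :
    avgJ S f g - avgJ S f g' ≤ B - δ / (S.card : ℝ) ^ 2 := by
  have hN : (0 : ℝ) < S.card := by exact_mod_cast hS.card_pos
  set F : ℝ × ℝ → ℝ := fun q => f (g * na q.1 q.2)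
  set F' : ℝ × ℝ → ℝ := fun q => f (g' * na q.1 q.2)
  have e : ∑ z ∈ S ×ˢ S, (F z.1 - F' z.2) = S.card * ∑ q ∈ S, F q - S.card * ∑ q ∈ S, F' q := by
    rw [Finset.sum_sub_distrib, Finset.sum_product, Finset.sum_product]
    simp [Finset.mul_sum]
  have hz : (q₀, q₀') ∈ S ×ˢ S := Finset.mk_mem_product h₀ h₀'
  have h1 : ∑ z ∈ S ×ˢ S, (F z.1 - F' z.2) ≤ S.card ^ 2 * B - δ := by
    classical
    rw [← Finset.add_sum_erase _ _ hz]
    have h2 : ∑ z ∈ (S ×ˢ S).erase (q₀, q₀'), (F z.1 - F' z.2) ≤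
        ∑ z ∈ (S ×ˢ S).erase (q₀, q₀'), B := Finset.sum_le_sum fun z hz' => by
      have := Finset.mem_product.mp (Finset.mem_of_mem_erase hz')
      exact h _ this.1 _ this.2
    have h3 : (∑ z ∈ (S ×ˢ S).erase (q₀, q₀'), B) + B = S.card ^ 2 * B := by
      rw [Finset.sum_erase_add (S ×ˢ S) (fun _ => B) hz, Finset.sum_const, Finset.card_product,
        nsmul_eq_mul]
      push_cast
      ring
    have h4 : F q₀ - F' q₀' ≤ B - δ := hδ
    simp only
    linarith
  rw [e] at h1
  have e2 : avgJ S f g - avgJ S f g' =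
      (S.card * ∑ q ∈ S, F q - S.card * ∑ q ∈ S, F' q) / (S.card : ℝ) ^ 2 := by
    simp only [avgJ, F, F']
    field_simp
  rw [e2, div_le_iff₀ (by positivity), sub_mul, div_mul_cancel₀ _ (by positivity)]
  linarith

lemma abs_avgJ_mul_sub_le {S : Finset (ℝ × ℝ)} (hS : S.Nonempty) {W f : SL2 → ℝ} {Q C : ℝ}
    (hW0 : ∀ g, 0 ≤ W g) (hWm : ∀ g p, W (g * p) ≤ nm p.1 * W g) (hQ : 0 ≤ Q)
    (hL : LipW W f Q) (hC : ∀ q ∈ S, nm (na q.1 q.2).1 ^ 3 ≤ C) (g p : SL2) :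
    |avgJ S f (g * p) - avgJ S f g| ≤ C * Q * dev p * W g := by
  have hN : (0 : ℝ) < S.card := by exact_mod_cast hS.card_pos
  unfold avgJ
  rw [← sub_div, ← Finset.sum_sub_distrib, abs_div, abs_of_pos hN, div_le_iff₀ hN]
  refine (Finset.abs_sum_le_sum_abs _ _).trans ?_
  rw [mul_comm _ (S.card : ℝ), ← nsmul_eq_mul]
  refine Finset.sum_le_card_nsmul _ _ _ fun q hq => ?_
  have h := hL (g * na q.1 q.2) ((na q.1 q.2)⁻¹ * p * na q.1 q.2)
  rw [show g * na q.1 q.2 * ((na q.1 q.2)⁻¹ * p * na q.1 q.2) = g * p * na q.1 q.2 by group] at h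
  refine h.trans ?_
  have hd := dev_nonneg p
  have hn := nm_nonneg (na q.1 q.2).1
  have hg := hW0 g
  calc Q * dev ((na q.1 q.2)⁻¹ * p * na q.1 q.2) * W (g * na q.1 q.2)
      ≤ Q * (nm (na q.1 q.2).1 ^ 2 * dev p) * (nm (na q.1 q.2).1 * W g) := by
        gcongr
        · exact hW0 _
        · exact dev_conj_le _ _
        · exact hWm _ _
    _ = nm (na q.1 q.2).1 ^ 3 * (Q * dev p * W g) := by ring
    _ ≤ C * (Q * dev p * W g) := mul_le_mul_of_nonneg_right (hC q hq) (by positivity)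
    _ = C * Q * dev p * W g := by ring

lemma avgA_ht_le {Γ : Subgroup SL2} (hΓ : IsDisc Γ) {t₀ b : ℝ}
    (hb : ∀ t ∈ Set.Icc t₀ (t₀ + 1), ∀ g,
      ∫ u in (0 : ℝ)..1, ht Γ (g * na u t) ≤ 1 / 2 * ht Γ g + b) (g : SL2) :
    avgA t₀ (ht Γ) g ≤ 1 / 2 * ht Γ g + b := by
  have hc := continuous_mul_na (continuous_ht hΓ) g
  unfold avgA
  rw [boxInt_swap hc]
  have hc' : Continuous fun q : ℝ × ℝ => ht Γ (g * na q.2 q.1) :=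
    (continuous_ht hΓ).comp (continuous_const.mul ((continuous_nU.comp continuous_snd).mul
      (continuous_amat.comp continuous_fst.neg)))
  have h1 : Continuous fun t => ∫ u in (0 : ℝ)..1, ht Γ (g * na u t) :=
    intervalIntegral.continuous_parametric_intervalIntegral_of_continuous'
      (f := fun t u => ht Γ (g * na u t)) hc' _ _
  have := intervalIntegral.integral_mono_on (μ := volume) (show t₀ ≤ t₀ + 1 by linarith)
    (h1.intervalIntegrable _ _) ((continuous_const (y := 1 / 2 * ht Γ g + b)).intervalIntegrable _ _)
    fun t ht' => hb t ht' g
  simpa using this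

lemma avgA_sub_le {Γ : Subgroup SL2} (hΓ : IsDisc Γ) {t₀ b β M : ℝ} (hβ : 0 ≤ β) (hM : 0 ≤ M)
    (hb : ∀ t ∈ Set.Icc t₀ (t₀ + 1), ∀ g,
      ∫ u in (0 : ℝ)..1, ht Γ (g * na u t) ≤ 1 / 2 * ht Γ g + b)
    {f : SL2 → ℝ} (hf : Continuous f)
    (hD : ∀ g g', f g - f g' ≤ M * ((1 + β * ht Γ g) + (1 + β * ht Γ g'))) (g g' : SL2) :
    avgA t₀ f g - avgA t₀ f g' ≤ M * (2 + β * (1 / 2 * (ht Γ g + ht Γ g') + 2 * b)) := by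
  have hc := continuous_mul_na (continuous_ht hΓ) g
  have hc' := continuous_mul_na (continuous_ht hΓ) g'
  have e : boxInt t₀ (fun u t => 2 * M + M * β * (ht Γ (g * na u t) + ht Γ (g' * na u t))) =
      2 * M + M * β * (avgA t₀ (ht Γ) g + avgA t₀ (ht Γ) g') := by
    rw [boxInt_add (G := fun _ _ => 2 * M) continuous_const
      (continuous_const.mul (hc.add hc')), boxInt_const, boxInt_const_mul, boxInt_add hc hc']
    rfl
  have h1 : avgA t₀ f g - avgA t₀ f g' ≤
      boxInt t₀ (fun u t => 2 * M + M * β * (ht Γ (g * na u t) + ht Γ (g' * na u t))) := by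
    unfold avgA
    rw [← boxInt_sub (continuous_mul_na hf g) (continuous_mul_na hf g')]
    refine boxInt_mono ((continuous_mul_na hf g).sub (continuous_mul_na hf g'))
      (continuous_const.add (continuous_const.mul (hc.add hc'))) fun u _ t _ => ?_
    refine (hD _ _).trans_eq ?_
    ring
  rw [e] at h1
  have h2 := avgA_ht_le hΓ hb g
  have h3 := avgA_ht_le hΓ hb g'
  have h4 := mul_le_mul_of_nonneg_left (add_le_add h2 h3) (mul_nonneg hM hβ)
  linarith

lemma LipW.abs_sub_le_of_dev_le {W f : SL2 → ℝ} {Q η B : ℝ} (hL : LipW W f Q) {g₁ γ h p : SL2}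
    (hf : ∀ g, f (γ * g) = f g) (hQ : 0 ≤ Q) (hW : 0 ≤ W g₁) (hd : dev (g₁⁻¹ * γ * h * p) ≤ η)
    (hB : Q * η * W g₁ ≤ B) : |f (h * p) - f g₁| ≤ B := by
  have h1 := hL g₁ (g₁⁻¹ * γ * h * p)
  rw [show g₁ * (g₁⁻¹ * γ * h * p) = γ * (h * p) by group, hf] at h1
  exact h1.trans ((mul_le_mul_of_nonneg_right (mul_le_mul_of_nonneg_left hd hQ) hW).trans hB)

/-- `avg` contracts the weighted oscillation and the weighted Lipschitz seminorm by `ρ`. -/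
def Contracts (Γ : Subgroup SL2) (ε t₀ : ℝ) (S : Finset (ℝ × ℝ)) (β K ρ : ℝ) : Prop :=
  ∀ f : SL2 → ℝ, (∀ γ ∈ Γ, ∀ g, f (γ * g) = f g) → ∀ M : ℝ, 0 ≤ M →
    (∀ g g', f g - f g' ≤ M * ((1 + β * ht Γ g) + (1 + β * ht Γ g'))) →
    LipW (fun g => 1 + β * ht Γ g) f (K * M) →
    (∀ g g', avg ε t₀ S f g - avg ε t₀ S f g' ≤
      ρ * M * ((1 + β * ht Γ g) + (1 + β * ht Γ g'))) ∧
    LipW (fun g => 1 + β * ht Γ g) (avg ε t₀ S f) (K * (ρ * M))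

/-- The averaging operator uniformly contracts the weighted oscillation. -/
theorem exists_contraction {Γ : Subgroup SL2} (hlat : IsLatticeSL2 Γ) (hΓ : IsDisc Γ)
    {g₁ γ₀ : SL2} {c : ℝ} (hc : c ≠ 0) (hγ₀ : γ₀ ∈ Γ) (h₀ : γ₀ * g₁ = g₁ * nU c) :
    ∃ (t₀ b : ℝ) (S : Finset (ℝ × ℝ)) (ε β K ρ : ℝ), 0 ≤ t₀ ∧ 0 ≤ b ∧
      (∀ t ∈ Set.Icc t₀ (t₀ + 1), ∀ g,
        ∫ u in (0 : ℝ)..1, ht Γ (g * na u t) ≤ 1 / 2 * ht Γ g + b) ∧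
      S.Nonempty ∧ 0 < ε ∧ ε < 1 ∧ 0 < β ∧ β ≤ 1 ∧ 25 ≤ K ∧ 0 < ρ ∧ ρ < 1 ∧
      Contracts Γ ε t₀ S β K ρ := by
  set t₀ := driftTime 248 with ht₀
  obtain ⟨b, hb0, hb⟩ := drift hΓ (le_refl 248)
  rw [← ht₀] at hb
  have hexp : Real.exp (t₀ / 2) = 128 * 248 ^ 2 := by
    rw [ht₀, driftTime, mul_div_cancel_left₀ _ two_ne_zero, Real.exp_log (by norm_num)]
    norm_num
  have ht2 : 2 ≤ t₀ := by
    by_contra! h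
    have h1 := Real.exp_le_exp.mpr (show t₀ / 2 ≤ 1 by linarith)
    rw [hexp] at h1
    linarith [Real.exp_one_lt_d9]
  have ht64 : 64 ≤ Real.exp (t₀ / 2) := by rw [hexp]; norm_num
  set C := 16 * (4 * Real.exp ((t₀ + 2) / 2) + 1) with hC
  have hC16 : 16 ≤ C := by linarith [Real.exp_pos ((t₀ + 2) / 2)]
  clear_value t₀ C
  have hV1 := one_le_ht hΓ
  have hK : 0 < 4 * C := by linarith
  have hη : 0 < 1 / (2 * (4 * C) * (1 + ht Γ g₁)) := by
    have := hV1 g₁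
    positivity
  set η := 1 / (2 * (4 * C) * (1 + ht Γ g₁)) with hηd
  obtain ⟨S, hS, hreach⟩ := exists_finset_dev_le hlat hΓ hc hγ₀ h₀ hη (16 * b + 1)
  set CJ := ∑ q ∈ S, nm (na q.1 q.2).1 ^ 3 with hCJ
  have hCq : ∀ q ∈ S, nm (na q.1 q.2).1 ^ 3 ≤ CJ := fun q hq =>
    Finset.single_le_sum (f := fun q : ℝ × ℝ => nm (na q.1 q.2).1 ^ 3)
      (fun q _ => pow_nonneg (nm_nonneg _) 3) hq
  have hCq1 : ∀ q ∈ S, nm (na q.1 q.2).1 ≤ CJ := fun q hq =>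
    (le_self_pow₀ (nm_SL2_ge_one _) three_ne_zero).trans (hCq q hq)
  have hCJ1 : 1 ≤ CJ := by
    obtain ⟨q, hq⟩ := hS
    exact (nm_SL2_ge_one _).trans (hCq1 q hq)
  have hN : (1 : ℝ) ≤ S.card := by exact_mod_cast hS.card_pos
  set N : ℝ := (S.card : ℝ) with hNd
  set ε := 1 / (8 * CJ) with hε
  have hε0 : 0 < ε := by positivity
  have hεC : ε * CJ = 1 / 8 := by rw [hε]; field_simp
  have hε1 : ε ≤ 1 / 8 := by nlinarith
  set β := min 1 (ε / (4 * N ^ 2 * (b + 1))) with hβ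
  have hβ0 : 0 < β := lt_min one_pos (by positivity)
  have hβ1 : β ≤ 1 := min_le_left _ _
  have hβb : 2 * b * β ≤ ε / (2 * N ^ 2) := by
    have h1 : β ≤ ε / (4 * N ^ 2 * (b + 1)) := min_le_right _ _
    rw [le_div_iff₀ (by positivity)] at h1 ⊢
    nlinarith [mul_nonneg hβ0.le (sq_nonneg N)]
  set θ := min (min (1 / 8) (ε / (4 * N ^ 2))) (β / 16) with hθ
  have hθ0 : 0 < θ := lt_min (lt_min (by norm_num) (by positivity)) (by positivity)
  have hθ1 : θ ≤ 1 / 8 := (min_le_left _ _).trans (min_le_left _ _)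
  have hθ2 : θ ≤ ε / (4 * N ^ 2) := (min_le_left _ _).trans (min_le_right _ _)
  have hθ3 : θ ≤ β / 16 := min_le_right _ _
  clear_value CJ N ε β θ η
  refine ⟨t₀, b, S, ε, β, 4 * C, 1 - θ, by linarith, hb0, hb, hS, hε0, by linarith, hβ0, hβ1,
    by linarith, by linarith, by linarith, fun f hf M hM hD hL => ?_⟩
  have hW0 : ∀ g, 0 ≤ 1 + β * ht Γ g := fun g => by
    have := hV1 g
    positivity
  have hWm : ∀ g p : SL2, 1 + β * ht Γ (g * p) ≤ nm p.1 * (1 + β * ht Γ g) := fun g p => by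
    have h1 := mul_le_mul_of_nonneg_left (ht_mul_le hΓ g p) hβ0.le
    have h2 := nm_SL2_ge_one p
    linarith
  have hfc := hL.continuous
  have hD' : ∀ g g', avg ε t₀ S f g - avg ε t₀ S f g' ≤
      (1 - θ) * M * ((1 + β * ht Γ g) + (1 + β * ht Γ g')) := fun g g' => by
    have hA := avgA_sub_le hΓ hβ0.le hM hb hfc hD g g'
    have hg := hV1 g
    have hg' := hV1 g'
    have hs0 : 0 ≤ ht Γ g + ht Γ g' := by linarith
    set s := ht Γ g + ht Γ g' with hs
    have hMs : 0 ≤ M * (β * s) := mul_nonneg hM (mul_nonneg hβ0.le hs0)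
    have hpair : ∀ q ∈ S, ∀ q' ∈ S, f (g * na q.1 q.2) - f (g' * na q'.1 q'.2) ≤
        M * (2 + β * (CJ * s)) := fun q hq q' hq' => by
      refine (hD _ _).trans (mul_le_mul_of_nonneg_left ?_ hM)
      have h1 : ht Γ (g * na q.1 q.2) ≤ CJ * ht Γ g :=
        (ht_mul_le hΓ _ _).trans (mul_le_mul_of_nonneg_right (hCq1 q hq) (by linarith))
      have h2 : ht Γ (g' * na q'.1 q'.2) ≤ CJ * ht Γ g' :=
        (ht_mul_le hΓ _ _).trans (mul_le_mul_of_nonneg_right (hCq1 q' hq') (by linarith))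
      have h3 := mul_le_mul_of_nonneg_left (add_le_add h1 h2) hβ0.le
      rw [hs]
      linarith
    have key : ∀ δ : ℝ, avgJ S f g - avgJ S f g' ≤ M * (2 + β * (CJ * s)) - δ →
        avg ε t₀ S f g - avg ε t₀ S f g' ≤ M * (2 + 3 / 4 * β * s + 2 * b * β) - ε * δ := by
      intro δ hJ
      have e : avg ε t₀ S f g - avg ε t₀ S f g' = (1 - ε) * (avgA t₀ f g - avgA t₀ f g') +
          ε * (avgJ S f g - avgJ S f g') := by unfold avg; ring
      rw [e]
      have h1 := mul_le_mul_of_nonneg_left hA (show 0 ≤ 1 - ε by linarith)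
      have h2 := mul_le_mul_of_nonneg_left hJ hε0.le
      have h3 : 0 ≤ ε * (M * (β * s)) := mul_nonneg hε0.le hMs
      have h4 : 0 ≤ M * β * ε * b :=
        mul_nonneg (mul_nonneg (mul_nonneg hM hβ0.le) hε0.le) hb0
      have h5 : ε * (M * (2 + β * (CJ * s)) - δ) = ε * M * 2 + M * β * s * (ε * CJ) - ε * δ := by
        ring
      rw [h5, hεC] at h2
      linarith
    by_cases hsR : s ≤ 16 * b + 1
    · obtain ⟨q₀, hq₀, γ, hγ, hd⟩ := hreach g (by linarith)
      obtain ⟨q₀', hq₀', γ', hγ', hd'⟩ := hreach g' (by linarith)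
      have hη2 : 4 * C * M * η * (1 + β * ht Γ g₁) ≤ M / 2 := by
        have h2 : 1 + β * ht Γ g₁ ≤ 1 + ht Γ g₁ := by
          have := mul_le_mul_of_nonneg_right hβ1 (zero_le_one.trans (hV1 g₁))
          linarith
        refine (mul_le_mul_of_nonneg_left h2
          (mul_nonneg (mul_nonneg hK.le hM) hη.le)).trans_eq ?_
        have := hV1 g₁
        rw [hηd]
        field_simp
      have hQ := mul_nonneg hK.le hM
      have h1 := abs_le.mp 
        (hL.abs_sub_le_of_dev_le (hf γ hγ) hQ (hW0 _) hd hη2)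
      have h2 := abs_le.mp 
        (hL.abs_sub_le_of_dev_le (hf γ' hγ') hQ (hW0 _) hd' hη2)
      have hCJs : 0 ≤ M * (β * (CJ * s)) :=
        mul_nonneg hM (mul_nonneg hβ0.le (mul_nonneg (by linarith) hs0))
      have h3 := avgJ_sub_le hS hpair hq₀ hq₀' (δ := M) (by linarith)
      have h4 := key _ h3
      rw [← hNd] at h4
      have h5 : ε * (M / N ^ 2) = M * (ε / N ^ 2) := by ring
      have h6 : ε / (2 * N ^ 2) = ε / N ^ 2 / 2 := by field_simp
      have h7 : ε / (4 * N ^ 2) = ε / N ^ 2 / 4 := by field_simp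
      rw [h5] at h4
      rw [h6] at hβb
      rw [h7] at hθ2
      have h8 := mul_le_mul_of_nonneg_left hβb hM
      have h9 := mul_le_mul_of_nonneg_left hθ2 hM
      have h10 := mul_le_mul_of_nonneg_right hθ1 hMs
      have e : (1 - θ) * M * ((1 + β * ht Γ g) + (1 + β * ht Γ g')) =
        2 * M - 2 * (M * θ) + M * (β * s) - θ * (M * (β * s)) := by rw [hs]; ring
      rw [e]
      linarith
    · obtain ⟨q, hq⟩ := hS
      have h3 := avgJ_sub_le ⟨q, hq⟩ hpair hq hq (δ := 0) (by linarith [hpair q hq q hq])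
      have h4 := key 0 (by simpa using h3)
      have e : (1 - θ) * M * ((1 + β * ht Γ g) + (1 + β * ht Γ g')) =
        2 * M - 2 * (M * θ) + M * (β * s) - θ * (M * (β * s)) := by rw [hs]; ring
      rw [e]
      have h9 := mul_le_mul_of_nonneg_left hθ3 hM
      have h10 := mul_le_mul_of_nonneg_right hθ1 hMs
      have h11 := mul_le_mul_of_nonneg_left (not_le.mp hsR).le (mul_nonneg hM hβ0.le)
      linarith
  refine ⟨hD', fun g p => ?_⟩
  have hWg := hW0 g
  have hdp := dev_nonneg p
  by_cases hp : dev p ≤ 1 / 8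
  · have hA := abs_avgA_mul_sub_le hW0 hWm (mul_nonneg hK.le hM) hM hL hD ht2 ht64 g p hp
    have hJ := abs_avgJ_mul_sub_le hS hW0 hWm (mul_nonneg hK.le hM) hL hCq g p
    have e : avg ε t₀ S f (g * p) - avg ε t₀ S f g =
        (1 - ε) * (avgA t₀ f (g * p) - avgA t₀ f g) +
          ε * (avgJ S f (g * p) - avgJ S f g) := by unfold avg; ring
    rw [← hC] at hA
    have hX : 0 ≤ C * M * dev p * (1 + β * ht Γ g) :=
      mul_nonneg (mul_nonneg (mul_nonneg (by linarith) hM) hdp) hWg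
    have hεJ : ε * (CJ * (4 * C * M) * dev p * (1 + β * ht Γ g)) =
        (ε * CJ) * 4 * (C * M * dev p * (1 + β * ht Γ g)) := by ring
    rw [hεC] at hεJ
    have h4 : |avg ε t₀ S f (g * p) - avg ε t₀ S f g| ≤
        |avgA t₀ f (g * p) - avgA t₀ f g| + ε * |avgJ S f (g * p) - avgJ S f g| := by
      rw [e]
      refine (abs_add_le _ _).trans ?_
      rw [abs_mul, abs_mul, abs_of_pos hε0, abs_of_pos (show 0 < 1 - ε by linarith)]
      have := mul_nonneg hε0.le (abs_nonneg (avgA t₀ f (g * p) - avgA t₀ f g))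
      linarith
    have h5 := mul_le_mul_of_nonneg_left hJ hε0.le
    have h6 := mul_le_mul_of_nonneg_right hθ1 hX
    rw [hεJ] at h5
    have e2 : 4 * C * ((1 - θ) * M) * dev p * (1 + β * ht Γ g) =
        4 * (C * M * dev p * (1 + β * ht Γ g)) - 4 * (θ * (C * M * dev p * (1 + β * ht Γ g))) := by
      ring
    rw [e2]
    linarith
  · push Not at hp
    have h1 := hD' (g * p) g
    have h2 := hD' g (g * p)
    have hθM : 0 ≤ (1 - θ) * M := mul_nonneg (by linarith) hM
    have h3 : (1 + β * ht Γ (g * p)) + (1 + β * ht Γ g) ≤ 4 * C * dev p * (1 + β * ht Γ g) := by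
      have h4 := hWm g p
      have h5 := nm_le_dev p
      have h6 : nm p.1 + 1 ≤ 4 * C * dev p := by nlinarith
      nlinarith
    have h4 := mul_le_mul_of_nonneg_left h3 hθM
    rw [abs_le]
    constructor <;> linarith

section quotient
variable {Γ : Subgroup SL2}

lemma qmk_eq_iff {a b : SL2} : qmk Γ a = qmk Γ b ↔ b * a⁻¹ ∈ Γ := by
  rw [← QuotientGroup.rightRel_apply]
  exact Quotient.eq

lemma qmk_surjective : Function.Surjective (qmk Γ) := Quotient.mk_surjective

lemma qmk_mul_left {γ : SL2} (hγ : γ ∈ Γ) (g : SL2) : qmk Γ (γ * g) = qmk Γ g := by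
  rw [eq_comm, qmk_eq_iff, mul_inv_cancel_right]
  exact hγ

lemma rmul_qmk (g p : SL2) : rmul Γ (qmk Γ g) p = qmk Γ (g * p) := rfl

lemma isOpenQuotientMap_qmk : IsOpenQuotientMap (qmk Γ) := by
  refine ⟨qmk_surjective, continuous_qmk Γ, fun U hU => ?_⟩
  have e : qmk Γ ⁻¹' (qmk Γ '' U) = ⋃ γ : Γ, (fun g => (γ : SL2) * g) ⁻¹' U := by
    ext g
    simp only [Set.mem_preimage, Set.mem_image, Set.mem_iUnion]
    constructor
    · rintro ⟨h, hU, h2⟩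
      have h3 := qmk_eq_iff.mp h2.symm
      exact ⟨⟨_, h3⟩, by simpa using hU⟩
    · rintro ⟨γ, h⟩
      exact ⟨_, h, qmk_mul_left γ.2 g⟩
  have h : IsOpen (qmk Γ ⁻¹' (qmk Γ '' U)) := by
    rw [e]
    exact isOpen_iUnion fun γ => hU.preimage (continuous_const.mul continuous_id)
  exact h

instance : BorelSpace (XQuot Γ) := ⟨rfl⟩

lemma continuous_rmul : Continuous fun q : XQuot Γ × SL2 => rmul Γ q.1 q.2 := by
  have h := (isOpenQuotientMap_qmk (Γ := Γ)).prodMap (IsOpenQuotientMap.id (X := SL2))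
  rw [h.isQuotientMap.continuous_iff]
  exact (continuous_qmk Γ).comp continuous_mul

lemma continuous_rmul_right (x : XQuot Γ) : Continuous fun p => rmul Γ x p :=
  continuous_rmul.comp (continuous_const.prodMk continuous_id)

lemma continuous_rmul_left (p : SL2) : Continuous fun x : XQuot Γ => rmul Γ x p :=
  continuous_rmul.comp (continuous_id.prodMk continuous_const)

/-- The operator `avg` on functions on the quotient. -/
def avgX (ε t₀ : ℝ) (S : Finset (ℝ × ℝ)) (F : XQuot Γ → ℝ) (x : XQuot Γ) : ℝ :=
  (1 - ε) * boxInt t₀ (fun u t => F (rmul Γ x (na u t))) +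
    ε * ((∑ q ∈ S, F (rmul Γ x (na q.1 q.2))) / S.card)

lemma avgX_qmk (ε t₀ : ℝ) (S : Finset (ℝ × ℝ)) (F : XQuot Γ → ℝ) (g : SL2) :
    avgX ε t₀ S F (qmk Γ g) = avg ε t₀ S (fun g => F (qmk Γ g)) g := rfl

lemma continuous_iff_qmk {F : XQuot Γ → ℝ} : Continuous F ↔ Continuous fun g => F (qmk Γ g) :=
  (isOpenQuotientMap_qmk (Γ := Γ)).isQuotientMap.continuous_iff

section measure
variable {μ : Measure (XQuot Γ)}

lemma integrable_of_continuous_bounded [IsProbabilityMeasure μ] {F : XQuot Γ → ℝ} (hF : Continuous F) {B : ℝ}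
    (hB : ∀ x, |F x| ≤ B) : Integrable F μ :=
  (integrable_const B).mono' hF.aestronglyMeasurable (ae_of_all _ hB)

lemma integral_rmul (hinv : ∀ g : SL2, Measure.map (fun x => rmul Γ x g) μ = μ)
    {F : XQuot Γ → ℝ} (hF : Continuous F) (p : SL2) :
    ∫ x, F (rmul Γ x p) ∂μ = ∫ x, F x ∂μ := by
  conv_rhs => rw [← hinv p]
  rw [integral_map (continuous_rmul_left p).measurable.aemeasurable hF.aestronglyMeasurable]

lemma integral_interval_swap [IsProbabilityMeasure μ] {G : ℝ → XQuot Γ → ℝ} (hG : Continuous (Function.uncurry G))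
    {B : ℝ} (hB : ∀ u x, |G u x| ≤ B) (a b : ℝ) :
    ∫ x, (∫ u in a..b, G u x) ∂μ = ∫ u in a..b, (∫ x, G u x ∂μ) := by
  refine (intervalIntegral_integral_swap ?_).symm
  have : IsFiniteMeasure (volume.restrict (Set.uIoc a b)) :=
    ⟨by rw [Measure.restrict_apply_univ, Set.uIoc, Real.volume_Ioc]; exact ENNReal.ofReal_lt_top⟩
  exact (integrable_const B).mono' hG.aestronglyMeasurable (ae_of_all _ fun z => hB _ _)

lemma integral_boxInt [IsProbabilityMeasure μ] {G : ℝ → ℝ → XQuot Γ → ℝ}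
    (hG : Continuous fun z : ℝ × ℝ × XQuot Γ => G z.1 z.2.1 z.2.2)
    {B : ℝ} (hB : ∀ u t x, |G u t x| ≤ B) (t₀ : ℝ) :
    ∫ x, boxInt t₀ (fun u t => G u t x) ∂μ = boxInt t₀ fun u t => ∫ x, G u t x ∂μ := by
  unfold boxInt
  have h1 : Continuous (Function.uncurry fun u x => ∫ t in t₀..(t₀ + 1), G u t x) := by
    have h := intervalIntegral.continuous_parametric_intervalIntegral_of_continuous'
      (μ := volume) (f := fun (z : ℝ × XQuot Γ) t => G z.1 t z.2)
      (hG.comp ((continuous_fst.comp continuous_fst).prodMk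
        (continuous_snd.prodMk (continuous_snd.comp continuous_fst)))) t₀ (t₀ + 1)
    exact h
  rw [integral_interval_swap h1 (B := B)]
  · congr 1
    ext u
    exact integral_interval_swap (G := G u) (hG.comp (continuous_const.prodMk continuous_id))
      (hB u) _ _
  · intro u x
    have := abs_integral_le_of_le (a := t₀) (b := t₀ + 1) (f := fun t => G u t x)
      fun t _ => hB u t x
    simpa using this

lemma continuous_boxInt {G : ℝ → ℝ → XQuot Γ → ℝ}
    (hG : Continuous fun z : ℝ × ℝ × XQuot Γ => G z.1 z.2.1 z.2.2) (t₀ : ℝ) :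
    Continuous fun x => boxInt t₀ fun u t => G u t x := by
  refine intervalIntegral.continuous_parametric_intervalIntegral_of_continuous'
    (f := fun x u => ∫ t in t₀..(t₀ + 1), G u t x) ?_ _ _
  have h := intervalIntegral.continuous_parametric_intervalIntegral_of_continuous'
    (μ := volume) (f := fun (z : XQuot Γ × ℝ) t => G z.2 t z.1)
    (hG.comp ((continuous_snd.comp continuous_fst).prodMk
      (continuous_snd.prodMk (continuous_fst.comp continuous_fst)))) t₀ (t₀ + 1)
  exact h

lemma abs_boxInt_le {G : ℝ → ℝ → XQuot Γ → ℝ}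
    (hG : Continuous fun z : ℝ × ℝ × XQuot Γ => G z.1 z.2.1 z.2.2)
    {B : ℝ} (hB : ∀ u t x, |G u t x| ≤ B) (t₀ : ℝ) (x : XQuot Γ) :
    |boxInt t₀ fun u t => G u t x| ≤ B := by
  have hcx : Continuous fun q : ℝ × ℝ => G q.1 q.2 x :=
    hG.comp (continuous_fst.prodMk (continuous_snd.prodMk continuous_const))
  have := abs_boxInt_sub_le (t₀ := t₀) (G := fun u t => G u t x)
    (G' := fun _ _ => 0) hcx continuous_const (B := B) fun u _ t _ => by
      rw [sub_zero]; exact hB _ _ _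
  rwa [boxInt_const, sub_zero] at this

lemma integral_avgX [IsProbabilityMeasure μ]
    (hinv : ∀ g : SL2, Measure.map (fun x => rmul Γ x g) μ = μ)
    {F : XQuot Γ → ℝ} (hF : Continuous F) {B : ℝ} (hB : ∀ x, |F x| ≤ B) (ε t₀ : ℝ)
    {S : Finset (ℝ × ℝ)} (hS : S.Nonempty) :
    ∫ x, avgX ε t₀ S F x ∂μ = ∫ x, F x ∂μ := by
  have hN : (S.card : ℝ) ≠ 0 := by exact_mod_cast hS.card_pos.ne'
  have hc : Continuous fun z : ℝ × ℝ × XQuot Γ => F (rmul Γ z.2.2 (na z.1 z.2.1)) :=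
    hF.comp (continuous_rmul.comp ((continuous_snd.comp continuous_snd).prodMk
      ((continuous_nU.comp continuous_fst).mul
        (continuous_amat.comp (continuous_fst.comp continuous_snd).neg))))
  have hFr : ∀ p, Integrable (fun x => F (rmul Γ x p)) μ := fun p =>
    integrable_of_continuous_bounded (hF.comp (continuous_rmul_left p)) fun x => hB _
  have h1 := integral_boxInt (μ := μ) (G := fun u t x => F (rmul Γ x (na u t))) hc
    (fun _ _ _ => hB _) t₀
  simp only [integral_rmul hinv hF, boxInt_const] at h1
  have h2 : Integrable (fun x => boxInt t₀ fun u t => F (rmul Γ x (na u t))) μ := by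
    exact integrable_of_continuous_bounded
      (continuous_boxInt (G := fun u t x => F (rmul Γ x (na u t))) hc t₀)
      (abs_boxInt_le (G := fun u t x => F (rmul Γ x (na u t))) hc (fun _ _ _ => hB _) t₀)
  unfold avgX
  rw [integral_add (h2.const_mul _)
    (((integrable_finsetSum _ fun q _ => hFr _).div_const _).const_mul _),
    integral_const_mul, integral_const_mul, integral_div, integral_finsetSum _ fun q _ => hFr _, h1]
  simp only [integral_rmul hinv hF, Finset.sum_const, nsmul_eq_mul]
  field_simp
  ring

end measure
end quotient

section decay
variable {Γ : Subgroup SL2} {ε t₀ : ℝ} {S : Finset (ℝ × ℝ)}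

lemma abs_avgX_sub_le (hε : 0 ≤ ε) (hε1 : ε ≤ 1) (hS : S.Nonempty) {F : XQuot Γ → ℝ}
    (hF : Continuous F) {x : XQuot Γ} {c B : ℝ}
    (h1 : ∀ u ∈ Set.Icc (0 : ℝ) 1, ∀ t ∈ Set.Icc t₀ (t₀ + 1), |F (rmul Γ x (na u t)) - c| ≤ B)
    (h2 : ∀ q ∈ S, |F (rmul Γ x (na q.1 q.2)) - c| ≤ B) : |avgX ε t₀ S F x - c| ≤ B := by
  have hN : (0 : ℝ) < S.card := by exact_mod_cast hS.card_pos
  have hc : Continuous fun q : ℝ × ℝ => F (rmul Γ x (na q.1 q.2)) :=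
    hF.comp ((continuous_rmul_right x).comp ((continuous_nU.comp continuous_fst).mul
      (continuous_amat.comp continuous_snd.neg)))
  have b1 := abs_boxInt_sub_le (t₀ := t₀) (G := fun u t => F (rmul Γ x (na u t)))
    (G' := fun _ _ => c) hc continuous_const h1
  rw [boxInt_const] at b1
  have b2 : |(∑ q ∈ S, F (rmul Γ x (na q.1 q.2))) / S.card - c| ≤ B := by
    have e : (∑ q ∈ S, F (rmul Γ x (na q.1 q.2))) / S.card - c =
        (∑ q ∈ S, (F (rmul Γ x (na q.1 q.2)) - c)) / S.card := by
      rw [Finset.sum_sub_distrib, Finset.sum_const, nsmul_eq_mul]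
      field_simp
    rw [e, abs_div, abs_of_pos hN, div_le_iff₀ hN, mul_comm, ← nsmul_eq_mul]
    exact (Finset.abs_sum_le_sum_abs _ _).trans (Finset.sum_le_card_nsmul _ _ _ h2)
  rw [abs_le] at b1 b2 ⊢
  unfold avgX
  constructor <;> nlinarith

/-- Iterates of the averaging operator converge exponentially fast to the space average. -/
theorem exists_decay {β K ρ : ℝ} (hΓ : IsDisc Γ) (ht₀ : 0 ≤ t₀) (hε : 0 ≤ ε) (hε1 : ε ≤ 1)
    (hS : S.Nonempty) (hβ : 0 ≤ β) (hρ : 0 < ρ) (hρ1 : ρ < 1) (hcon : Contracts Γ ε t₀ S β K ρ)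
    {μ : Measure (XQuot Γ)} [IsProbabilityMeasure μ]
    (hinv : ∀ g : SL2, Measure.map (fun x => rmul Γ x g) μ = μ) :
    ∃ C, 0 ≤ C ∧ ∀ F : XQuot Γ → ℝ, ∀ M B : ℝ, 0 ≤ M → (∀ x, |F x| ≤ B) →
      (∀ g g', F (qmk Γ g) - F (qmk Γ g') ≤ M * ((1 + β * ht Γ g) + (1 + β * ht Γ g'))) →
      LipW (fun g => 1 + β * ht Γ g) (fun g => F (qmk Γ g)) (K * M) →
      ∀ n : ℕ, Continuous ((avgX ε t₀ S)^[n] F) ∧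
        ∀ g, |(avgX ε t₀ S)^[n] F (qmk Γ g) - ∫ x, F x ∂μ| ≤ C * M * ρ ^ n * (1 + β * ht Γ g) := by
  set N := 3 * Real.exp ((t₀ + 1) / 2) + ∑ q ∈ S, nm (na q.1 q.2).1 with hN
  have hsum : 0 ≤ ∑ q ∈ S, nm (na q.1 q.2).1 := Finset.sum_nonneg fun q _ => nm_nonneg _
  have hN1 : ∀ u ∈ Set.Icc (0 : ℝ) 1, ∀ t ∈ Set.Icc t₀ (t₀ + 1), nm (na u t).1 ≤ N :=
    fun u hu t ht => by
      have h1 := nm_na_le hu (ht₀.trans ht.1)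
      have h2 := Real.exp_le_exp.mpr (show t / 2 ≤ (t₀ + 1) / 2 by linarith [ht.2])
      linarith
  have hN2 : ∀ q ∈ S, nm (na q.1 q.2).1 ≤ N := fun q hq => by
    have h1 : nm (na q.1 q.2).1 ≤ ∑ q ∈ S, nm (na q.1 q.2).1 :=
      Finset.single_le_sum (f := fun q : ℝ × ℝ => nm (na q.1 q.2).1)
        (fun q _ => nm_nonneg _) hq
    have h2 := Real.exp_pos ((t₀ + 1) / 2)
    linarith
  have hN0 : 0 ≤ N := by
    have := Real.exp_pos ((t₀ + 1) / 2)
    linarith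
  clear_value N
  refine ⟨(N + 1) / (1 - ρ), div_nonneg (by linarith) (by linarith),
    fun F M B hM hB hD hL n => ?_⟩
  have hall : ∀ n : ℕ, (∀ g g', (avgX ε t₀ S)^[n] F (qmk Γ g) - (avgX ε t₀ S)^[n] F (qmk Γ g') ≤
        ρ ^ n * M * ((1 + β * ht Γ g) + (1 + β * ht Γ g'))) ∧
      LipW (fun g => 1 + β * ht Γ g) (fun g => (avgX ε t₀ S)^[n] F (qmk Γ g))
        (K * (ρ ^ n * M)) := by
    intro n
    induction n with
    | zero =>
      rw [pow_zero, one_mul]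
      exact ⟨hD, hL⟩
    | succ n ih =>
      have h := hcon _ (fun γ hγ g => by simp only [qmk_mul_left hγ g]) (ρ ^ n * M)
        (mul_nonneg (pow_nonneg hρ.le n) hM) ih.1 ih.2
      rw [← mul_assoc, ← pow_succ'] at h
      rw [Function.iterate_succ_apply']
      exact h
  have hcont : ∀ n, Continuous ((avgX ε t₀ S)^[n] F) := fun n =>
    continuous_iff_qmk.mpr (hall n).2.continuous
  have hbd : ∀ n x, |(avgX ε t₀ S)^[n] F x| ≤ B := fun n => by
    induction n with
    | zero => exact hB
    | succ n ih =>
      intro x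
      rw [Function.iterate_succ_apply', ← sub_zero (avgX ε t₀ S _ x)]
      exact abs_avgX_sub_le hε hε1 hS (hcont n) (fun u _ t _ => by rw [sub_zero]; exact ih _)
        fun q _ => by rw [sub_zero]; exact ih _
  have hInteg : ∀ n, ∫ x, (avgX ε t₀ S)^[n] F x ∂μ = ∫ x, F x ∂μ := fun n => by
    induction n with
    | zero => rfl
    | succ n ih =>
      rw [Function.iterate_succ']
      exact (integral_avgX hinv (hcont n) (hbd n) ε t₀ hS).trans ih
  have hW : ∀ g, 0 ≤ 1 + β * ht Γ g := fun g => by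
    have := mul_nonneg hβ (zero_le_one.trans (one_le_ht hΓ g))
    linarith
  have hWm : ∀ g p, nm p.1 ≤ N → 1 + β * ht Γ (g * p) ≤ N * (1 + β * ht Γ g) := fun g p hp => by
    have h1 := mul_le_mul_of_nonneg_left (ht_mul_le hΓ g p) hβ
    have h2 := nm_SL2_ge_one p
    have h3 := mul_le_mul_of_nonneg_right hp (hW g)
    linarith
  have hstep : ∀ g n, dist ((avgX ε t₀ S)^[n] F (qmk Γ g)) ((avgX ε t₀ S)^[n + 1] F (qmk Γ g)) ≤
      ((N + 1) * M * (1 + β * ht Γ g)) * ρ ^ n := fun g n => by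
    have key : ∀ p : SL2, nm p.1 ≤ N →
        |(avgX ε t₀ S)^[n] F (rmul Γ (qmk Γ g) p) - (avgX ε t₀ S)^[n] F (qmk Γ g)| ≤
          ((N + 1) * M * (1 + β * ht Γ g)) * ρ ^ n := fun p hp => by
      rw [rmul_qmk]
      have h1 := (hall n).1 (g * p) g
      have h2 := (hall n).1 g (g * p)
      have h3 := mul_le_mul_of_nonneg_left (hWm g p hp) (mul_nonneg (pow_nonneg hρ.le n) hM)
      rw [abs_le]
      constructor <;> linarith
    rw [dist_comm, Function.iterate_succ_apply', Real.dist_eq]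
    exact abs_avgX_sub_le hε hε1 hS (hcont n) (fun u hu t ht => key _ (hN1 u hu t ht))
      fun q hq => key _ (hN2 q hq)
  have hlim : ∀ g, Tendsto (fun n => (avgX ε t₀ S)^[n] F (qmk Γ g)) atTop
      (𝓝 (∫ x, F x ∂μ)) := fun g => by
    have h1 : Tendsto (fun n => ∫ x, ((avgX ε t₀ S)^[n] F (qmk Γ g) - (avgX ε t₀ S)^[n] F x) ∂μ)
        atTop (𝓝 (∫ _, (0 : ℝ) ∂μ)) := by
      refine tendsto_integral_of_dominated_convergence (fun _ => 2 * B)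
        (fun n => (continuous_const.sub (hcont n)).aestronglyMeasurable) (integrable_const _)
        (fun n => ae_of_all _ fun x => ?_) (ae_of_all _ fun x => ?_)
      · refine (abs_sub _ _).trans ?_
        linarith [hbd n x, hbd n (qmk Γ g)]
      · obtain ⟨g', rfl⟩ := qmk_surjective x
        have h2 : Tendsto (fun n : ℕ => ρ ^ n * M * ((1 + β * ht Γ g) + (1 + β * ht Γ g')))
            atTop (𝓝 0) := by
          have := ((tendsto_pow_atTop_nhds_zero_of_lt_one hρ.le hρ1).mul_const M).mul_const
            ((1 + β * ht Γ g) + (1 + β * ht Γ g'))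
          simpa using this
        refine squeeze_zero_norm (fun n => ?_) h2
        rw [Real.norm_eq_abs, abs_le]
        have h3 := (hall n).1 g g'
        have h4 := (hall n).1 g' g
        constructor <;> linarith
    have h2 : ∀ n, ∫ x, ((avgX ε t₀ S)^[n] F (qmk Γ g) - (avgX ε t₀ S)^[n] F x) ∂μ =
        (avgX ε t₀ S)^[n] F (qmk Γ g) - ∫ x, F x ∂μ := fun n => by
      rw [integral_sub (integrable_const _)
        (integrable_of_continuous_bounded (hcont n) (hbd n)), hInteg]
      simp
    simp only [h2, integral_zero] at h1
    simpa using h1.add_const (∫ x, F x ∂μ)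
  refine ⟨hcont n, fun g => ?_⟩
  have h := dist_le_of_le_geometric_of_tendsto ρ _ hρ1 (hstep g) (hlim g) n
  rw [Real.dist_eq] at h
  refine h.trans_eq ?_
  ring

end decay

lemma continuous_boxInt_param {t₀ : ℝ} {Φ : ℝ → ℝ → ℝ → ℝ}
    (hΦ : Continuous fun z : ℝ × ℝ × ℝ => Φ z.1 z.2.1 z.2.2) :
    Continuous fun v => boxInt t₀ (Φ v) := by
  have h1 : Continuous fun q : ℝ × ℝ => ∫ t in t₀..(t₀ + 1), Φ q.1 q.2 t :=
    intervalIntegral.continuous_parametric_intervalIntegral_of_continuous'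
      (f := fun (q : ℝ × ℝ) t => Φ q.1 q.2 t)
      (hΦ.comp ((continuous_fst.comp continuous_fst).prodMk
        ((continuous_snd.comp continuous_fst).prodMk continuous_snd))) _ _
  exact intervalIntegral.continuous_parametric_intervalIntegral_of_continuous'
    (f := fun v u => ∫ t in t₀..(t₀ + 1), Φ v u t) h1 _ _

lemma integral_swap_of_continuous {f : ℝ → ℝ → ℝ} (hf : Continuous fun q : ℝ × ℝ => f q.1 q.2)
    (a b a' b' : ℝ) :
    ∫ x in a..b, ∫ y in a'..b', f x y = ∫ y in a'..b', ∫ x in a..b, f x y :=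
  intervalIntegral_intervalIntegral_swap <|
    (hf.continuousOn.integrableOn_compact
      ((isCompact_uIcc (a := a) (b := b)).prod (isCompact_uIcc (a := a') (b := b')))).mono_set
      (Set.prod_mono Set.uIoc_subset_uIcc Set.uIoc_subset_uIcc)

lemma integral_boxInt_swap {t₀ : ℝ} {Φ : ℝ → ℝ → ℝ → ℝ}
    (hΦ : Continuous fun z : ℝ × ℝ × ℝ => Φ z.1 z.2.1 z.2.2) :
    ∫ v in (0 : ℝ)..1, boxInt t₀ (Φ v) = boxInt t₀ fun u t => ∫ v in (0 : ℝ)..1, Φ v u t := by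
  have h1 : Continuous fun q : ℝ × ℝ => ∫ t in t₀..(t₀ + 1), Φ q.1 q.2 t :=
    intervalIntegral.continuous_parametric_intervalIntegral_of_continuous'
      (f := fun (q : ℝ × ℝ) t => Φ q.1 q.2 t)
      (hΦ.comp ((continuous_fst.comp continuous_fst).prodMk
        ((continuous_snd.comp continuous_fst).prodMk continuous_snd))) _ _
  unfold boxInt
  rw [integral_swap_of_continuous h1]
  congr 1
  ext u
  exact integral_swap_of_continuous (f := fun v t => Φ v u t)
    (hΦ.comp (continuous_fst.prodMk (continuous_const.prodMk continuous_snd))) _ _ _ _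

/-- A family of functions generated by averaging, which decays exponentially, starts from a
function with bounded primitive. -/
lemma abs_integral_le_of_decay {L : ℕ → ℝ → ℝ} {ε t₀ R C ρ : ℝ} {S : Finset (ℝ × ℝ)}
    (hLc : ∀ n, Continuous (L n)) (hC : 0 ≤ C) (hρ : 0 < ρ) (hρ1 : ρ < 1) (hε : 0 ≤ ε)
    (hε1 : ε ≤ 1) (hS : S.Nonempty) (ht₀ : 0 ≤ t₀) (hR : t₀ + 1 ≤ R) (hSR : ∀ q ∈ S, |q.2| ≤ R)
    (hL : ∀ n r, -R ≤ r → |L n r| ≤ C * ρ ^ n)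
    (hrec : ∀ n r, L (n + 1) r = (1 - ε) * (∫ t in t₀..(t₀ + 1), L n (r + t)) +
      ε * ((∑ q ∈ S, L n (r + q.2)) / S.card)) {T : ℝ} (hT : 0 ≤ T) :
    |∫ r in (0 : ℝ)..T, L 0 r| ≤ 2 * R * C / (1 - ρ) := by
  have hN : (0 : ℝ) < S.card := by exact_mod_cast hS.card_pos
  have hR0 : 0 ≤ R := by linarith
  have hii : ∀ n a b, IntervalIntegrable (L n) volume a b := fun n a b =>
    (hLc n).intervalIntegrable a b
  have hshift : ∀ n τ, |τ| ≤ R →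
      |(∫ r in (0 : ℝ)..T, L n (r + τ)) - ∫ r in (0 : ℝ)..T, L n r| ≤ 2 * R * C * ρ ^ n := by
    intro n τ hτ
    have hτ' := abs_le.mp hτ
    rw [intervalIntegral.integral_comp_add_right, zero_add]
    have e : (∫ r in τ..T + τ, L n r) - ∫ r in (0 : ℝ)..T, L n r =
        (∫ r in T..T + τ, L n r) - ∫ r in (0 : ℝ)..τ, L n r := by
      have h1 := intervalIntegral.integral_add_adjacent_intervals (hii n 0 τ) (hii n τ (T + τ))
      have h2 := intervalIntegral.integral_add_adjacent_intervals (hii n 0 T) (hii n T (T + τ))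
      linarith
    have hp : 0 ≤ C * ρ ^ n := mul_nonneg hC (pow_nonneg hρ.le n)
    have b1 : |∫ r in T..T + τ, L n r| ≤ C * ρ ^ n * |T + τ - T| :=
      abs_integral_le_of_le fun r hr => hL n r <| by
        rw [Set.mem_uIcc] at hr
        rcases hr with h | h <;> linarith [h.1]
    have b2 : |∫ r in (0 : ℝ)..τ, L n r| ≤ C * ρ ^ n * |τ - 0| :=
      abs_integral_le_of_le fun r hr => hL n r <| by
        rw [Set.mem_uIcc] at hr
        rcases hr with h | h <;> linarith [h.1]
    rw [add_sub_cancel_left] at b1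
    rw [sub_zero] at b2
    have h3 := mul_le_mul_of_nonneg_left hτ hp
    rw [e]
    refine (abs_sub _ _).trans ?_
    linarith
  have hstep : ∀ n, dist (∫ r in (0 : ℝ)..T, L n r) (∫ r in (0 : ℝ)..T, L (n + 1) r) ≤
      2 * R * C * ρ ^ n := by
    intro n
    have hc2 : Continuous fun q : ℝ × ℝ => L n (q.1 + q.2) :=
      (hLc n).comp (continuous_fst.add continuous_snd)
    have hc1 : Continuous fun r => ∫ t in t₀..(t₀ + 1), L n (r + t) :=
      intervalIntegral.continuous_parametric_intervalIntegral_of_continuous'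
        (f := fun r t => L n (r + t)) hc2 _ _
    have hcs : ∀ τ, Continuous fun r => L n (r + τ) := fun τ =>
      (hLc n).comp (continuous_id.add continuous_const)
    have e1 : ∫ r in (0 : ℝ)..T, L (n + 1) r =
        (1 - ε) * (∫ r in (0 : ℝ)..T, ∫ t in t₀..(t₀ + 1), L n (r + t)) +
          ε * ((∑ q ∈ S, ∫ r in (0 : ℝ)..T, L n (r + q.2)) / S.card) := by
      simp only [hrec]
      rw [intervalIntegral.integral_add ((hc1.intervalIntegrable _ _).const_mul _)
        ((((continuous_finsetSum S fun q _ => hcs q.2).div_const _).const_mul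
          ε).intervalIntegrable _ _),
        intervalIntegral.integral_const_mul, intervalIntegral.integral_const_mul,
        intervalIntegral.integral_div,
        intervalIntegral.integral_finsetSum fun q _ => (hcs q.2).intervalIntegrable _ _]
    have e2 : ∫ r in (0 : ℝ)..T, ∫ t in t₀..(t₀ + 1), L n (r + t) =
        ∫ t in t₀..(t₀ + 1), ∫ r in (0 : ℝ)..T, L n (r + t) :=
      integral_swap_of_continuous (f := fun r t => L n (r + t)) hc2 _ _ _ _
    set I := ∫ r in (0 : ℝ)..T, L n r with hI
    have b1 : |(∫ t in t₀..(t₀ + 1), ∫ r in (0 : ℝ)..T, L n (r + t)) - I| ≤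
        2 * R * C * ρ ^ n := by
      have hc3 : Continuous fun t => ∫ r in (0 : ℝ)..T, L n (r + t) :=
        intervalIntegral.continuous_parametric_intervalIntegral_of_continuous'
          (f := fun t r => L n (r + t)) ((hLc n).comp (continuous_snd.add continuous_fst)) _ _
      have e3 : (∫ t in t₀..(t₀ + 1), ∫ r in (0 : ℝ)..T, L n (r + t)) - I =
          ∫ t in t₀..(t₀ + 1), ((∫ r in (0 : ℝ)..T, L n (r + t)) - I) := by
        rw [intervalIntegral.integral_sub (hc3.intervalIntegrable _ _)
          (continuous_const.intervalIntegrable _ _)]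
        simp
      rw [e3]
      have := abs_integral_le_of_le (a := t₀) (b := t₀ + 1)
        (f := fun t => (∫ r in (0 : ℝ)..T, L n (r + t)) - I) (B := 2 * R * C * ρ ^ n)
        fun t ht => hshift n t <| by
          rw [Set.uIcc_of_le (by linarith)] at ht
          exact abs_le.mpr ⟨by linarith [ht.1], by linarith [ht.2]⟩
      simpa using this
    have b2 : |(∑ q ∈ S, ∫ r in (0 : ℝ)..T, L n (r + q.2)) / S.card - I| ≤
        2 * R * C * ρ ^ n := by
      have e : (∑ q ∈ S, ∫ r in (0 : ℝ)..T, L n (r + q.2)) / S.card - I =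
          (∑ q ∈ S, ((∫ r in (0 : ℝ)..T, L n (r + q.2)) - I)) / S.card := by
        rw [Finset.sum_sub_distrib, Finset.sum_const, nsmul_eq_mul]
        field_simp
      rw [e, abs_div, abs_of_pos hN, div_le_iff₀ hN, mul_comm _ (S.card : ℝ), ← nsmul_eq_mul]
      exact (Finset.abs_sum_le_sum_abs _ _).trans
        (Finset.sum_le_card_nsmul _ _ _ fun q hq => hshift n q.2 (hSR q hq))
    rw [dist_comm, Real.dist_eq, e1, e2]
    rw [abs_le] at b1 b2 ⊢
    constructor <;> nlinarith
  have hlim : Tendsto (fun n => ∫ r in (0 : ℝ)..T, L n r) atTop (𝓝 0) := by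
    have h2 : Tendsto (fun n : ℕ => C * ρ ^ n * |T - 0|) atTop (𝓝 0) := by
      have := ((tendsto_pow_atTop_nhds_zero_of_lt_one hρ.le hρ1).const_mul C).mul_const |T - 0|
      simpa using this
    refine squeeze_zero_norm (fun n => ?_) h2
    refine abs_integral_le_of_le fun r hr => hL n r ?_
    rw [Set.uIcc_of_le hT] at hr
    linarith [hr.1]
  have h := dist_le_of_le_geometric_of_tendsto₀ ρ _ hρ1 hstep hlim
  rwa [dist_zero_right, Real.norm_eq_abs] at h

/-- The average of `G` over the translate by `amat (-r)` of a closed horocycle. -/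
def horoAvg (g₁ : SL2) (c : ℝ) (G : SL2 → ℝ) (r : ℝ) : ℝ :=
  ∫ v in (0 : ℝ)..1, G (g₁ * nU (c * v) * amat (-r))

lemma amat_mul_nU (r u : ℝ) : amat (-r) * nU u = nU (Real.exp (-r) * u) * amat (-r) := by
  apply SL2_ext'
  rw [SL2_mul_coe, SL2_mul_coe]
  have h : Real.exp (-r) * Real.exp (r / 2) = Real.exp (-r / 2) := by
    rw [← Real.exp_add]; congr 1; ring
  ext i j
  fin_cases i <;> fin_cases j <;> simp [nU, amat, Matrix.mul_apply]
  rw [show -(-r / 2) = r / 2 by ring]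
  linear_combination -u * h

section horoAvg
variable {g₁ : SL2} {c : ℝ} {G : SL2 → ℝ}

lemma continuous_horo_left (hG : Continuous G) (r : ℝ) :
    Continuous fun v : ℝ => G (g₁ * nU (c * v) * amat (-r)) :=
  hG.comp ((continuous_const.mul (continuous_nU.comp (continuous_const.mul continuous_id))).mul
    continuous_const)

lemma continuous_horoAvg (hG : Continuous G) : Continuous (horoAvg g₁ c G) := by
  have hc : Continuous fun q : ℝ × ℝ => G (g₁ * nU (c * q.2) * amat (-q.1)) :=
    hG.comp ((continuous_const.mul (continuous_nU.comp (continuous_const.mul continuous_snd))).mul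
      (continuous_amat.comp continuous_fst.neg))
  exact intervalIntegral.continuous_parametric_intervalIntegral_of_continuous'
    (f := fun r v => G (g₁ * nU (c * v) * amat (-r))) hc _ _

/-- Integrals over a closed horocycle are invariant under shifts of the parameter. -/
lemma integral_horo_shift (hc : c ≠ 0) {γ₀ : SL2} (h₀ : γ₀ * g₁ = g₁ * nU c)
    (hG : ∀ g, G (γ₀ * g) = G g) (x r : ℝ) :
    ∫ v in (0 : ℝ)..1, G (g₁ * nU (c * v + x) * amat (-r)) = horoAvg g₁ c G r := by
  have hper : Function.Periodic (fun v => G (g₁ * nU (c * v) * amat (-r))) 1 := fun v => by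
    have e : g₁ * nU (c * (v + 1)) * amat (-r) = γ₀ * (g₁ * nU (c * v) * amat (-r)) := by
      rw [← mul_assoc, ← mul_assoc, h₀, mul_assoc g₁ (nU c), ← nU_add]
      congr 3
      ring
    simp only
    rw [e, hG]
  have e2 : ∀ v, c * v + x = c * (v + x / c) := fun v => by field_simp
  simp only [e2]
  rw [intervalIntegral.integral_comp_add_right
    (fun v => G (g₁ * nU (c * v) * amat (-r))), zero_add, add_comm 1]
  have := hper.intervalIntegral_add_eq (x / c) 0
  rw [zero_add] at this
  exact this

lemma horoAvg_mul_na (hc : c ≠ 0) {γ₀ : SL2} (h₀ : γ₀ * g₁ = g₁ * nU c)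
    (hG : ∀ g, G (γ₀ * g) = G g) (u t r : ℝ) :
    horoAvg g₁ c (fun g => G (g * na u t)) r = horoAvg g₁ c G (r + t) := by
  have e : ∀ v, g₁ * nU (c * v) * amat (-r) * na u t =
      g₁ * nU (c * v + Real.exp (-r) * u) * amat (-(r + t)) := fun v => by
    have h := amat_mul_nU r u
    rw [nU_add, na, neg_add, amat_add]
    simp only [mul_assoc]
    rw [← mul_assoc (amat (-r)), h]
    simp only [mul_assoc]
  rw [← integral_horo_shift hc h₀ hG (Real.exp (-r) * u) (r + t)]
  simp only [horoAvg, e]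

lemma horoAvg_avg (hGc : Continuous G) (hc : c ≠ 0) {γ₀ : SL2} (h₀ : γ₀ * g₁ = g₁ * nU c)
    (hG : ∀ g, G (γ₀ * g) = G g) (ε t₀ : ℝ) (S : Finset (ℝ × ℝ)) (r : ℝ) :
    horoAvg g₁ c (avg ε t₀ S G) r = (1 - ε) * (∫ t in t₀..(t₀ + 1), horoAvg g₁ c G (r + t)) +
      ε * ((∑ q ∈ S, horoAvg g₁ c G (r + q.2)) / S.card) := by
  have hc3 : Continuous fun z : ℝ × ℝ × ℝ =>
      G (g₁ * nU (c * z.1) * amat (-r) * na z.2.1 z.2.2) :=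
    hGc.comp (((continuous_const.mul (continuous_nU.comp
      (continuous_const.mul continuous_fst))).mul continuous_const).mul
        ((continuous_nU.comp (continuous_fst.comp continuous_snd)).mul
          (continuous_amat.comp (continuous_snd.comp continuous_snd).neg)))
  have hq : ∀ u t, Continuous fun v => G (g₁ * nU (c * v) * amat (-r) * na u t) := fun u t =>
    hGc.comp (((continuous_const.mul (continuous_nU.comp
      (continuous_const.mul continuous_id))).mul continuous_const).mul continuous_const)
  have hb : ∀ v, avg ε t₀ S G (g₁ * nU (c * v) * amat (-r)) =
      (1 - ε) * boxInt t₀ (fun u t => G (g₁ * nU (c * v) * amat (-r) * na u t)) +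
      ε * ((∑ q ∈ S, G (g₁ * nU (c * v) * amat (-r) * na q.1 q.2)) / S.card) := fun v => rfl
  have e1 : ∫ v in (0 : ℝ)..1, boxInt t₀ (fun u t => G (g₁ * nU (c * v) * amat (-r) * na u t)) =
      ∫ t in t₀..(t₀ + 1), horoAvg g₁ c G (r + t) := by
    rw [integral_boxInt_swap (Φ := fun v u t => G (g₁ * nU (c * v) * amat (-r) * na u t)) hc3]
    have := fun u t => horoAvg_mul_na hc h₀ hG u t r
    simp only [horoAvg] at this ⊢
    simp [boxInt, this]
  have hcb : Continuous fun v =>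
      boxInt t₀ (fun u t => G (g₁ * nU (c * v) * amat (-r) * na u t)) :=
    continuous_boxInt_param (Φ := fun v u t => G (g₁ * nU (c * v) * amat (-r) * na u t)) hc3
  rw [← e1]
  have := fun u t => horoAvg_mul_na hc h₀ hG u t r
  simp only [horoAvg] at this
  simp only [horoAvg, hb]
  rw [intervalIntegral.integral_add ((hcb.intervalIntegrable _ _).const_mul _)
      ((((continuous_finsetSum S fun q _ => hq q.1 q.2).div_const _).const_mul
        ε).intervalIntegrable _ _),
    intervalIntegral.integral_const_mul, intervalIntegral.integral_const_mul,
    intervalIntegral.integral_div,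
    intervalIntegral.integral_finsetSum fun q _ => (hq q.1 q.2).intervalIntegrable _ _]
  simp only [this]

end horoAvg

lemma exists_le_of_drift {φ : ℝ → ℝ} (hφ : Continuous φ) {T b : ℝ} (hT : 0 < T)
    (h : ∀ r, φ (r + T) ≤ 1 / 2 * φ r + b) (R : ℝ) : ∃ B, ∀ r, -R ≤ r → φ r ≤ B := by
  obtain ⟨B, hB⟩ := (isCompact_Icc (a := -R) (b := -R + T)).bddAbove_image hφ.continuousOn
  have hB' : ∀ r, -R ≤ r → r ≤ -R + T → φ r ≤ B := fun r h1 h2 =>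
    hB (Set.mem_image_of_mem _ ⟨h1, h2⟩)
  have hn : ∀ n : ℕ, ∀ r, -R ≤ r → r ≤ -R + T + n * T → φ r ≤ max B (2 * b) := by
    intro n
    induction n with
    | zero =>
      intro r h1 h2
      exact (hB' r h1 (by simpa using h2)).trans (le_max_left _ _)
    | succ n ih =>
      intro r h1 h2
      by_cases hr : r ≤ -R + T
      · exact (hB' r h1 hr).trans (le_max_left _ _)
      · push Not at hr
        push_cast at h2
        have h3 := ih (r - T) (by linarith) (by linarith)
        have h4 := h (r - T)
        rw [sub_add_cancel] at h4
        linarith [le_max_right B (2 * b)]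
  refine ⟨max B (2 * b), fun r hr => ?_⟩
  obtain ⟨n, hn'⟩ := exists_nat_ge ((r + R) / T)
  rw [div_le_iff₀ hT] at hn'
  exact hn n r hr (by linarith)

lemma exists_horoAvg_ht_le {Γ : Subgroup SL2} (hΓ : IsDisc Γ) {g₁ γ₀ : SL2} {c t b : ℝ}
    (hc : c ≠ 0) (hγ₀ : γ₀ ∈ Γ) (h₀ : γ₀ * g₁ = g₁ * nU c) (ht0 : 0 < t)
    (hb : ∀ g, ∫ u in (0 : ℝ)..1, ht Γ (g * na u t) ≤ 1 / 2 * ht Γ g + b) (R : ℝ) :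
    ∃ B, ∀ r, -R ≤ r → horoAvg g₁ c (ht Γ) r ≤ B := by
  have hVc : Continuous (ht Γ) := continuous_ht hΓ
  refine exists_le_of_drift (continuous_horoAvg hVc) ht0 (b := b) (fun r => ?_) R
  have hc2 : Continuous fun q : ℝ × ℝ =>
      ht Γ (g₁ * nU (c * q.1) * amat (-r) * na q.2 t) :=
    hVc.comp (((continuous_const.mul (continuous_nU.comp
      (continuous_const.mul continuous_fst))).mul continuous_const).mul
        ((continuous_nU.comp continuous_snd).mul continuous_const))
  have e : horoAvg g₁ c (ht Γ) (r + t) = ∫ v in (0 : ℝ)..1, ∫ u in (0 : ℝ)..1,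
      ht Γ (g₁ * nU (c * v) * amat (-r) * na u t) := by
    rw [integral_swap_of_continuous
      (f := fun v u => ht Γ (g₁ * nU (c * v) * amat (-r) * na u t)) hc2]
    have := fun u => horoAvg_mul_na hc h₀ (ht_mul_left hγ₀) u t r
    simp only [horoAvg] at this ⊢
    simp [this]
  have hcl : Continuous fun v => ht Γ (g₁ * nU (c * v) * amat (-r)) := continuous_horo_left hVc r
  have hci : Continuous fun v => ∫ u in (0 : ℝ)..1,
      ht Γ (g₁ * nU (c * v) * amat (-r) * na u t) :=
    intervalIntegral.continuous_parametric_intervalIntegral_of_continuous'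
      (f := fun v u => ht Γ (g₁ * nU (c * v) * amat (-r) * na u t)) hc2 _ _
  have hcr : Continuous fun v => 1 / 2 * ht Γ (g₁ * nU (c * v) * amat (-r)) + b :=
    (continuous_const.mul hcl).add continuous_const
  rw [e]
  refine (intervalIntegral.integral_mono_on (μ := volume)
    (g := fun v => 1 / 2 * ht Γ (g₁ * nU (c * v) * amat (-r)) + b) zero_le_one
    (hci.intervalIntegrable _ _) (hcr.intervalIntegrable _ _) fun v _ => hb _).trans ?_
  rw [intervalIntegral.integral_add ((hcl.intervalIntegrable _ _).const_mul _)
    (continuous_const.intervalIntegrable _ _), intervalIntegral.integral_const_mul]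
  simp [horoAvg]

/-- The averages over the expanding translates of a closed horocycle have bounded primitive. -/
theorem exists_integral_horoAvg_le {Γ : Subgroup SL2} (hlat : IsLatticeSL2 Γ) (hΓ : IsDisc Γ)
    {μ : Measure (XQuot Γ)} [IsProbabilityMeasure μ]
    (hinv : ∀ g : SL2, Measure.map (fun x => rmul Γ x g) μ = μ)
    {g₁ γ₀ : SL2} {c : ℝ} (hc : c ≠ 0) (hγ₀ : γ₀ ∈ Γ) (h₀ : γ₀ * g₁ = g₁ * nU c) :
    ∃ C, 0 ≤ C ∧ ∀ F : XQuot Γ → ℝ, ∀ M : ℝ, 0 ≤ M → (∀ x, |F x| ≤ M) →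
      LipW (fun _ => 1) (fun g => F (qmk Γ g)) M → ∀ T, 0 ≤ T →
      |∫ r in (0 : ℝ)..T, (horoAvg g₁ c (fun g => F (qmk Γ g)) r - ∫ x, F x ∂μ)| ≤ C * M := by
  obtain ⟨t₀, b, S, ε, β, K, ρ, ht₀, hb0, hb, hS, hε, hε1, hβ, hβ1, hK, hρ, hρ1, hcon⟩ :=
    exists_contraction hlat hΓ hc hγ₀ h₀
  obtain ⟨C, hC, hdec⟩ := exists_decay hΓ ht₀ hε.le hε1.le hS hβ.le hρ hρ1 hcon hinv
  set R := ∑ q ∈ S, |q.2| + t₀ + 1 with hR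
  have hsum : 0 ≤ ∑ q ∈ S, |q.2| := Finset.sum_nonneg fun q _ => abs_nonneg _
  have hSR : ∀ q ∈ S, |q.2| ≤ R := fun q hq => by
    have h1 : |q.2| ≤ ∑ q ∈ S, |q.2| :=
      Finset.single_le_sum (f := fun q : ℝ × ℝ => |q.2|) (fun q _ => abs_nonneg _) hq
    linarith
  have hRt : t₀ + 1 ≤ R := by linarith
  clear_value R
  obtain ⟨B, hB⟩ := exists_horoAvg_ht_le hΓ hc hγ₀ h₀ (t := t₀ + 1) (by linarith)
    (hb (t₀ + 1) ⟨by linarith, le_rfl⟩) R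
  set B' := max B 0 with hB'
  have hB0 : 0 ≤ B' := le_max_right _ _
  have hVc : Continuous (ht Γ) := continuous_ht hΓ
  have hV1 := one_le_ht hΓ
  refine ⟨2 * R * (C * (1 + β * B')) / (1 - ρ), div_nonneg (mul_nonneg (by linarith)
    (mul_nonneg hC (by nlinarith))) (by linarith), fun F M hM hFM hL T hT => ?_⟩
  have hd := hdec F M M hM hFM (fun g g' => by
      have h1 := abs_le.mp (hFM (qmk Γ g))
      have h2 := abs_le.mp (hFM (qmk Γ g'))
      have h3 : 0 ≤ β * ht Γ g := mul_nonneg hβ.le (by linarith [hV1 g])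
      have h4 : 0 ≤ β * ht Γ g' := mul_nonneg hβ.le (by linarith [hV1 g'])
      nlinarith [mul_nonneg hM h3, mul_nonneg hM h4])
    (fun g p => by
      have h1 := hL g p
      have h3 : 0 ≤ β * ht Γ g := mul_nonneg hβ.le (by linarith [hV1 g])
      have h5 : 0 ≤ M * dev p := mul_nonneg hM (dev_nonneg p)
      have h6 := mul_le_mul_of_nonneg_right (show 1 ≤ K by linarith) h5
      have h7 : K * (M * dev p) * 1 ≤ K * (M * dev p) * (1 + β * ht Γ g) :=
        mul_le_mul_of_nonneg_left (by linarith) (by linarith)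
      simp only [mul_one] at h1 h7
      calc _ ≤ M * dev p := h1
        _ ≤ K * (M * dev p) := by linarith
        _ ≤ K * (M * dev p) * (1 + β * ht Γ g) := h7
        _ = _ := by ring)
  set m := ∫ x, F x ∂μ with hm
  clear_value m
  have hGc : ∀ n, Continuous fun g => (avgX ε t₀ S)^[n] F (qmk Γ g) := fun n =>
    continuous_iff_qmk.mp (hd n).1
  have hGi : ∀ n, ∀ g, (avgX ε t₀ S)^[n] F (qmk Γ (γ₀ * g)) = (avgX ε t₀ S)^[n] F (qmk Γ g) :=
    fun n g => by rw [qmk_mul_left hγ₀]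
  have hGa : ∀ n, (fun g => (avgX ε t₀ S)^[n + 1] F (qmk Γ g)) =
      avg ε t₀ S fun g => (avgX ε t₀ S)^[n] F (qmk Γ g) := fun n => by
    ext g
    rw [Function.iterate_succ_apply', avgX_qmk]
  have hN : (S.card : ℝ) ≠ 0 := by exact_mod_cast hS.card_pos.ne'
  have key := abs_integral_le_of_decay
    (L := fun n r => horoAvg g₁ c (fun g => (avgX ε t₀ S)^[n] F (qmk Γ g)) r - m)
    (ε := ε) (t₀ := t₀) (R := R) (C := C * M * (1 + β * B')) (ρ := ρ) (S := S)
    (fun n => (continuous_horoAvg (hGc n)).sub continuous_const)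
    (mul_nonneg (mul_nonneg hC hM) (by nlinarith)) hρ hρ1 hε.le hε1.le hS ht₀ hRt hSR
    ?_ ?_ hT
  · simp only [Function.iterate_zero, id_eq] at key
    refine key.trans (le_of_eq ?_)
    ring
  · intro n r hr
    have hcl : Continuous fun v => ht Γ (g₁ * nU (c * v) * amat (-r)) :=
      continuous_horo_left hVc r
    have e1 : horoAvg g₁ c (fun g => (avgX ε t₀ S)^[n] F (qmk Γ g)) r - m =
        ∫ v in (0 : ℝ)..1, ((avgX ε t₀ S)^[n] F (qmk Γ (g₁ * nU (c * v) * amat (-r))) - m) := by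
      rw [intervalIntegral.integral_sub ((continuous_horo_left (hGc n) r).intervalIntegrable _ _)
        (continuous_const.intervalIntegrable _ _)]
      simp [horoAvg]
    have hP : 0 ≤ C * M * ρ ^ n := mul_nonneg (mul_nonneg hC hM) (pow_nonneg hρ.le n)
    have e2 : ∫ v in (0 : ℝ)..1, C * M * ρ ^ n * (1 + β * ht Γ (g₁ * nU (c * v) * amat (-r))) =
        C * M * ρ ^ n * (1 + β * horoAvg g₁ c (ht Γ) r) := by
      rw [intervalIntegral.integral_const_mul, intervalIntegral.integral_add
        (continuous_const.intervalIntegrable _ _) ((hcl.intervalIntegrable _ _).const_mul _),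
        intervalIntegral.integral_const_mul]
      simp [horoAvg]
    have e3 : |horoAvg g₁ c (fun g => (avgX ε t₀ S)^[n] F (qmk Γ g)) r - m| ≤
        C * M * ρ ^ n * (1 + β * horoAvg g₁ c (ht Γ) r) := by
      rw [e1, ← e2, ← Real.norm_eq_abs]
      exact intervalIntegral.norm_integral_le_of_norm_le zero_le_one
        (Eventually.of_forall fun v _ => (hd n).2 _)
        ((continuous_const.mul (continuous_const.add
          (continuous_const.mul hcl))).intervalIntegrable _ _)
    have e4 : β * horoAvg g₁ c (ht Γ) r ≤ β * B' :=
      mul_le_mul_of_nonneg_left ((hB r hr).trans (le_max_left _ _)) hβ.le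
    have e5 := mul_le_mul_of_nonneg_left
      (show 1 + β * horoAvg g₁ c (ht Γ) r ≤ 1 + β * B' by linarith) hP
    refine e3.trans (e5.trans (le_of_eq ?_))
    ring
  · intro n r
    have hh : Continuous fun t => horoAvg g₁ c (fun g => (avgX ε t₀ S)^[n] F (qmk Γ g)) (r + t) :=
      (continuous_horoAvg (hGc n)).comp (continuous_const.add continuous_id)
    rw [hGa, horoAvg_avg (hGc n) hc h₀ (hGi n), intervalIntegral.integral_sub
      (hh.intervalIntegrable _ _) (continuous_const.intervalIntegrable _ _),
      Finset.sum_sub_distrib, Finset.sum_const, nsmul_eq_mul]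
    simp
    field_simp
    ring

lemma exists_nm_le_of_isCompact {Γ : Subgroup SL2} {K : Set (XQuot Γ)} (hK : IsCompact K) :
    ∃ C : ℝ, ∀ x ∈ K, ∃ g : SL2, nm g.1 ≤ C ∧ qmk Γ g = x := by
  have ho : ∀ n : ℕ, IsOpen (qmk Γ '' {g : SL2 | nm g.1 < n}) := fun n =>
    isOpenQuotientMap_qmk.isOpenMap _
      (isOpen_lt (continuous_nm.comp continuous_coe_SL2) continuous_const)
  have hm : Monotone fun n : ℕ => qmk Γ '' {g : SL2 | nm g.1 < n} := fun m n hmn =>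
    Set.image_mono fun g (hg : nm g.1 < m) => hg.trans_le (by exact_mod_cast hmn)
  obtain ⟨n, hn⟩ := hK.elim_directed_cover _ ho (fun x _ => by
    obtain ⟨g, rfl⟩ := qmk_surjective x
    obtain ⟨n, hn⟩ := exists_nat_gt (nm g.1)
    exact Set.mem_iUnion.mpr ⟨n, g, hn, rfl⟩) hm.directed_le
  exact ⟨n, fun x hx => by
    obtain ⟨g, hg, e⟩ := hn hx
    exact ⟨g, hg.le, e⟩⟩

lemma exists_lipschitz_of_contDiff {Ψ : (Fin 2 → Fin 2 → ℝ) → ℝ}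
    (hΨ : ContDiff ℝ (⊤ : ℕ∞) Ψ) (C : ℝ) :
    ∃ L, 0 ≤ L ∧ ∀ A B : Matrix (Fin 2) (Fin 2) ℝ, nm A ≤ C → nm B ≤ C →
      |Ψ (fun i j => A i j) - Ψ (fun i j => B i j)| ≤ L * nm (A - B) := by
  have hK : IsCompact (Set.univ.pi fun _ : Fin 2 => Set.univ.pi fun _ : Fin 2 =>
      Set.Icc (-C) C) :=
    isCompact_univ_pi fun _ => isCompact_univ_pi fun _ => isCompact_Icc
  have hconv : Convex ℝ (Set.univ.pi fun _ : Fin 2 => Set.univ.pi fun _ : Fin 2 =>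
      Set.Icc (-C) C) :=
    convex_pi fun _ _ => convex_pi fun _ _ => convex_Icc _ _
  obtain ⟨L, hL⟩ := hK.exists_bound_of_continuousOn
    (hΨ.continuous_fderiv (by simp)).continuousOn
  have hmem : ∀ A : Matrix (Fin 2) (Fin 2) ℝ, nm A ≤ C → (fun i j => A i j) ∈
      Set.univ.pi fun _ : Fin 2 => Set.univ.pi fun _ : Fin 2 => Set.Icc (-C) C :=
    fun A hA i _ j _ => abs_le.mp ((abs_entry_le_nm A i j).trans hA)
  refine ⟨max L 0, le_max_right _ _, fun A B hA hB => ?_⟩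
  have h := hconv.norm_image_sub_le_of_norm_fderiv_le (𝕜 := ℝ)
    (fun x _ => (hΨ.differentiable (by simp)).differentiableAt)
    (fun x hx => (hL x hx).trans (le_max_left L 0)) (hmem B hB) (hmem A hA)
  rw [Real.norm_eq_abs] at h
  refine h.trans (mul_le_mul_of_nonneg_left ?_ (le_max_right _ _))
  refine (pi_norm_le_iff_of_nonneg (nm_nonneg _)).mpr fun i =>
    (pi_norm_le_iff_of_nonneg (nm_nonneg _)).mpr fun j => ?_
  exact abs_entry_le_nm (A - B) i j

/-- A smooth compactly supported function is bounded, and Lipschitz for right translations. -/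
theorem exists_lipW_of_isSmoothQuot {Γ : Subgroup SL2} {ψ : XQuot Γ → ℝ}
    (hsmooth : IsSmoothQuot Γ ψ) (hsupp : HasCompactSupport ψ) :
    ∃ L, 0 ≤ L ∧ (∀ x, |ψ x| ≤ L) ∧ LipW (fun _ => 1) (fun g => ψ (qmk Γ g)) L := by
  obtain ⟨Ψ, hΨ, hψ⟩ := hsmooth
  obtain ⟨C₁, hC₁⟩ := exists_nm_le_of_isCompact (Γ := Γ) hsupp
  set C := max C₁ 0 with hC
  have hC0 : 0 ≤ C := le_max_right _ _
  have hcov : ∀ x, ψ x ≠ 0 → ∃ g : SL2, nm g.1 ≤ C ∧ qmk Γ g = x := fun x hx => by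
    obtain ⟨g, h1, h2⟩ := hC₁ x (subset_tsupport _ hx)
    exact ⟨g, h1.trans (le_max_left _ _), h2⟩
  clear_value C
  obtain ⟨L₁, hL₁, hLip⟩ := exists_lipschitz_of_contDiff hΨ (3 * C)
  have hcont : Continuous fun g => ψ (qmk Γ g) := by
    simp only [hψ]
    exact hΨ.continuous.comp continuous_coe_SL2
  obtain ⟨B, hB⟩ := (isCompact_nm_le C).exists_bound_of_continuousOn hcont.continuousOn
  have hB0 : 0 ≤ max B 0 := le_max_right _ _
  have hbd : ∀ x, |ψ x| ≤ max B 0 := fun x => by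
    by_cases hx : ψ x = 0
    · rw [hx, abs_zero]
      exact le_max_right _ _
    · obtain ⟨g, h1, rfl⟩ := hcov x hx
      exact (hB g h1).trans (le_max_left _ _)
  have hnear : ∀ g p : SL2, nm g.1 ≤ C → dev p ≤ 1 →
      |ψ (qmk Γ (g * p)) - ψ (qmk Γ g)| ≤ L₁ * C * dev p := fun g p hg hp => by
    rw [hψ, hψ]
    have h1 : nm (g * p).1 ≤ 3 * C := by
      rw [SL2_mul_coe]
      have h2 := nm_le_dev p
      have h3 := nm_mul_le g.1 p.1
      nlinarith [nm_nonneg g.1, nm_nonneg p.1]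
    have h4 : nm ((g * p).1 - g.1) ≤ C * dev p := by
      have e : (g * p).1 - g.1 = g.1 * (p.1 - 1) := by rw [mul_sub, mul_one, SL2_mul_coe]
      rw [e]
      exact (nm_mul_le _ _).trans (mul_le_mul_of_nonneg_right hg (dev_nonneg p))
    refine (hLip (g * p).1 g.1 h1 (by linarith)).trans ?_
    rw [mul_assoc]
    exact mul_le_mul_of_nonneg_left h4 hL₁
  have hP : 0 ≤ L₁ * C := mul_nonneg hL₁ hC0
  refine ⟨L₁ * C + 2 * max B 0, by linarith, fun x => (hbd x).trans (by linarith),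
    fun g p => ?_⟩
  simp only [mul_one]
  have hdp := dev_nonneg p
  by_cases hp : dev p ≤ 1
  · suffices h : |ψ (qmk Γ (g * p)) - ψ (qmk Γ g)| ≤ L₁ * C * dev p by
      nlinarith [mul_nonneg hB0 hdp]
    by_cases h1 : ψ (qmk Γ g) = 0
    · by_cases h2 : ψ (qmk Γ (g * p)) = 0
      · rw [h1, h2, sub_zero, abs_zero]
        exact mul_nonneg hP hdp
      · obtain ⟨k, hk, e⟩ := hcov _ h2
        have e2 : qmk Γ g = qmk Γ (k * p⁻¹) := by
          rw [← rmul_qmk, e, rmul_qmk, mul_inv_cancel_right]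
        have := hnear k p⁻¹ hk (by rwa [dev_inv])
        rw [dev_inv] at this
        rwa [e2, ← e, abs_sub_comm]
    · obtain ⟨k, hk, e⟩ := hcov _ h1
      have := hnear k p hk hp
      rwa [← rmul_qmk, e, rmul_qmk] at this
  · push Not at hp
    have h1 := abs_le.mp (hbd (qmk Γ (g * p)))
    have h2 := abs_le.mp (hbd (qmk Γ g))
    have h3 : |ψ (qmk Γ (g * p)) - ψ (qmk Γ g)| ≤ 2 * max B 0 :=
      abs_le.mpr ⟨by linarith [h1.1, h2.2], by linarith [h1.2, h2.1]⟩
    nlinarith [mul_nonneg hP hdp]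

lemma dev_amat_le {δ κ : ℝ} (h0 : 0 ≤ δ) (h1 : δ ≤ κ) : dev (amat δ) ≤ Real.exp (κ / 2) * δ := by
  have e : dev (amat δ) = |Real.exp (δ / 2) - 1| + |Real.exp (-(δ / 2)) - 1| := by
    simp [dev, nm, amat]
  have p1 : 1 ≤ Real.exp (δ / 2) := Real.one_le_exp (by linarith)
  have p2 : Real.exp (-(δ / 2)) ≤ 1 := Real.exp_le_one_iff.mpr (by linarith)
  have p3 := Real.add_one_le_exp (-(δ / 2))
  have p4 : Real.exp (δ / 2) ≤ Real.exp (κ / 2) := Real.exp_le_exp.mpr (by linarith)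
  have p5 : Real.exp (δ / 2) * Real.exp (-(δ / 2)) = 1 := by rw [← Real.exp_add]; simp
  have p6 : Real.exp (δ / 2) - 1 ≤ Real.exp (δ / 2) * (δ / 2) := by nlinarith
  rw [e, abs_of_nonneg (by linarith), abs_of_nonpos (by linarith)]
  nlinarith

lemma log_exp_add_bounds {κ : ℝ} (hκ : 0 ≤ κ) (s : ℝ) : s ≤ Real.log (Real.exp s + κ) ∧
    Real.log (Real.exp s + κ) ≤ s + κ * Real.exp (-s) := by
  have hp := Real.exp_pos s
  constructor
  · rw [Real.le_log_iff_exp_le (by linarith)]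
    linarith
  · rw [Real.log_le_iff_le_exp (by linarith), Real.exp_add]
    have h := Real.add_one_le_exp (κ * Real.exp (-s))
    have e : Real.exp s * Real.exp (-s) = 1 := by rw [← Real.exp_add]; simp
    nlinarith

lemma integral_exp_neg_le {S : ℝ} : ∫ s in (0 : ℝ)..S, Real.exp (-s) ≤ 1 := by
  rw [intervalIntegral.integral_comp_neg (fun s => Real.exp s), integral_exp]
  simp [Real.exp_nonneg]

/-- Moving the base point of an expanding orbit along its horocycle changes the orbit integral by
a bounded amount. -/
theorem abs_integral_horo_sub_le {f : SL2 → ℝ} {M : ℝ} (hM : 0 ≤ M) (hfM : ∀ g, |f g| ≤ M)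
    (hL : LipW (fun _ => 1) f M) (g₁ : SL2) (x : ℝ) {κ S : ℝ} (hκ : 0 ≤ κ) (hS : 0 ≤ S) :
    |(∫ s in (0 : ℝ)..S, f (g₁ * nU (x * (Real.exp s + κ)) * amat (s - S))) -
      ∫ s in (0 : ℝ)..S, f (g₁ * nU (x * Real.exp s) * amat (s - S))| ≤
      κ * (Real.exp (κ / 2) + 3) * M := by
  have hf := hL.continuous
  set φ := fun s => f (g₁ * nU (x * Real.exp s) * amat (s - S)) with hφ
  have hφc : Continuous φ :=
    hf.comp ((continuous_const.mul (continuous_nU.comp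
      (continuous_const.mul Real.continuous_exp))).mul
        (continuous_amat.comp (continuous_id.sub continuous_const)))
  have hφM : ∀ s, |φ s| ≤ M := fun s => hfM _
  have hpos : ∀ s, 0 < Real.exp s + κ := fun s => by linarith [Real.exp_pos s]
  set σ := fun s => Real.log (Real.exp s + κ) with hσ
  have hσc : Continuous σ :=
    (Real.continuous_exp.add continuous_const).log fun s => (hpos s).ne'
  have hexpσ : ∀ s, Real.exp (σ s) = Real.exp s + κ := fun s => Real.exp_log (hpos s)
  set σ' := fun s => Real.exp s / (Real.exp s + κ) with hσ'
  have hσ'c : Continuous σ' :=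
    Real.continuous_exp.div (Real.continuous_exp.add continuous_const) fun s => (hpos s).ne'
  have hderiv : ∀ s ∈ Set.uIcc 0 S, HasDerivAt σ (σ' s) s := fun s _ =>
    ((Real.hasDerivAt_exp s).add_const κ).log (hpos s).ne'
  have hsub : ∫ s in (0 : ℝ)..S, (φ ∘ σ) s * σ' s = ∫ s in (σ 0)..(σ S), φ s :=
    intervalIntegral.integral_comp_mul_deriv hderiv hσ'c.continuousOn hφc
  have hψc : Continuous fun s => f (g₁ * nU (x * (Real.exp s + κ)) * amat (s - S)) :=
    hf.comp ((continuous_const.mul (continuous_nU.comp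
      (continuous_const.mul (Real.continuous_exp.add continuous_const)))).mul
        (continuous_amat.comp (continuous_id.sub continuous_const)))
  have hpt : ∀ s ∈ Set.Ioc 0 S,
      ‖f (g₁ * nU (x * (Real.exp s + κ)) * amat (s - S)) - (φ ∘ σ) s * σ' s‖ ≤
        κ * (Real.exp (κ / 2) + 1) * M * Real.exp (-s) := fun s hs => by
    have hb := log_exp_add_bounds hκ s
    have he1 : Real.exp (-s) ≤ 1 := Real.exp_le_one_iff.mpr (by linarith [hs.1])
    have he0 := Real.exp_pos (-s)
    have hes : Real.exp s * Real.exp (-s) = 1 := by rw [← Real.exp_add]; simp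
    have hd0 : 0 ≤ σ s - s := by simp only [hσ]; linarith [hb.1]
    have hd1 : σ s - s ≤ κ * Real.exp (-s) := by simp only [hσ]; linarith [hb.2]
    have hdev : dev (amat (σ s - s)) ≤ Real.exp (κ / 2) * (σ s - s) :=
      dev_amat_le hd0 (hd1.trans (mul_le_of_le_one_right hκ he1))
    have e1 : g₁ * nU (x * Real.exp (σ s)) * amat (σ s - S) =
        g₁ * nU (x * (Real.exp s + κ)) * amat (s - S) * amat (σ s - s) := by
      rw [hexpσ, mul_assoc _ (amat _), ← amat_add]
      congr 2
      ring
    have h1 : |φ (σ s) - f (g₁ * nU (x * (Real.exp s + κ)) * amat (s - S))| ≤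
        M * (Real.exp (κ / 2) * (κ * Real.exp (-s))) := by
      have h := hL (g₁ * nU (x * (Real.exp s + κ)) * amat (s - S)) (amat (σ s - s))
      rw [← e1, mul_one] at h
      exact h.trans (mul_le_mul_of_nonneg_left
        (hdev.trans (mul_le_mul_of_nonneg_left hd1 (Real.exp_pos _).le)) hM)
    have h2 : 0 ≤ 1 - σ' s ∧ 1 - σ' s ≤ κ * Real.exp (-s) := by
      have e : 1 - σ' s = κ / (Real.exp s + κ) := by
        simp only [hσ']
        field_simp [(hpos s).ne']
        ring
      rw [e]
      refine ⟨div_nonneg hκ (hpos s).le, ?_⟩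
      rw [div_le_iff₀ (hpos s)]
      have := mul_nonneg (mul_nonneg hκ hκ) he0.le
      nlinarith
    have h3 : |φ (σ s) * (1 - σ' s)| ≤ M * (κ * Real.exp (-s)) := by
      rw [abs_mul, abs_of_nonneg h2.1]
      exact mul_le_mul (hφM _) h2.2 h2.1 hM
    have e2 : f (g₁ * nU (x * (Real.exp s + κ)) * amat (s - S)) - (φ ∘ σ) s * σ' s =
        φ (σ s) * (1 - σ' s) - (φ (σ s) - f (g₁ * nU (x * (Real.exp s + κ)) * amat (s - S))) := by
      simp only [Function.comp]
      ring
    rw [e2, Real.norm_eq_abs]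
    refine (abs_sub _ _).trans ((add_le_add h3 h1).trans (le_of_eq ?_))
    ring
  have hA : 0 ≤ κ * (Real.exp (κ / 2) + 1) * M :=
    mul_nonneg (mul_nonneg hκ (by linarith [Real.exp_pos (κ / 2)])) hM
  have b1 : |(∫ s in (0 : ℝ)..S, f (g₁ * nU (x * (Real.exp s + κ)) * amat (s - S))) -
      ∫ s in (σ 0)..(σ S), φ s| ≤ κ * (Real.exp (κ / 2) + 1) * M := by
    have hmc : Continuous fun s => (φ ∘ σ) s * σ' s := (hφc.comp hσc).mul hσ'c
    rw [← hsub, ← intervalIntegral.integral_sub (hψc.intervalIntegrable _ _)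
      (hmc.intervalIntegrable _ _), ← Real.norm_eq_abs]
    refine (intervalIntegral.norm_integral_le_of_norm_le hS (Eventually.of_forall hpt)
      ((continuous_const.mul (Real.continuous_exp.comp continuous_neg)).intervalIntegrable
        _ _)).trans ?_
    rw [intervalIntegral.integral_const_mul]
    exact mul_le_of_le_one_right hA integral_exp_neg_le
  have hii : ∀ a b, IntervalIntegrable φ volume a b := fun a b => hφc.intervalIntegrable a b
  have b2 : |∫ s in S..(σ S), φ s| ≤ M * |σ S - S| := abs_integral_le_of_le fun s _ => hφM s
  have b3 : |∫ s in (0 : ℝ)..(σ 0), φ s| ≤ M * |σ 0 - 0| := abs_integral_le_of_le fun s _ => hφM s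
  have l2 : |σ S - S| ≤ κ := by
    have hb := log_exp_add_bounds hκ S
    have he1 : Real.exp (-S) ≤ 1 := Real.exp_le_one_iff.mpr (by linarith)
    have := mul_le_of_le_one_right hκ he1
    rw [abs_of_nonneg (by simp only [hσ]; linarith [hb.1])]
    simp only [hσ]
    linarith [hb.2]
  have l3 : |σ 0 - 0| ≤ κ := by
    have hb := log_exp_add_bounds hκ 0
    rw [abs_of_nonneg (by simp only [hσ]; linarith [hb.1])]
    simp only [hσ]
    have := hb.2
    rw [neg_zero, Real.exp_zero, mul_one, zero_add] at this
    rw [Real.exp_zero]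
    linarith
  have e3 : (∫ s in (σ 0)..(σ S), φ s) - ∫ s in (0 : ℝ)..S, φ s =
      (∫ s in S..(σ S), φ s) - ∫ s in (0 : ℝ)..(σ 0), φ s := by
    have h1 := intervalIntegral.integral_add_adjacent_intervals (hii 0 (σ 0)) (hii (σ 0) (σ S))
    have h2 := intervalIntegral.integral_add_adjacent_intervals (hii 0 S) (hii S (σ S))
    linarith
  have m2 := mul_le_mul_of_nonneg_left l2 hM
  have m3 := mul_le_mul_of_nonneg_left l3 hM
  have b4 := abs_sub (∫ s in S..(σ S), φ s) (∫ s in (0 : ℝ)..(σ 0), φ s)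
  rw [← e3] at b4
  have b5 := abs_sub_le (∫ s in (0 : ℝ)..S, f (g₁ * nU (x * (Real.exp s + κ)) * amat (s - S)))
    (∫ s in (σ 0)..(σ S), φ s) (∫ s in (0 : ℝ)..S, φ s)
  linarith

/-- Orbit integrals along an expanding orbit based at a closed horocycle are, up to a bounded
error, proportional to the space average. -/
theorem exists_abs_integral_horo_le {Γ : Subgroup SL2} (hlat : IsLatticeSL2 Γ) (hΓ : IsDisc Γ)
    {μ : Measure (XQuot Γ)} [IsProbabilityMeasure μ]
    (hinv : ∀ g : SL2, Measure.map (fun x => rmul Γ x g) μ = μ)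
    {g₁ γ₀ : SL2} {c : ℝ} (hγ₀ : γ₀ ∈ Γ) (h₀ : γ₀ * g₁ = g₁ * nU c) {x : ℝ} (hx : x ≠ 0)
    (hcx : 0 < c / x) :
    ∃ C, 0 ≤ C ∧ ∀ F : XQuot Γ → ℝ, ∀ M : ℝ, 0 ≤ M → (∀ x, |F x| ≤ M) →
      LipW (fun _ => 1) (fun g => F (qmk Γ g)) M → ∀ S, 0 ≤ S →
      |(∫ s in (0 : ℝ)..S, F (qmk Γ (g₁ * nU (x * Real.exp s) * amat (s - S)))) -
        S * ∫ x, F x ∂μ| ≤ C * M := by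
  have hc : c ≠ 0 := fun h => by simp [h] at hcx
  obtain ⟨C, hC, hInteg⟩ := exists_integral_horoAvg_le hlat hΓ hinv hc hγ₀ h₀
  set κ := c / x with hκ
  have hxκ : x * κ = c := by rw [hκ]; field_simp
  clear_value κ
  have hA : 0 ≤ κ * (Real.exp (κ / 2) + 3) :=
    mul_nonneg hcx.le (by linarith [Real.exp_pos (κ / 2)])
  refine ⟨κ * (Real.exp (κ / 2) + 3) + C, by linarith, fun F M hM hFM hL S hS => ?_⟩
  set m := ∫ x, F x ∂μ with hm
  have h1 := hInteg F M hM hFM hL S hS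
  rw [← hm] at h1
  clear_value m
  set f := fun g => F (qmk Γ g) with hfd
  have hf : Continuous f := hL.continuous
  have hfi : ∀ g, f (γ₀ * g) = f g := fun g => by simp only [hfd]; rw [qmk_mul_left hγ₀]
  have hfM : ∀ g, |f g| ≤ M := fun g => hFM _
  have hfx : ∀ g, F (qmk Γ g) = f g := fun g => rfl
  simp only [hfx]
  clear_value f
  have hcont2 : Continuous fun q : ℝ × ℝ =>
      f (g₁ * nU (c * q.1 + x * Real.exp q.2) * amat (-(S - q.2))) :=
    hf.comp ((continuous_const.mul (continuous_nU.comp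
      ((continuous_const.mul continuous_fst).add
        (continuous_const.mul (Real.continuous_exp.comp continuous_snd))))).mul
          (continuous_amat.comp (continuous_const.sub continuous_snd).neg))
  have e1 : ∫ v in (0 : ℝ)..1, ∫ s in (0 : ℝ)..S,
      f (g₁ * nU (c * v + x * Real.exp s) * amat (-(S - s))) =
      ∫ r in (0 : ℝ)..S, horoAvg g₁ c f r := by
    rw [integral_swap_of_continuous
      (f := fun v s => f (g₁ * nU (c * v + x * Real.exp s) * amat (-(S - s)))) hcont2]
    simp only [integral_horo_shift hc h₀ hfi]
    rw [intervalIntegral.integral_comp_sub_left (fun r => horoAvg g₁ c f r), sub_self, sub_zero]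
  have e2 : ∫ r in (0 : ℝ)..S, (horoAvg g₁ c f r - m) =
      (∫ r in (0 : ℝ)..S, horoAvg g₁ c f r) - S * m := by
    rw [intervalIntegral.integral_sub ((continuous_horoAvg hf).intervalIntegrable _ _)
      (continuous_const.intervalIntegrable _ _)]
    simp
  set I := ∫ s in (0 : ℝ)..S, f (g₁ * nU (x * Real.exp s) * amat (s - S)) with hI
  have hci : Continuous fun v => ∫ s in (0 : ℝ)..S,
      f (g₁ * nU (c * v + x * Real.exp s) * amat (-(S - s))) :=
    intervalIntegral.continuous_parametric_intervalIntegral_of_continuous'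
      (f := fun v s => f (g₁ * nU (c * v + x * Real.exp s) * amat (-(S - s)))) hcont2 _ _
  have e3 : (∫ r in (0 : ℝ)..S, horoAvg g₁ c f r) - I = ∫ v in (0 : ℝ)..1,
      ((∫ s in (0 : ℝ)..S, f (g₁ * nU (c * v + x * Real.exp s) * amat (-(S - s)))) - I) := by
    rw [← e1, intervalIntegral.integral_sub (hci.intervalIntegrable _ _)
      (continuous_const.intervalIntegrable _ _)]
    simp
  have h2 : |(∫ r in (0 : ℝ)..S, horoAvg g₁ c f r) - I| ≤
      κ * (Real.exp (κ / 2) + 3) * M * |1 - 0| := by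
    rw [e3]
    refine abs_integral_le_of_le fun v hv => ?_
    rw [Set.uIcc_of_le zero_le_one] at hv
    have hv0 : 0 ≤ κ * v := mul_nonneg hcx.le hv.1
    have hvκ : κ * v ≤ κ := mul_le_of_le_one_right hcx.le hv.2
    have h := abs_integral_horo_sub_le hM hfM hL g₁ x hv0 hS
    have e4 : ∀ s, x * (Real.exp s + κ * v) = c * v + x * Real.exp s := fun s => by
      rw [← hxκ]; ring
    simp only [e4] at h
    simp only [neg_sub]
    refine h.trans (mul_le_mul_of_nonneg_right ?_ hM)
    have h5 : Real.exp (κ * v / 2) ≤ Real.exp (κ / 2) := Real.exp_le_exp.mpr (by linarith)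
    exact mul_le_mul hvκ (by linarith) (by linarith [Real.exp_pos (κ * v / 2)]) hcx.le
  rw [e2] at h1
  rw [sub_zero, abs_one, mul_one] at h2
  rw [abs_le] at h1 h2 ⊢
  constructor <;> linarith [h1.1, h1.2, h2.1, h2.2]

lemma amat_pos_eq (T : ℝ) (ω : SL2) (hω : ω.1 = !![0, 1; -1, Real.exp (-T)]) :
    amat T = kmat * nU (-(1 / 2)) * amat (-T) * ω := by
  apply SL2_ext'
  rw [SL2_mul_coe, SL2_mul_coe, SL2_mul_coe, hω]
  have h1 : Real.exp (-T / 2) * Real.exp (-T / 2) = Real.exp (-T) := by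
    rw [← Real.exp_add]; congr 1; ring
  have h2 : Real.exp (T / 2) * Real.exp (-T) = Real.exp (-T / 2) := by
    rw [← Real.exp_add]; congr 1; ring
  have h3 : -(-T / 2) = T / 2 := by ring
  have h4 : -(T / 2) = -T / 2 := by ring
  ext i j
  fin_cases i <;> fin_cases j <;> simp [amat, nU, kmat, Matrix.mul_apply, h3, h4] <;>
    linarith

lemma amat_neg_eq (T : ℝ) (ω : SL2) (hω : ω.1 = !![1, 0; -Real.exp (-T), 1]) :
    amat (-T) = kmat * nU (1 / 2) * amat (-T) * ω := by
  apply SL2_ext'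
  rw [SL2_mul_coe, SL2_mul_coe, SL2_mul_coe, hω]
  have h2 : Real.exp (T / 2) * Real.exp (-T) = Real.exp (-T / 2) := by
    rw [← Real.exp_add]; congr 1; ring
  have h3 : -(-T / 2) = T / 2 := by ring
  ext i j
  fin_cases i <;> fin_cases j <;> simp [amat, nU, kmat, Matrix.mul_apply, h3] <;>
    linarith

lemma hmat_mul_eq {p ω : SL2} {x S : ℝ} (h : p = kmat * nU x * amat (-S) * ω) (s : ℝ) :
    hmat s * p = kmat * nU (x * Real.exp s) * amat (s - S) * ω := by
  have h1 := amat_mul_nU (-s) x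
  rw [neg_neg] at h1
  calc hmat s * p = (hmat s * kmat) * nU x * amat (-S) * ω := by
        rw [h]; simp only [mul_assoc]
    _ = kmat * (amat s * nU x) * amat (-S) * ω := by
        rw [hmat_mul_kmat]; simp only [mul_assoc]
    _ = kmat * nU (x * Real.exp s) * (amat s * amat (-S)) * ω := by
        rw [h1, mul_comm x]; simp only [mul_assoc]
    _ = _ := by rw [← amat_add, sub_eq_add_neg]

lemma LipW.mul_right {f : SL2 → ℝ} {L N : ℝ} (h : LipW (fun _ => 1) f L) (hL : 0 ≤ L)
    {ω : SL2} (hω : nm ω.1 ≤ N) : LipW (fun _ => 1) (fun g => f (g * ω)) (N ^ 2 * L) := by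
  intro g p
  have h1 := h (g * ω) (ω⁻¹ * p * ω)
  have h2 := dev_conj_le ω p
  have h3 : nm ω.1 ^ 2 ≤ N ^ 2 := pow_le_pow_left₀ (nm_nonneg _) hω 2
  have h4 := mul_le_mul_of_nonneg_right h3 (dev_nonneg p)
  have e : g * ω * (ω⁻¹ * p * ω) = g * p * ω := by group
  rw [e] at h1
  have h5 := mul_le_mul_of_nonneg_left (h2.trans h4) hL
  simp only [mul_one] at h1 ⊢
  linarith

lemma exists_abs_integral_hmat_le {Γ : Subgroup SL2} (hlat : IsLatticeSL2 Γ) (hΓ : IsDisc Γ)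
    {μ : Measure (XQuot Γ)} [IsProbabilityMeasure μ]
    (hinv : ∀ g : SL2, Measure.map (fun x => rmul Γ x g) μ = μ)
    {g₀ γ₀ : SL2} {c : ℝ} (hγ₀ : γ₀ ∈ Γ) (h₀ : γ₀ * (g₀ * kmat) = g₀ * kmat * nU c)
    {x : ℝ} (hx : x ≠ 0) (hcx : 0 < c / x) {ψ : XQuot Γ → ℝ} (hsmooth : IsSmoothQuot Γ ψ)
    (hsupp : HasCompactSupport ψ) :
    ∃ C, 0 ≤ C ∧ ∀ S, 0 ≤ S → ∀ p ω : SL2, nm ω.1 ≤ 3 → p = kmat * nU x * amat (-S) * ω →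
      |(∫ s in (0 : ℝ)..S, ψ (rmul Γ (qmk Γ g₀) (hmat s * p))) - S * ∫ x, ψ x ∂μ| ≤ C := by
  obtain ⟨L, hL0, hLM, hL⟩ := exists_lipW_of_isSmoothQuot hsmooth hsupp
  obtain ⟨C, hC, hInteg⟩ := exists_abs_integral_horo_le hlat hΓ hinv hγ₀ h₀ hx hcx
  refine ⟨C * (3 ^ 2 * L), mul_nonneg hC (by linarith), fun S hS p ω hω hp => ?_⟩
  have h := hInteg (fun y => ψ (rmul Γ y ω)) (3 ^ 2 * L) (by linarith)
    (fun y => (hLM _).trans (by linarith)) (hL.mul_right hL0 hω) S hS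
  rw [integral_rmul hinv (continuous_iff_qmk.mpr hL.continuous)] at h
  have e : ∀ s, rmul Γ (qmk Γ g₀) (hmat s * p) =
      rmul Γ (qmk Γ (g₀ * kmat * nU (x * Real.exp s) * amat (s - S))) ω := fun s => by
    rw [hmat_mul_eq hp, rmul_qmk, rmul_qmk]
    simp only [mul_assoc]
  simp only [e]
  exact h

/-- main term for the integral over `[0,|T|]` along a forward-divergent geodesic. -/
theorem integral_translate_divergent_forward
    (Γ : Subgroup SL2) (hlat : IsLatticeSL2 Γ)
    (μ : Measure (XQuot Γ)) (hprob : IsProbabilityMeasure μ)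
    (hinv : ∀ g : SL2, Measure.map (fun x => rmul Γ x g) μ = μ)
    (x₀ : XQuot Γ)
    (hdiv : ∀ C : Set (XQuot Γ), IsCompact C →
      ∃ s₁ : ℝ, 0 < s₁ ∧ ∀ s : ℝ, s₁ ≤ s → rmul Γ x₀ (hmat s) ∉ C)
    (ψ : XQuot Γ → ℝ) (hsmooth : IsSmoothQuot Γ ψ) (hsupp : HasCompactSupport ψ) :
    ∃ C₀ > (0:ℝ), ∀ T : ℝ, 1 < |T| →
      |(∫ s in (0:ℝ)..|T|, ψ (rmul Γ x₀ (hmat s * amat T)))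
          - |T| * ∫ x, ψ x ∂μ| ≤ C₀ := by
  have hΓ := isDisc_of_discreteTopology Γ hlat.1
  obtain ⟨g₀, rfl⟩ := qmk_surjective x₀
  obtain ⟨c, hc, γ₀, hγ₀, h₀⟩ := exists_unipotent_of_divergent hΓ (sys_divergent hlat hdiv)
  have hsigned : ∀ x : ℝ, x ≠ 0 → ∃ C, 0 ≤ C ∧ ∀ S, 0 ≤ S → ∀ p ω : SL2, nm ω.1 ≤ 3 →
      p = kmat * nU x * amat (-S) * ω →
      |(∫ s in (0 : ℝ)..S, ψ (rmul Γ (qmk Γ g₀) (hmat s * p))) - S * ∫ x, ψ x ∂μ| ≤ C := by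
    intro x hx
    rcases lt_or_gt_of_ne (div_ne_zero hc hx) with h | h
    · refine exists_abs_integral_hmat_le (c := -c) hlat hΓ hinv (Γ.inv_mem hγ₀) ?_ hx
        (by rw [neg_div]; linarith) hsmooth hsupp
      rw [inv_mul_eq_iff_eq_mul, ← mul_assoc, h₀, mul_assoc _ (nU c), ← nU_add, add_neg_cancel,
        nU_zero, mul_one]
    · exact exists_abs_integral_hmat_le hlat hΓ hinv hγ₀ h₀ hx h hsmooth hsupp
  obtain ⟨C₁, hC₁, h₁⟩ := hsigned (-(1 / 2)) (by norm_num)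
  obtain ⟨C₂, hC₂, h₂⟩ := hsigned (1 / 2) (by norm_num)
  refine ⟨C₁ + C₂ + 1, by linarith, fun T _ => ?_⟩
  have he0 := Real.exp_pos (-|T|)
  have he1 : Real.exp (-|T|) ≤ 1 := Real.exp_le_one_iff.mpr (by linarith [abs_nonneg T])
  rcases le_or_gt 0 T with hT | hT
  · have h := h₁ |T| (abs_nonneg T) (amat T)
      ⟨!![0, 1; -1, Real.exp (-|T|)], by simp [Matrix.det_fin_two_of]⟩
      (by simp [nm]; linarith) (by rw [abs_of_nonneg hT]; exact amat_pos_eq T _ rfl)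
    linarith
  · have h := h₂ |T| (abs_nonneg T) (amat T)
      ⟨!![1, 0; -Real.exp (-|T|), 1], by simp [Matrix.det_fin_two_of]⟩
      (by simp [nm]; linarith)
      ((congrArg amat (show T = -|T| by rw [abs_of_neg hT, neg_neg])).trans
        (amat_neg_eq |T| _ rfl))
    linarith
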